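/- Let n ≥ 1 and let L₀ ⊆ E = ℝⁿ × ℝⁿ be the set L₀ = { (x,ξ) : ‖x‖² + ‖ξ‖² = 1 and x, ξ are linearly dependent }. Let 0 < r < 1/√2. Then there do not exist an open interval I containing 0 and 1, a C^∞ map Φ : E × I → E and a C^∞ function h : E × I → ℝ such that Φ(·,0) = id_E, ∂Φ/∂s(p,s) = X_{h(·,s)}(Φ(p,s)) for all (p,s) ∈ E × I, and Φ(·,1)(L₀) ⊆ { (x,ξ) ∈ E : x₁² + ξ₁² ≤ r² }. -/

import Mathlib

open scoped RealInnerProductSpace ContDiff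

noncomputable section

/-- `E = ℝⁿ × ℝⁿ`. -/
abbrev Esp (n : ℕ) : Type := EuclideanSpace ℝ (Fin n) × EuclideanSpace ℝ (Fin n)

/-- The Hamiltonian vector field `X_h(x,ξ) = (∇_ξ h(x,ξ), −∇_x h(x,ξ))` of a function
`h : E → ℝ`. -/
def hamVF {n : ℕ} (h : Esp n → ℝ) (p : Esp n) : Esp n :=
  (gradient (fun η => h (p.1, η)) p.2, - gradient (fun y => h (y, p.2)) p.1)

/-- The Lagrangian `L₀ = {(x,ξ) : ‖x‖² + ‖ξ‖² = 1, x and ξ linearly dependent}`. -/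
def elZero (n : ℕ) : Set (Esp n) :=
  {p | ‖p.1‖ ^ 2 + ‖p.2‖ ^ 2 = 1 ∧ ¬ LinearIndependent ℝ ![p.1, p.2]}

section

open Set Filter Topology

section NoRetraction

/-- A function that is Lipschitz on a closed ball and vanishes on its boundary sphere stays
Lipschitz after extension by zero. -/
lemma lipschitzWith_indicator_closedBall {W : Type*} [NormedAddCommGroup W] [NormedSpace ℝ W]
    {R : ℝ} {K : NNReal} {g : W → W} (hg : LipschitzOnWith K g (Metric.closedBall 0 R))
    (h0 : ∀ x, ‖x‖ = R → g x = 0) :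
    LipschitzWith K (indicator (Metric.closedBall 0 R) g) := by
  have key : ∀ x y : W, ‖x‖ ≤ R → R < ‖y‖ → dist (g x) 0 ≤ K * dist x y := by
    intro x y hx hy
    have hc : ContinuousOn (fun t : ℝ => ‖x + t • (y - x)‖) (Icc 0 1) := by fun_prop
    have hR : R ∈ Icc ‖x + (0 : ℝ) • (y - x)‖ ‖x + (1 : ℝ) • (y - x)‖ := by
      simp [hx, hy.le]
    obtain ⟨t, ht, hz⟩ := intermediate_value_Icc zero_le_one hc hR
    have hz' : ‖x + t • (y - x)‖ = R := hz
    have h1 := hg.dist_le_mul x (by simpa using hx) (x + t • (y - x)) (by simp [hz'])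
    rw [h0 _ hz'] at h1
    refine h1.trans (mul_le_mul_of_nonneg_left ?_ K.2)
    rw [dist_eq_norm, dist_eq_norm]
    have : x - (x + t • (y - x)) = t • (x - y) := by module
    rw [this, norm_smul, Real.norm_of_nonneg ht.1]
    exact mul_le_of_le_one_left (norm_nonneg _) ht.2
  refine LipschitzWith.of_dist_le_mul fun x y => ?_
  by_cases hx : ‖x‖ ≤ R <;> by_cases hy : ‖y‖ ≤ R
  · simpa [indicator, hx, hy] using hg.dist_le_mul x (by simpa using hx) y (by simpa using hy)
  · simpa [indicator, hx, hy] using key x y hx (not_le.1 hy)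
  · rw [dist_comm, dist_comm x y]
    simpa [indicator, hx, hy] using key y x hy (not_le.1 hx)
  · simp only [indicator, Metric.mem_closedBall, dist_zero_right, hx, hy, if_false, dist_self]
    positivity

lemma bijective_id_add_of_lipschitz {W : Type*} [NormedAddCommGroup W] [NormedSpace ℝ W]
    [CompleteSpace W] {K : NNReal} {g : W → W} (hg : LipschitzWith K g) (hK : K < 1) :
    Function.Bijective (fun x => x + g x) := by
  have hA : ApproximatesLinearOn (fun x => x + g x)
      ((ContinuousLinearEquiv.refl ℝ W : W ≃L[ℝ] W) : W →L[ℝ] W) univ K := by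
    intro x _ y _
    have : x + g x - (y + g y) - (x - y) = g x - g y := by abel
    simpa [this] using hg.norm_sub_le x y
  have hN : Subsingleton W ∨
      K < ‖(((ContinuousLinearEquiv.refl ℝ W).symm : W ≃L[ℝ] W) : W →L[ℝ] W)‖₊⁻¹ := by
    rcases subsingleton_or_nontrivial W with h | h
    · exact Or.inl h
    · right
      have : ‖(((ContinuousLinearEquiv.refl ℝ W).symm : W ≃L[ℝ] W) : W →L[ℝ] W)‖₊ = 1 := by
        ext; simp
      simpa [this] using hK
  exact ⟨injOn_univ.1 (hA.injOn hN), hA.surjective hN⟩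

open MeasureTheory Polynomial in
/-- The mean of `det (1 + t A)` is determined by its values at small `t`. -/
lemma integral_det_one_add_eq {W : Type*} [NormedAddCommGroup W] [NormedSpace ℝ W]
    [FiniteDimensional ℝ W] [MeasurableSpace W] [BorelSpace W] (μ : Measure W) (B : Set W)
    (A : W → W →L[ℝ] W) (δ V : ℝ) (hδ : 0 < δ)
    (hint : ∀ t : ℝ, IntegrableOn (fun x => (1 + t • A x).det) B μ)
    (hV : ∀ t ∈ Ioo 0 δ, ∫ x in B, (1 + t • A x).det ∂μ = V) :
    ∫ x in B, (1 + (1 : ℝ) • A x).det ∂μ = V := by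
  classical
  let d := Module.finrank ℝ W
  let b := Module.finBasis ℝ W
  let p : W → ℝ[X] := fun x =>
    Matrix.det ((X : ℝ[X]) • ((LinearMap.toMatrix b b (A x : W →ₗ[ℝ] W)).map C)
      + (1 : Matrix (Fin d) (Fin d) ℝ).map C)
  have hdeg : ∀ x, (p x).natDegree ≤ d := fun x => by
    have := natDegree_det_X_add_C_le (LinearMap.toMatrix b b (A x : W →ₗ[ℝ] W)) 1
    rwa [Fintype.card_fin] at this
  have heval : ∀ x t, (p x).eval t = (1 + t • A x).det := fun x t => by
    have h1 : (1 + t • A x).det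
        = Matrix.det (LinearMap.toMatrix b b ((1 + t • A x : W →L[ℝ] W) : W →ₗ[ℝ] W)) := by
      rw [LinearMap.det_toMatrix]
    have h2 : LinearMap.toMatrix b b ((1 + t • A x : W →L[ℝ] W) : W →ₗ[ℝ] W)
        = 1 + t • LinearMap.toMatrix b b (A x : W →ₗ[ℝ] W) := by
      rw [← LinearMap.toMatrix_one b, ← map_smul, ← map_add]; rfl
    rw [h1, h2]
    simp only [p]
    rw [← coe_evalRingHom, RingHom.map_det]
    congr 1
    ext i j
    rcases eq_or_ne i j with rfl | hij
    · simp; ring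
    · simp [hij]; ring
  let v : Fin (d + 1) → ℝ := fun i => δ * ((i : ℝ) + 1) / (d + 2)
  have hv : ∀ i, v i ∈ Ioo 0 δ := fun i => by
    have : (i : ℝ) + 1 < d + 2 := by
      have : ((i : ℕ) : ℝ) < (d + 1 : ℕ) := by exact_mod_cast i.2
      push_cast at this; linarith
    refine ⟨by positivity, ?_⟩
    rw [div_lt_iff₀ (by positivity)]
    exact mul_lt_mul_of_pos_left this hδ
  have hinj : Set.InjOn v (Finset.univ : Finset (Fin (d + 1))) := by
    intro i _ j _ hij
    have h2 : (d : ℝ) + 2 ≠ 0 := by positivity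
    simp only [v] at hij
    field_simp at hij
    exact Fin.ext (by exact_mod_cast (add_right_cancel hij))
  let w : Fin (d + 1) → ℝ := fun i => (Lagrange.basis Finset.univ v i).eval 1
  have hw : ∑ i, w i = 1 := by
    simp only [w]
    rw [← eval_finsetSum, Lagrange.sum_basis hinj ⟨0, Finset.mem_univ _⟩, eval_one]
  have hp : ∀ x, (p x).eval 1 = ∑ i, (p x).eval (v i) * w i := fun x => by
    have hlt : (p x).degree < (Finset.univ : Finset (Fin (d + 1))).card := by
      refine lt_of_le_of_lt degree_le_natDegree ?_
      rw [Finset.card_fin]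
      exact_mod_cast Nat.lt_succ_of_le (hdeg x)
    conv_lhs => rw [Lagrange.eq_interpolate hinj hlt]
    rw [Lagrange.interpolate_apply, eval_finsetSum]
    simp [w]
  calc ∫ x in B, (1 + (1 : ℝ) • A x).det ∂μ
      = ∫ x in B, ∑ i, (1 + v i • A x).det * w i ∂μ := by
        refine integral_congr_ae (Eventually.of_forall fun x => ?_)
        simp only [← heval, hp]
    _ = ∑ i, ∫ x in B, (1 + v i • A x).det * w i ∂μ :=
        integral_finsetSum _ fun i _ => (hint (v i)).mul_const _
    _ = V := by
        simp_rw [integral_mul_const, hV _ (hv _), ← Finset.mul_sum, hw, mul_one]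

/-- There is no retraction of a ball onto its boundary sphere, in the form: a continuous self-map
equal to the identity outside the unit ball has a zero. -/
theorem exists_eq_zero_of_eq_id_off_ball {W : Type*} [NormedAddCommGroup W]
    [InnerProductSpace ℝ W] [FiniteDimensional ℝ W]
    (G : W → W) (hG : Continuous G)
    (hid : ∀ x, 1 ≤ ‖x‖ → G x = x) : ∃ x, G x = 0 := by
  by_contra! hne
  let _ : MeasurableSpace W := borel W
  have : BorelSpace W := ⟨rfl⟩
  obtain ⟨P, hPs, hPd, hPe, -⟩ := hG.exists_contDiff_approx_and_eqOn (ε := fun x => ‖G x‖)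
    (S := {x | 2 ≤ ‖x‖}) (U := {x | 1 < ‖x‖}) 1 hG.norm (fun x => norm_pos_iff.2 (hne x))
    (isClosed_le continuous_const continuous_norm)
    ((isOpen_lt continuous_const continuous_norm).mem_nhdsSet.2
      fun x (hx : 2 ≤ ‖x‖) => show 1 < ‖x‖ by linarith)
    (contDiffOn_id.congr fun x (hx : 1 < ‖x‖) => hid x hx.le)
  have hP0 : ∀ x, P x ≠ 0 := fun x h => by
    have := hPd x
    rw [h, dist_zero_left] at this
    exact lt_irrefl _ this
  have hPs : ContDiff ℝ 1 P := by exact_mod_cast hPs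
  have hPid : ∀ x, 2 ≤ ‖x‖ → P x = x := fun x hx => (hPe hx).trans (hid x (by linarith))
  let ν : W → W := fun x => ‖P x‖⁻¹ • P x
  have hν : ContDiff ℝ 1 ν :=
    (((hPs.norm ℝ hP0).inv fun x => norm_ne_zero_iff.2 (hP0 x))).smul hPs
  have hν1 : ∀ x, ‖ν x‖ = 1 := fun x => by
    simp only [ν, norm_smul, norm_inv, norm_norm]
    exact inv_mul_cancel₀ (norm_ne_zero_iff.2 (hP0 x))
  let g : W → W := fun x => (3 : ℝ) • ν x - x
  have hg : ContDiff ℝ 1 g := (hν.const_smul (3 : ℝ)).sub contDiff_id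
  have hg0 : ∀ x, ‖x‖ = 3 → g x = 0 := fun x hx => by
    simp only [g, ν]
    rw [hPid x (by linarith), hx, smul_smul]
    norm_num
  let B : Set W := Metric.closedBall 0 3
  have hBc : IsCompact B := isCompact_closedBall 0 3
  obtain ⟨K, hK⟩ := hg.contDiffOn.exists_lipschitzOnWith one_ne_zero (convex_closedBall 0 3) hBc
  have hgt := lipschitzWith_indicator_closedBall hK hg0
  have hdc : Continuous fun q : ℝ × W => (1 + q.1 • fderiv ℝ g q.2).det := by
    have : Continuous (fderiv ℝ g) := hg.continuous_fderiv one_ne_zero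
    exact ContinuousLinearMap.continuous_det.comp (by fun_prop)
  have hpos : ∀ᶠ t in 𝓝 (0 : ℝ), ∀ x ∈ B, 0 < (1 + t • fderiv ℝ g x).det := by
    refine hBc.eventually_forall_of_forall_eventually fun x _ => ?_
    refine hdc.continuousAt.eventually (lt_mem_nhds ?_)
    have : (1 : W →L[ℝ] W).det = 1 := LinearMap.det_id
    simp [this]
  have hKt : ∀ᶠ t in 𝓝 (0 : ℝ), ‖t‖₊ * K < 1 := by
    have : Continuous fun t : ℝ => ‖t‖₊ * K := by fun_prop
    refine this.continuousAt.eventually (gt_mem_nhds ?_)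
    simp
  obtain ⟨δ, hδ, hδp⟩ := Metric.eventually_nhds_iff.1 (hpos.and hKt)
  have hint : ∀ t : ℝ, MeasureTheory.IntegrableOn (fun x => (1 + t • fderiv ℝ g x).det) B :=
    fun t => ((hdc.comp (Continuous.prodMk_right t)).continuousOn).integrableOn_compact hBc
  have hvol := integral_det_one_add_eq MeasureTheory.volume B (fderiv ℝ g) δ
    (MeasureTheory.volume.real B) hδ hint fun t ht => by
    obtain ⟨h1, h2⟩ := hδp (y := t) (by
      rw [dist_zero_right, Real.norm_of_nonneg ht.1.le]; exact ht.2)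
    have hbij := bijective_id_add_of_lipschitz ((lipschitzWith_smul t).comp hgt) h2
    set φ : W → W := fun x => x + ((fun x => t • x) ∘ indicator (Metric.closedBall 0 3) g) x
      with hφ
    have hin : ∀ x ∈ B, φ x = x + t • g x := fun x hx => by
      simp only [hφ, Function.comp, indicator_of_mem (show x ∈ Metric.closedBall 0 3 from hx)]
    have hout : ∀ x, x ∉ B → φ x = x := fun x hx => by
      simp only [hφ, Function.comp,
        indicator_of_notMem (show x ∉ Metric.closedBall 0 3 from hx), smul_zero, add_zero]
    have himg : (fun x => x + t • g x) '' B = B := by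
      rw [← Set.EqOn.image_eq (f₁ := φ) hin]
      ext y
      constructor
      · rintro ⟨x, hx, rfl⟩
        by_contra hy
        exact hy (by rwa [show φ x = x from hbij.1 (hout _ hy)])
      · intro hy
        obtain ⟨x, rfl⟩ := hbij.2 y
        by_cases hx : x ∈ B
        · exact ⟨x, hx, rfl⟩
        · rw [hout x hx] at hy
          exact absurd hy hx
    have hinj : InjOn (fun x => x + t • g x) B :=
      (hbij.1.injOn (s := B)).congr hin
    have hder : ∀ x ∈ B, HasFDerivWithinAt (fun x => x + t • g x)
        (1 + t • fderiv ℝ g x) B x := fun x _ =>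
      ((hasFDerivAt_id x).add
        (((hg.differentiable one_ne_zero) x).hasFDerivAt.const_smul t)).hasFDerivWithinAt
    have := MeasureTheory.integral_image_eq_integral_abs_det_fderiv_smul MeasureTheory.volume
      hBc.measurableSet hder hinj (fun _ => (1 : ℝ))
    rw [himg] at this
    rw [MeasureTheory.setIntegral_const, smul_eq_mul, mul_one] at this
    rw [this]
    refine MeasureTheory.setIntegral_congr_fun hBc.measurableSet fun x hx => ?_
    simp [abs_of_pos (h1 x hx)]
  have hdet : ∀ x, (1 + (1 : ℝ) • fderiv ℝ g x).det = 0 := fun x => by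
    have hνd : HasFDerivAt ν (fderiv ℝ ν x) x := (hν.differentiable one_ne_zero x).hasFDerivAt
    have hgd : fderiv ℝ g x = (3 : ℝ) • fderiv ℝ ν x - 1 :=
      ((hνd.const_smul (3 : ℝ)).sub (hasFDerivAt_id x)).fderiv
    have horth : ∀ v, ⟪ν x, fderiv ℝ ν x v⟫ = 0 := fun v => by
      have h1 := hνd.norm_sq
      have h2 : (fun y => ‖ν y‖ ^ 2) = fun _ => (1 : ℝ) := by ext y; simp [hν1]
      rw [h2] at h1
      have h3 := congrArg (fun L : W →L[ℝ] ℝ => L v) (h1.unique (hasFDerivAt_const _ _))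
      simpa using! h3
    by_contra hd
    have hsurj : Function.Surjective ((3 : ℝ) • fderiv ℝ ν x) := by
      rw [hgd] at hd
      have : (1 : W →L[ℝ] W) + (1 : ℝ) • ((3 : ℝ) • fderiv ℝ ν x - 1) = (3 : ℝ) • fderiv ℝ ν x := by
        rw [one_smul]; abel
      rw [this] at hd
      exact (LinearMap.equivOfDetNeZero _ hd).surjective
    obtain ⟨v, hv⟩ := hsurj (ν x)
    have h1 : ⟪ν x, ν x⟫ = 0 := by
      rw [← hv]
      nth_rewrite 1 [hv]
      simp [inner_smul_right, horth]
    rw [real_inner_self_eq_norm_sq, hν1] at h1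
    norm_num at h1
  simp only [hdet, MeasureTheory.integral_zero] at hvol
  have : 0 < MeasureTheory.volume.real B :=
    ENNReal.toReal_pos (Metric.measure_closedBall_pos _ _ (by norm_num)).ne'
      hBc.measure_lt_top.ne
  exact this.ne hvol

end NoRetraction

section Sphere

/-- Maps into the punctured space are homotopic as soon as a continuous nonvanishing function on
`[0, 1] × X` interpolates between them. -/
lemma homotopic_of_ne_zero {X W : Type*} [TopologicalSpace X] [NormedAddCommGroup W]
    (f g : C(X, {w : W // w ≠ 0})) (H : ℝ × X → W) (hH : Continuous H)
    (hne : ∀ t ∈ Icc (0 : ℝ) 1, ∀ x, H (t, x) ≠ 0) (h0 : ∀ x, H (0, x) = f x)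
    (h1 : ∀ x, H (1, x) = g x) : f.Homotopic g :=
  ⟨{ toFun := fun q => ⟨H (q.1, q.2), hne _ q.1.2 _⟩
     continuous_toFun := by fun_prop
     map_zero_left := fun x => Subtype.ext (by simpa using h0 x)
     map_one_left := fun x => Subtype.ext (by simpa using h1 x) }⟩

/-- Maps from a unit sphere into a punctured space of larger dimension are null-homotopic. -/
theorem nullhomotopic_of_finrank_lt {V W : Type*} [NormedAddCommGroup V] [InnerProductSpace ℝ V]
    [FiniteDimensional ℝ V] [NormedAddCommGroup W] [NormedSpace ℝ W] [FiniteDimensional ℝ W]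
    (hdim : Module.finrank ℝ V < Module.finrank ℝ W)
    (g : C(Metric.sphere (0 : V) 1, {w : W // w ≠ 0})) : g.Nullhomotopic := by
  have hW : Nontrivial W := Module.nontrivial_of_finrank_pos (R := ℝ) (by omega)
  rcases isEmpty_or_nonempty (Metric.sphere (0 : V) 1) with hE | hE
  · obtain ⟨w, hw⟩ := exists_ne (0 : W)
    exact ⟨⟨w, hw⟩, by
      rw [show g = ContinuousMap.const _ ⟨w, hw⟩ from ContinuousMap.ext fun x => hE.elim x]⟩
  obtain ⟨x₀, hx₀⟩ := (CompactSpace.isCompact_univ (X := Metric.sphere (0 : V) 1)).exists_isMinOn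
    univ_nonempty (f := fun x => ‖(g x : W)‖) (by fun_prop)
  set m := ‖(g x₀ : W)‖ with hm
  have hm0 : 0 < m := norm_pos_iff.2 (g x₀).2
  have hgm : ∀ x, m ≤ ‖(g x : W)‖ := fun x => hx₀.2 (mem_univ x)
  obtain ⟨G, hG⟩ := ContinuousMap.exists_restrict_eq (Metric.isClosed_sphere (x := (0 : V)) (ε := 1))
    (⟨fun x => (g x : W), by fun_prop⟩ : C(Metric.sphere (0 : V) 1, W))
  have hGg : ∀ x : Metric.sphere (0 : V) 1, G x = g x := fun x =>
    congrArg (fun f : C(Metric.sphere (0 : V) 1, W) => f x) hG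
  obtain ⟨P, hPs, hPd, -⟩ := G.continuous.exists_contDiff_approx (ε := fun _ => m / 4) 1
    continuous_const (fun _ => by positivity)
  have hPs : ContDiff ℝ 1 P := by exact_mod_cast hPs
  obtain ⟨w, hw, hwm⟩ := (hPs.dense_compl_range_of_finrank_lt_finrank hdim).exists_dist_lt 0
    (show 0 < m / 4 by positivity)
  have hPw : ∀ x, P x - w ≠ 0 := fun x h => hw ⟨x, sub_eq_zero.1 h⟩
  rw [dist_zero_left] at hwm
  have hPc := hPs.continuous
  let f : C(Metric.sphere (0 : V) 1, {w : W // w ≠ 0}) :=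
    ⟨fun x => ⟨P x - w, hPw x⟩, by fun_prop⟩
  have h1 : g.Homotopic f := by
    refine homotopic_of_ne_zero g f (fun q => (g q.2 : W) + q.1 • (P q.2 - w - g q.2))
      (by fun_prop) (fun t ht x h => ?_) (fun x => by simp) (fun x => by simp [f])
    have h2 : ‖P x - w - g x‖ < m := by
      have h3 := hPd x
      rw [hGg, dist_eq_norm] at h3
      calc ‖P x - w - g x‖ = ‖(P x - g x) - w‖ := by congr 1; abel
        _ ≤ ‖P x - g x‖ + ‖w‖ := norm_sub_le _ _
        _ < m := by linarith
    have h4 : (g x : W) = -(t • (P x - w - g x)) := eq_neg_of_add_eq_zero_left h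
    have h5 := hgm x
    rw [h4, norm_neg, norm_smul, Real.norm_of_nonneg ht.1] at h5
    nlinarith [ht.2, norm_nonneg (P x - w - g x)]
  refine ⟨⟨P 0 - w, hPw 0⟩, h1.trans ?_⟩
  exact homotopic_of_ne_zero _ _ (fun q => P ((1 - q.1) • (q.2 : V)) - w) (by fun_prop)
    (fun t _ x => hPw _) (fun x => by simp [f]) (fun x => by simp)

/-- The inclusion of the unit sphere into the punctured space is not null-homotopic. -/
theorem not_nullhomotopic_sphere {W : Type*} [NormedAddCommGroup W] [InnerProductSpace ℝ W]
    [FiniteDimensional ℝ W] (f : C(Metric.sphere (0 : W) 1, {w : W // w ≠ 0}))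
    (hf : ∀ x, (f x : W) = x) : ¬ f.Nullhomotopic := by
  rintro ⟨c, ⟨H⟩⟩
  let σ : W → unitInterval := fun x => projIcc 0 1 zero_le_one (2 - 2 * ‖x‖)
  let N : W → ℝ := fun x => max 1 ‖x‖
  have hpos : ∀ x : W, x ≠ 0 → ‖‖x‖⁻¹ • x‖ = 1 := fun x hx => by
    rw [norm_smul, norm_inv, norm_norm, inv_mul_cancel₀ (norm_ne_zero_iff.2 hx)]
  classical
  let G : W → W := fun x => if hx : x = 0 then (c : W) else
    N x • (H (σ x, ⟨‖x‖⁻¹ • x, by simpa using hpos x hx⟩) : W)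
  have hσ : Continuous σ := continuous_projIcc.comp (by fun_prop)
  have hGc : Continuous G := by
    rw [continuous_iff_continuousAt]
    intro x
    by_cases hx : x = 0
    · have : G =ᶠ[𝓝 x] fun _ => (c : W) := by
        have h2 : ∀ᶠ y in 𝓝 x, ‖y‖ < 1 / 2 := by
          refine (continuous_norm.continuousAt).eventually (gt_mem_nhds ?_)
          simp [hx]
        filter_upwards [h2] with y hy
        by_cases hy0 : y = 0
        · simp [G, hy0]
        · have h3 : σ y = 1 := projIcc_of_right_le _ (by linarith)
          have h4 : N y = 1 := max_eq_left (by linarith)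
          simp [G, hy0, h3, h4]
      exact continuousAt_const.congr this.symm
    · have hcont : Continuous fun y : {y : W // y ≠ 0} =>
          N y • (H (σ y, ⟨‖(y : W)‖⁻¹ • (y : W), by simpa using hpos y y.2⟩) : W) := by
        have h1 : Continuous fun y : {y : W // y ≠ 0} => ‖(y : W)‖⁻¹ • (y : W) :=
          (continuous_subtype_val.norm.inv₀ fun y => norm_ne_zero_iff.2 y.2).smul
            continuous_subtype_val
        have h2 : Continuous fun y : {y : W // y ≠ 0} => N y := by fun_prop
        have h3 : Continuous fun y : {y : W // y ≠ 0} =>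
            H (σ y, ⟨‖(y : W)‖⁻¹ • (y : W), by simpa using hpos y y.2⟩) := by fun_prop
        exact h2.smul (continuous_subtype_val.comp h3)
      have hon : ContinuousOn G {y | y ≠ 0} := by
        rw [continuousOn_iff_continuous_domRestrict]
        refine hcont.congr fun y => ?_
        have : (y : W) ≠ 0 := y.2
        simp [G, this]
      exact hon.continuousAt (isOpen_ne.mem_nhds hx)
  obtain ⟨x, hx⟩ := exists_eq_zero_of_eq_id_off_ball G hGc fun x hx => by
    have hx0 : x ≠ 0 := by
      rintro rfl; simp at hx; linarith
    have h3 : σ x = 0 := projIcc_of_le_left _ (by linarith)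
    have h4 : N x = ‖x‖ := max_eq_right hx
    simp [G, hx0, h3, h4, hf, smul_smul, norm_ne_zero_iff.2 hx0]
  by_cases hx0 : x = 0
  · simp [G, hx0] at hx
    exact c.2 hx
  · simp only [G, hx0, dite_false, smul_eq_zero] at hx
    rcases hx with hx | hx
    · have : 1 ≤ N x := le_max_left _ _
      linarith
    · exact (H _).2 hx

end Sphere

section Inessential

variable {U : Type*} [NormedAddCommGroup U]

/-- The part of the unit sphere on which `F` is at most `c`. -/
def sphereSublevel (F : U → ℝ) (c : ℝ) : Set U := {x | ‖x‖ = 1 ∧ F x ≤ c}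

/-- The inclusion `A ⊆ B` is inessential with respect to the unit sphere of `W`: no map from that
sphere into `A` can be detected by a map from `B` to the punctured space `W ∖ {0}`. -/
def SphereInessential (W : Type*) [NormedAddCommGroup W] (A B : Set U) : Prop :=
  ∃ hAB : A ⊆ B, ∀ (u : C(Metric.sphere (0 : W) 1, A)) (R : C(B, {w : W // w ≠ 0})),
    (R.comp ((ContinuousMap.inclusion hAB).comp u)).Nullhomotopic

variable {W : Type*} [NormedAddCommGroup W]

lemma SphereInessential.of_homotopic {A₀ B₀ A₁ B₁ : Set U} (h : SphereInessential W A₀ B₀)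
    (h₁ : A₁ ⊆ B₁) (α : C(A₁, A₀)) (β : C(B₀, B₁))
    (hαβ : (β.comp ((ContinuousMap.inclusion h.1).comp α)).Homotopic
      (ContinuousMap.inclusion h₁)) : SphereInessential W A₁ B₁ := by
  obtain ⟨h₀, hu⟩ := h
  refine ⟨h₁, fun u R => ?_⟩
  obtain ⟨y, hy⟩ := hu (α.comp u) (R.comp β)
  refine ⟨y, ContinuousMap.Homotopic.trans ?_ hy⟩
  exact ((ContinuousMap.Homotopic.refl R).comp
    (hαβ.comp (ContinuousMap.Homotopic.refl u))).symm

lemma SphereInessential.mono {A₀ B₀ A₁ B₁ : Set U} (h : SphereInessential W A₀ B₀)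
    (hA : A₁ ⊆ A₀) (hB : B₀ ⊆ B₁) : SphereInessential W A₁ B₁ :=
  h.of_homotopic (hA.trans (h.1.trans hB)) (ContinuousMap.inclusion hA)
    (ContinuousMap.inclusion hB) (ContinuousMap.Homotopic.refl _)

end Inessential

section Deformation

variable {U : Type*} [NormedAddCommGroup U]

/-- Continuous deformation of the unit sphere along which `F` does not increase and which moves
`{F ≤ c + η}` into `{F ≤ c - η}`. -/
def HasDescent (F : U → ℝ) (c η : ℝ) : Prop :=
  ∃ K : ℝ × U → U, ContinuousOn K (univ ×ˢ Metric.sphere 0 1) ∧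
    (∀ x, ‖x‖ = 1 → K (0, x) = x) ∧
    (∀ s ∈ Icc (0 : ℝ) 1, ∀ x, ‖x‖ = 1 → ‖K (s, x)‖ = 1 ∧ F (K (s, x)) ≤ F x) ∧
    ∀ x, ‖x‖ = 1 → F x ≤ c + η → F (K (1, x)) ≤ c - η

lemma SphereInessential.of_descent {W : Type*} [NormedAddCommGroup W] {F₀ F₁ : U → ℝ}
    {c c' η : ℝ} (hcc : c ≤ c') (hη : 0 ≤ η) (hF : ∀ x, ‖x‖ = 1 → |F₀ x - F₁ x| ≤ η)
    (hc : HasDescent F₁ c η) (hc' : HasDescent F₁ c' η)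
    (h : SphereInessential W (sphereSublevel F₀ c) (sphereSublevel F₀ c')) :
    SphereInessential W (sphereSublevel F₁ c) (sphereSublevel F₁ c') := by
  obtain ⟨K, hKc, hK0, hK, hK1⟩ := hc
  obtain ⟨L, hLc, hL0, hL, hL1⟩ := hc'
  have hsub : sphereSublevel F₁ c ⊆ sphereSublevel F₁ c' := fun x hx => ⟨hx.1, hx.2.trans hcc⟩
  have h1 : (1 : ℝ) ∈ Icc (0 : ℝ) 1 := ⟨zero_le_one, le_rfl⟩
  have hcont : ∀ {M : ℝ × U → U} {Y : Type _} [TopologicalSpace Y] (f : Y → ℝ × U), Continuous f →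
      (∀ y, ‖(f y).2‖ = 1) → ContinuousOn M (univ ×ˢ Metric.sphere 0 1) →
      Continuous fun y => M (f y) := fun f hf hy hM =>
    hM.comp_continuous hf fun y => ⟨mem_univ _, by simpa using hy y⟩
  refine h.of_homotopic hsub
    ⟨fun x => ⟨K (1, x), (hK 1 h1 x x.2.1).1, ?_⟩, ?_⟩
    ⟨fun x => ⟨L (1, x), (hL 1 h1 x x.2.1).1, ?_⟩, ?_⟩ (ContinuousMap.Homotopic.symm ⟨
    { toFun := fun q => ⟨L (q.1, K (q.1, q.2)), ?_⟩
      continuous_toFun := ?_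
      map_zero_left := ?_
      map_one_left := ?_ }⟩)
  · have := hK1 x x.2.1 (by linarith [x.2.2])
    have := abs_le.1 (hF _ (hK 1 h1 x x.2.1).1)
    linarith
  · exact (hcont (fun x : sphereSublevel F₁ c => ((1 : ℝ), (x : U))) (by fun_prop)
      (fun x => x.2.1) hKc).subtype_mk _
  · have := abs_le.1 (hF _ x.2.1)
    have := hL1 x x.2.1 (by linarith [x.2.2])
    linarith
  · exact (hcont (fun x : sphereSublevel F₀ c' => ((1 : ℝ), (x : U))) (by fun_prop)
      (fun x => x.2.1) hLc).subtype_mk _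
  · obtain ⟨h2, h3⟩ := hK q.1 q.1.2 q.2 q.2.2.1
    obtain ⟨h4, h5⟩ := hL q.1 q.1.2 _ h2
    exact ⟨h4, h5.trans (h3.trans (q.2.2.2.trans hcc))⟩
  · have h2 : Continuous fun q : unitInterval × sphereSublevel F₁ c => K (q.1, q.2) :=
      hcont (fun q : unitInterval × sphereSublevel F₁ c => ((q.1 : ℝ), (q.2 : U))) (by fun_prop)
        (fun q => q.2.2.1) hKc
    exact (hcont (fun q : unitInterval × sphereSublevel F₁ c => ((q.1 : ℝ), K (q.1, q.2)))
      ((continuous_subtype_val.comp continuous_fst).prodMk h2)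
        (fun q => (hK q.1 q.1.2 q.2 q.2.2.1).1) hLc).subtype_mk _
  · intro x
    refine Subtype.ext ?_
    simp only [Icc.coe_zero, hK0 x x.2.1, hL0 x x.2.1]
    rfl
  · intro x
    rfl

end Deformation

section GradientDescent

variable {U : Type*} [NormedAddCommGroup U] [InnerProductSpace ℝ U]

/-- Step of size `s` along `-v`, normalized to the unit sphere. -/
noncomputable def sphereStep (v : U → U) (s : ℝ) (x : U) : U := ‖x - s • v x‖⁻¹ • (x - s • v x)

lemma sq_norm_sub_smul_of_tangent {x w : U} (hx : ‖x‖ = 1) (hw : ⟪x, w⟫ = 0) (s : ℝ) :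
    ‖x - s • w‖ ^ 2 = 1 + s ^ 2 * ‖w‖ ^ 2 := by
  rw [norm_sub_sq_real, hx, inner_smul_right, hw, norm_smul, mul_pow, Real.norm_eq_abs, sq_abs]
  ring

lemma one_le_norm_sub_smul_of_tangent {x w : U} (hx : ‖x‖ = 1) (hw : ⟪x, w⟫ = 0) (s : ℝ) :
    1 ≤ ‖x - s • w‖ := by
  have := sq_norm_sub_smul_of_tangent hx hw s
  nlinarith [norm_nonneg (x - s • w), mul_nonneg (sq_nonneg s) (sq_nonneg ‖w‖)]

lemma norm_sphereStep {v : U → U} (hv : ∀ x, ‖x‖ = 1 → ⟪x, v x⟫ = 0) (s : ℝ) {x : U}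
    (hx : ‖x‖ = 1) : ‖sphereStep v s x‖ = 1 := by
  have := one_le_norm_sub_smul_of_tangent hx (hv x hx) s
  rw [sphereStep, norm_smul, norm_inv, norm_norm, inv_mul_cancel₀ (by linarith)]

lemma continuousOn_iterate_sphereStep {v : U → U} (hvc : Continuous v)
    (hv : ∀ x, ‖x‖ = 1 → ⟪x, v x⟫ = 0) (a : ℝ) (k : ℕ) :
    ContinuousOn (fun q : ℝ × U => (sphereStep v (q.1 * a))^[k] q.2)
      (univ ×ˢ Metric.sphere 0 1) ∧
    ∀ q ∈ (univ ×ˢ Metric.sphere 0 1 : Set (ℝ × U)), ‖(sphereStep v (q.1 * a))^[k] q.2‖ = 1 := by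
  induction k with
  | zero => exact ⟨continuousOn_snd, fun q hq => by simpa using hq.2⟩
  | succ k ih =>
    obtain ⟨h1, h2⟩ := ih
    have h3 : ContinuousOn (fun q : ℝ × U => (sphereStep v (q.1 * a))^[k] q.2 -
        (q.1 * a) • v ((sphereStep v (q.1 * a))^[k] q.2)) (univ ×ˢ Metric.sphere 0 1) :=
      h1.sub ((by fun_prop : ContinuousOn (fun q : ℝ × U => q.1 * a) _).smul
        (hvc.comp_continuousOn h1))
    refine ⟨?_, fun q hq => ?_⟩
    · simp only [Function.iterate_succ', Function.comp, sphereStep]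
      refine (h3.norm.inv₀ fun q hq => ?_).smul h3
      have := one_le_norm_sub_smul_of_tangent (h2 q hq) (hv _ (h2 q hq)) (q.1 * a)
      linarith
    · rw [Function.iterate_succ_apply']
      exact norm_sphereStep hv _ (h2 q hq)

lemma sphereStep_le {F : U → ℝ} {v g : U → U} {L G V s : ℝ} {x : U} (hx : ‖x‖ = 1)
    (hF : ∀ y, ‖y‖ = 1 → F y ≤ F x + ⟪g x, y - x⟫ + L * ‖y - x‖ ^ 2)
    (hgv : g x = v x + ⟪x, g x⟫ • x) (hv : ∀ x, ‖x‖ = 1 → ⟪x, v x⟫ = 0)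
    (hG : ‖g x‖ ≤ G) (hV : ‖v x‖ ≤ V) (hL : 0 ≤ L) (hs : 0 ≤ s)
    (hs1 : s ^ 2 * V ^ 2 ≤ 1 / 2) (hs2 : s * (G + 2 * L) ≤ 1 / 4) :
    F (sphereStep v s x) ≤ F x - s / 4 * ‖v x‖ ^ 2 := by
  set y := sphereStep v s x with hy
  have hy1 : ‖y‖ = 1 := norm_sphereStep hv s hx
  set n := ‖x - s • v x‖ with hn
  have hn1 : 1 ≤ n := one_le_norm_sub_smul_of_tangent hx (hv x hx) s
  have hn2 : n ^ 2 = 1 + s ^ 2 * ‖v x‖ ^ 2 := sq_norm_sub_smul_of_tangent hx (hv x hx) s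
  have hyd : y = n⁻¹ • (x - s • v x) := rfl
  have hxx : ⟪x, x⟫ = 1 := by rw [real_inner_self_eq_norm_sq, hx]; norm_num
  have hm1 : n⁻¹ ≤ 1 := inv_le_one_of_one_le₀ hn1
  have hm2 : 1 - s ^ 2 * ‖v x‖ ^ 2 ≤ n⁻¹ := by
    rw [show 1 - s ^ 2 * ‖v x‖ ^ 2 = 2 - n ^ 2 by linarith, ← one_div, le_div_iff₀ (by linarith)]
    nlinarith [mul_nonneg (sub_nonneg.2 hn1) (sub_nonneg.2 hn1)]
  have hxy : ⟪x, y⟫ = n⁻¹ := by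
    rw [hyd, inner_smul_right, inner_sub_right, inner_smul_right, hv x hx, hxx]; ring
  have hd : ‖y - x‖ ^ 2 = 2 - 2 * n⁻¹ := by
    rw [norm_sub_sq_real, hy1, hx, real_inner_comm, hxy]; ring
  have hvv : ⟪v x, g x⟫ = ‖v x‖ ^ 2 := by
    rw [hgv, inner_add_right, inner_smul_right, real_inner_self_eq_norm_sq,
      real_inner_comm x (v x), hv x hx]
    ring
  have hgx : |⟪x, g x⟫| ≤ G := (abs_real_inner_le_norm _ _).trans (by rw [hx, one_mul]; exact hG)
  have hin : ⟪g x, y - x⟫ = (n⁻¹ - 1) * ⟪x, g x⟫ - n⁻¹ * s * ‖v x‖ ^ 2 := by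
    rw [real_inner_comm, inner_sub_left, hyd, inner_smul_left, inner_sub_left, inner_smul_left, hvv]
    simp
    ring
  have hw : s ^ 2 * ‖v x‖ ^ 2 ≤ 1 / 2 := le_trans (by gcongr) hs1
  have h1 := hF y hy1
  rw [hin, hd] at h1
  have h2 : (n⁻¹ - 1) * ⟪x, g x⟫ ≤ s ^ 2 * ‖v x‖ ^ 2 * G := by
    calc (n⁻¹ - 1) * ⟪x, g x⟫ = (1 - n⁻¹) * -⟪x, g x⟫ := by ring
      _ ≤ (s ^ 2 * ‖v x‖ ^ 2) * G :=
        mul_le_mul_of_nonneg (by linarith) ((neg_le_abs _).trans hgx) (by linarith)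
          ((abs_nonneg _).trans hgx)
  have h3 : 1 / 2 * (s * ‖v x‖ ^ 2) ≤ n⁻¹ * (s * ‖v x‖ ^ 2) := by
    refine mul_le_mul_of_nonneg_right (by linarith) (by positivity)
  have h4 : L * (2 - 2 * n⁻¹) ≤ L * (2 * (s ^ 2 * ‖v x‖ ^ 2)) := by gcongr; linarith
  have h5 := mul_le_mul_of_nonneg_right hs2 (show 0 ≤ s * ‖v x‖ ^ 2 by positivity)
  nlinarith

variable [FiniteDimensional ℝ U]

/-- A function without critical points on a band of levels on the unit sphere descends through
the band. -/
theorem hasDescent_of_no_critical {F : U → ℝ} (hF : ContDiff ℝ 2 F) {c η : ℝ}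
    (hcrit : ∀ x, ‖x‖ = 1 → |F x - c| ≤ η → ∀ τ : ℝ, ∃ u, fderiv ℝ F x u ≠ τ * ⟪x, u⟫) :
    HasDescent F c η := by
  let g : U → U := fun x => (InnerProductSpace.toDual ℝ U).symm (fderiv ℝ F x)
  have hg : ∀ x u, ⟪g x, u⟫ = fderiv ℝ F x u := fun x u => by
    simp [g]
  have hgs : ContDiff ℝ 1 g :=
    (InnerProductSpace.toDual ℝ U).symm.toContinuousLinearEquiv.contDiff.comp
      (hF.fderiv_right (m := 1) (by norm_num))
  have hgc := hgs.continuous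
  let v : U → U := fun x => g x - ⟪x, g x⟫ • x
  have hvc : Continuous v := by fun_prop
  have hgv : ∀ x, g x = v x + ⟪x, g x⟫ • x := fun x => by simp [v]
  have hv : ∀ x, ‖x‖ = 1 → ⟪x, v x⟫ = 0 := fun x hx => by
    simp [v, inner_sub_right, inner_smul_right, hx]
  have hS : IsCompact (Metric.sphere (0 : U) 1) := isCompact_sphere 0 1
  obtain ⟨L, hL⟩ := hgs.contDiffOn.exists_lipschitzOnWith one_ne_zero
    (convex_closedBall (0 : U) 1) (isCompact_closedBall 0 1)
  have hquad : ∀ x y, ‖x‖ = 1 → ‖y‖ = 1 →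
      F y ≤ F x + ⟪g x, y - x⟫ + L * ‖y - x‖ ^ 2 := fun x y hx hy => by
    have hseg : segment ℝ x y ⊆ Metric.closedBall 0 1 :=
      (convex_closedBall (0 : U) 1).segment_subset (by simp [hx]) (by simp [hy])
    have h1 := (convex_segment x y).norm_image_sub_le_of_norm_hasFDerivWithin_le'
      (f := F) (f' := fderiv ℝ F) (φ := fderiv ℝ F x) (C := L * ‖y - x‖)
      (fun z _ => ((hF.differentiable two_ne_zero) z).hasFDerivAt.hasFDerivWithinAt)
      (fun z hz => by
        have h2 : fderiv ℝ F z - fderiv ℝ F x = InnerProductSpace.toDual ℝ U (g z - g x) := by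
          simp [g]
        rw [h2, LinearIsometryEquiv.norm_map]
        refine (hL.norm_sub_le (hseg hz) (by simp [hx])).trans ?_
        gcongr
        exact norm_sub_le_of_mem_segment hz)
      (left_mem_segment ℝ x y) (right_mem_segment ℝ x y)
    have h3 := (le_abs_self _).trans h1
    rw [← hg] at h3
    nlinarith
  obtain ⟨G, hG⟩ := hS.exists_bound_of_continuousOn hgc.continuousOn
  obtain ⟨V, hV⟩ := hS.exists_bound_of_continuousOn hvc.continuousOn
  have hband : IsCompact (Metric.sphere (0 : U) 1 ∩ {x | |F x - c| ≤ η}) :=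
    hS.inter_right (isClosed_le (by have := hF.continuous; fun_prop) continuous_const)
  have hm : ∃ m > 0, ∀ x, ‖x‖ = 1 → |F x - c| ≤ η → m ≤ ‖v x‖ ^ 2 := by
    rcases (Metric.sphere (0 : U) 1 ∩ {x | |F x - c| ≤ η}).eq_empty_or_nonempty with he | he
    · refine ⟨1, one_pos, fun x hx hx' => ?_⟩
      have : x ∈ Metric.sphere (0 : U) 1 ∩ {x | |F x - c| ≤ η} := ⟨by simpa using hx, hx'⟩
      rw [he] at this
      exact this.elim
    · obtain ⟨x₀, hx₀, hmin⟩ := hband.exists_isMinOn he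
        (f := fun x => ‖v x‖ ^ 2) (by fun_prop)
      refine ⟨‖v x₀‖ ^ 2, ?_, fun x hx hx' => hmin ⟨by simpa using hx, hx'⟩⟩
      have : v x₀ ≠ 0 := fun h0 => by
        obtain ⟨u, hu⟩ := hcrit x₀ (by simpa using hx₀.1) hx₀.2 ⟪x₀, g x₀⟫
        refine hu ?_
        rw [← hg]
        nth_rewrite 1 [hgv x₀]
        rw [h0, zero_add, inner_smul_left]
        simp
      positivity
  obtain ⟨m, hm0, hm⟩ := hm
  obtain ⟨s₀, hs0, hs⟩ : ∃ s₀ > 0, ∀ s ∈ Icc (0 : ℝ) s₀,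
      s ^ 2 * V ^ 2 ≤ 1 / 2 ∧ s * (G + 2 * L) ≤ 1 / 4 := by
    have h1 : ∀ᶠ s in 𝓝 (0 : ℝ), s ^ 2 * V ^ 2 < 1 / 2 ∧ s * (G + 2 * L) < 1 / 4 := by
      refine Filter.Eventually.and ?_ ?_
      · refine (by fun_prop : Continuous fun s : ℝ => s ^ 2 * V ^ 2).continuousAt.eventually
          (gt_mem_nhds ?_)
        norm_num
      · refine (by fun_prop : Continuous fun s : ℝ => s * (G + 2 * L)).continuousAt.eventually
          (gt_mem_nhds ?_)
        norm_num
    obtain ⟨δ, hδ, h2⟩ := Metric.eventually_nhds_iff.1 h1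
    refine ⟨δ / 2, by positivity, fun s hs => ?_⟩
    have h3 := h2 (y := s) (by
      rw [dist_zero_right, Real.norm_of_nonneg hs.1]; linarith [hs.2])
    exact ⟨h3.1.le, h3.2.le⟩
  have hstep : ∀ s ∈ Icc (0 : ℝ) s₀, ∀ x, ‖x‖ = 1 →
      F (sphereStep v s x) ≤ F x - s / 4 * ‖v x‖ ^ 2 := fun s hs' x hx =>
    sphereStep_le hx (fun y => hquad x y hx) (hgv x) hv (hG x (by simpa using hx))
      (hV x (by simpa using hx)) L.2 hs'.1 (hs s hs').1 (hs s hs').2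
  have hmono : ∀ s ∈ Icc (0 : ℝ) s₀, ∀ k, ∀ x, ‖x‖ = 1 →
      ‖(sphereStep v s)^[k] x‖ = 1 ∧ F ((sphereStep v s)^[k] x) ≤ F x := fun s hs' k => by
    induction k with
    | zero => exact fun x hx => ⟨hx, le_rfl⟩
    | succ k ih =>
      intro x hx
      obtain ⟨h1, h2⟩ := ih x hx
      rw [Function.iterate_succ_apply']
      refine ⟨norm_sphereStep hv s h1, (hstep s hs' _ h1).trans ?_⟩
      have := mul_nonneg (div_nonneg hs'.1 (by norm_num : (0 : ℝ) ≤ 4))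
        (sq_nonneg ‖v ((sphereStep v s)^[k] x)‖)
      linarith
  have hdec : ∀ k : ℕ, ∀ x, ‖x‖ = 1 → F x ≤ c + η →
      c - η < F ((sphereStep v s₀)^[k] x) →
      F ((sphereStep v s₀)^[k] x) ≤ c + η - k * (s₀ / 4 * m) := fun k => by
    induction k with
    | zero => intro x _ hx _; simpa using hx
    | succ k ih =>
      intro x hx hxc hlt
      have hs₀ : s₀ ∈ Icc (0 : ℝ) s₀ := ⟨hs0.le, le_rfl⟩
      obtain ⟨h1, h2⟩ := hmono s₀ hs₀ k x hx
      rw [Function.iterate_succ_apply'] at hlt ⊢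
      have h3 := hstep s₀ hs₀ _ h1
      have h4 : F ((sphereStep v s₀)^[k] x) > c - η := by
        have := mul_nonneg (div_nonneg hs0.le (by norm_num : (0 : ℝ) ≤ 4))
          (sq_nonneg ‖v ((sphereStep v s₀)^[k] x)‖)
        linarith
      have h5 := ih x hx hxc h4
      have h6 := hm _ h1 (abs_le.2 ⟨by linarith, by linarith⟩)
      have h7 := mul_le_mul_of_nonneg_left h6 (div_nonneg hs0.le (by norm_num : (0 : ℝ) ≤ 4))
      push_cast
      linarith
  obtain ⟨k, hk⟩ := exists_nat_ge (2 * η / (s₀ / 4 * m))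
  rw [div_le_iff₀ (by positivity)] at hk
  refine ⟨fun q => (sphereStep v (q.1 * s₀))^[k] q.2,
    (continuousOn_iterate_sphereStep hvc hv s₀ k).1, fun x hx => ?_, fun s hs' x hx => ?_,
    fun x hx hxc => ?_⟩
  · have : sphereStep v (0 * s₀) x = x := by simp [sphereStep, hx]
    exact Function.iterate_fixed this k
  · exact hmono _ ⟨mul_nonneg hs'.1 hs0.le, mul_le_of_le_one_left hs0.le hs'.2⟩ k x hx
  · by_contra! hlt
    simp only [one_mul] at hlt
    have := hdec k x hx hxc hlt
    linarith

end GradientDescent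

section Continuation

variable {U : Type*} [NormedAddCommGroup U] [InnerProductSpace ℝ U] [FiniteDimensional ℝ U]

/-- Inessentiality of sublevel inclusions is carried along a path of functions none of which has
a critical point on the unit sphere with level in `[-κ', κ']`. -/
theorem SphereInessential.of_path {W : Type*} [NormedAddCommGroup W] {F : ℝ → U → ℝ}
    {C κ κ' c c' : ℝ} (hF : ∀ l ∈ Icc (0 : ℝ) 1, ContDiff ℝ 2 (F l))
    (hC : ∀ l ∈ Icc (0 : ℝ) 1, ∀ m ∈ Icc (0 : ℝ) 1, ∀ x, ‖x‖ = 1 →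
      |F l x - F m x| ≤ C * |l - m|)
    (hcrit : ∀ l ∈ Icc (0 : ℝ) 1, ∀ x, ‖x‖ = 1 → |F l x| ≤ κ' →
      ∀ τ : ℝ, ∃ u, fderiv ℝ (F l) x u ≠ τ * ⟪x, u⟫)
    (hκ : κ < κ') (hc : |c| ≤ κ) (hc' : |c'| ≤ κ) (hcc : c ≤ c')
    (h : SphereInessential W (sphereSublevel (F 0) c) (sphereSublevel (F 0) c')) :
    SphereInessential W (sphereSublevel (F 1) c) (sphereSublevel (F 1) c') := by
  obtain ⟨P, hP⟩ := exists_nat_ge (C / (κ' - κ))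
  rw [div_le_iff₀ (by linarith)] at hP
  have hP1 : (0 : ℝ) < P + 1 := by positivity
  have hmem : ∀ k : ℕ, k ≤ P + 1 → (k : ℝ) / (P + 1) ∈ Icc (0 : ℝ) 1 := fun k hk =>
    ⟨by positivity, (div_le_one hP1).2 (by exact_mod_cast hk)⟩
  have hd : ∀ l ∈ Icc (0 : ℝ) 1, ∀ c, |c| ≤ κ → HasDescent (F l) c (κ' - κ) := fun l hl c hc =>
    hasDescent_of_no_critical (hF l hl) fun x hx hxc => hcrit l hl x hx (by
      have := abs_add_le (F l x - c) c
      rw [sub_add_cancel] at this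
      linarith)
  have key : ∀ k : ℕ, k ≤ P + 1 → SphereInessential W
      (sphereSublevel (F (k / (P + 1))) c) (sphereSublevel (F (k / (P + 1))) c') := fun k => by
    induction k with
    | zero => intro _; simpa using h
    | succ k ih =>
      intro hk
      have hk' := hmem _ hk
      refine SphereInessential.of_descent hcc (by linarith) (fun x hx => ?_) (hd _ hk' c hc)
        (hd _ hk' c' hc') (ih (by omega))
      refine (hC _ (hmem k (by omega)) _ hk' x hx).trans ?_
      have h1 : ((k : ℝ) / (P + 1) - (k + 1 : ℕ) / (P + 1)) = -(1 / (P + 1)) := by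
        push_cast; field_simp; ring
      rw [h1, abs_neg, abs_of_pos (by positivity), mul_one_div, div_le_iff₀ hP1]
      nlinarith
  have := key (P + 1) le_rfl
  rwa [show (((P + 1 : ℕ) : ℝ) / (P + 1)) = 1 by push_cast; exact div_self hP1.ne'] at this

end Continuation

section Splitting

lemma inner_add_self_of_splitting {U : Type*} [NormedAddCommGroup U] [InnerProductSpace ℝ U]
    {A : U →ₗ[ℝ] U} (hA : A.IsSymmetric) {x y : U}
    (h : ⟪A x, y⟫ = 0) : ⟪A (x + y), x + y⟫ = ⟪A x, x⟫ + ⟪A y, y⟫ := by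
  have h2 : ⟪A y, x⟫ = 0 := by rw [hA, real_inner_comm, h]
  rw [map_add, inner_add_left, inner_add_right, inner_add_right, h, h2]
  ring

variable {U : Type*} [NormedAddCommGroup U] [InnerProductSpace ℝ U] [FiniteDimensional ℝ U]

/-- Spectral splitting of a symmetric operator without eigenvalues in `[-κ, κ]`. -/
lemma exists_spectral_splitting {A : U →ₗ[ℝ] U} (hA : A.IsSymmetric) {κ : ℝ}
    (hgap : ∀ x, ‖x‖ = 1 → |⟪A x, x⟫| ≤ κ → ∀ τ : ℝ, A x ≠ τ • x) :
    ∃ V : Submodule ℝ U, (∀ x ∈ V, ⟪A x, x⟫ ≤ -κ * ‖x‖ ^ 2) ∧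
      (∀ x ∈ Vᗮ, x ≠ 0 → κ * ‖x‖ ^ 2 < ⟪A x, x⟫) ∧ ∀ x ∈ V, ∀ y ∈ Vᗮ, ⟪A x, y⟫ = 0 := by
  let b := hA.eigenvectorBasis rfl
  let l := hA.eigenvalues rfl
  have hb : ∀ i, A (b i) = l i • b i := fun i => by
    exact hA.apply_eigenvectorBasis rfl i
  have hexp : ∀ x y, ⟪A x, y⟫ = ∑ i, l i * (⟪b i, x⟫ * ⟪b i, y⟫) := fun x y => by
    rw [← b.sum_inner_mul_inner (A x) y]
    refine Finset.sum_congr rfl fun i _ => ?_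
    rw [hA, hb, inner_smul_right, real_inner_comm]
    ring
  have hnorm : ∀ x, ‖x‖ ^ 2 = ∑ i, (⟪b i, x⟫ * ⟪b i, x⟫) := fun x => by
    rw [← real_inner_self_eq_norm_sq, ← b.sum_inner_mul_inner x x]
    exact Finset.sum_congr rfl fun i _ => by rw [real_inner_comm]
  have hlgap : ∀ i, l i ≤ κ → l i < -κ := fun i hi => by
    by_contra! h
    refine hgap (b i) (b.norm_eq_one i) ?_ (l i) (hb i)
    rw [hb, inner_smul_left, real_inner_self_eq_norm_sq, b.norm_eq_one]
    simpa using abs_le.2 ⟨h, hi⟩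
  let V : Submodule ℝ U := Submodule.span ℝ (b '' {i | l i ≤ κ})
  have hV : ∀ x ∈ V, ∀ i, κ < l i → ⟪b i, x⟫ = 0 := fun x hx i hi => by
    induction hx using Submodule.span_induction with
    | mem x h =>
      obtain ⟨j, hj, rfl⟩ := h
      exact b.orthonormal.2 (by rintro rfl; exact absurd hj (not_le.2 hi))
    | zero => simp
    | add x y _ _ h1 h2 => rw [inner_add_right, h1, h2, add_zero]
    | smul a x _ h => rw [inner_smul_right, h, mul_zero]
  have hV' : ∀ x ∈ Vᗮ, ∀ i, l i ≤ κ → ⟪b i, x⟫ = 0 := fun x hx i hi =>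
    (Submodule.mem_orthogonal _ _).1 hx _ (Submodule.subset_span ⟨i, hi, rfl⟩)
  refine ⟨V, fun x hx => ?_, fun x hx hx0 => ?_, fun x hx y hy => ?_⟩
  · rw [hexp, hnorm, Finset.mul_sum]
    refine Finset.sum_le_sum fun i _ => ?_
    rcases le_or_gt (l i) κ with hi | hi
    · exact mul_le_mul_of_nonneg_right (hlgap i hi).le (mul_self_nonneg _)
    · simp [hV x hx i hi]
  · obtain ⟨i, hi⟩ : ∃ i, ⟪b i, x⟫ ≠ 0 := by
      by_contra! h
      refine hx0 (norm_eq_zero.1 (pow_eq_zero_iff two_ne_zero |>.1 ?_))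
      rw [hnorm]
      simp [h]
    rw [hexp, hnorm, Finset.mul_sum]
    refine Finset.sum_lt_sum (fun i _ => ?_) ⟨i, Finset.mem_univ _, ?_⟩
    · rcases le_or_gt (l i) κ with hi | hi
      · simp [hV' x hx i hi]
      · exact mul_le_mul_of_nonneg_right hi.le (mul_self_nonneg _)
    · rcases le_or_gt (l i) κ with h | h
      · exact absurd (hV' x hx i h) hi
      · exact mul_lt_mul_of_pos_right h (mul_self_pos.2 hi)
  · rw [hexp]
    refine Finset.sum_eq_zero fun i _ => ?_
    rcases le_or_gt (l i) κ with h | h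
    · simp [hV' y hy i h]
    · simp [hV x hx i h]

/-- A sublevel inclusion of a quadratic form is inessential with respect to spheres of larger
dimension than its negative part. -/
theorem sphereInessential_of_splitting {W : Type*} [NormedAddCommGroup W] [NormedSpace ℝ W]
    [FiniteDimensional ℝ W] {A : U →ₗ[ℝ] U} (hA : A.IsSymmetric) {κ : ℝ} (hκ : 0 ≤ κ)
    {V : Submodule ℝ U} (hV : ∀ x ∈ V, ⟪A x, x⟫ ≤ -κ * ‖x‖ ^ 2)
    (hV' : ∀ x ∈ Vᗮ, x ≠ 0 → κ * ‖x‖ ^ 2 < ⟪A x, x⟫) (hVV : ∀ x ∈ V, ∀ y ∈ Vᗮ, ⟪A x, y⟫ = 0)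
    (hdim : Module.finrank ℝ V < Module.finrank ℝ W) :
    SphereInessential W (sphereSublevel (fun x => ⟪A x, x⟫) κ)
      (sphereSublevel (fun x => ⟪A x, x⟫) κ) := by
  set B := sphereSublevel (fun x => ⟪A x, x⟫) κ with hB
  let P := V.starProjection
  have hPV : ∀ x, P x ∈ V := fun x => V.starProjection_apply_mem x
  have hPo : ∀ x, x - P x ∈ Vᗮ := fun x => V.sub_starProjection_mem_orthogonal x
  have hPc : Continuous P := P.continuous
  have hpath : ∀ x ∈ B, ∀ s ∈ Icc (0 : ℝ) 1, P x + (1 - s) • (x - P x) ≠ 0 ∧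
      ⟪A (P x + (1 - s) • (x - P x)), P x + (1 - s) • (x - P x)⟫
        ≤ κ * ‖P x + (1 - s) • (x - P x)‖ ^ 2 := fun x hx s hs => by
    have hortho : ∀ t : ℝ, ‖P x + t • (x - P x)‖ ^ 2 = ‖P x‖ ^ 2 + t ^ 2 * ‖x - P x‖ ^ 2 := by
      intro t
      rw [norm_add_sq_real, inner_smul_right,
        (Submodule.mem_orthogonal _ _).1 (hPo x) _ (hPV x), norm_smul, mul_pow, Real.norm_eq_abs,
        sq_abs]
      ring
    have hval : ∀ t : ℝ, ⟪A (P x + t • (x - P x)), P x + t • (x - P x)⟫ =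
        ⟪A (P x), P x⟫ + t ^ 2 * ⟪A (x - P x), x - P x⟫ := by
      intro t
      rw [inner_add_self_of_splitting hA (hVV _ (hPV x) _ (Vᗮ.smul_mem t (hPo x))), map_smul,
        inner_smul_left, inner_smul_right]
      simp; ring
    have hx1 := hval 1
    have hx2 := hortho 1
    simp only [one_smul, add_sub_cancel, one_pow, one_mul] at hx1 hx2
    have hx3 : ⟪A x, x⟫ ≤ κ * ‖x‖ ^ 2 := by rw [hx.1]; simpa using hx.2
    have hmin : κ * ‖x - P x‖ ^ 2 ≤ ⟪A (x - P x), x - P x⟫ := by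
      rcases eq_or_ne (x - P x) 0 with h | h
      · simp [h]
      · exact (hV' _ (hPo x) h).le
    have hPx : P x ≠ 0 := fun h0 => by
      have h1 := hV' x (by simpa [h0] using hPo x) (fun h => by simp [h] at hx; simpa using hx.1)
      linarith
    constructor
    · intro h0
      have h1 := hortho (1 - s)
      rw [h0, norm_zero] at h1
      have : 0 < ‖P x‖ ^ 2 := by positivity
      nlinarith [mul_nonneg (sq_nonneg (1 - s)) (sq_nonneg ‖x - P x‖)]
    · rw [hval, hortho]
      have h2 : (1 - s) ^ 2 ≤ 1 := by nlinarith [hs.1, hs.2]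
      nlinarith [mul_nonneg (sub_nonneg.2 h2) (sub_nonneg.2 hmin)]
  have hnorm : ∀ x : U, x ≠ 0 → ‖‖x‖⁻¹ • x‖ = 1 := fun x hx => by
    rw [norm_smul, norm_inv, norm_norm, inv_mul_cancel₀ (norm_ne_zero_iff.2 hx)]
  have hlev : ∀ x : U, x ≠ 0 → ⟪A x, x⟫ ≤ κ * ‖x‖ ^ 2 → ‖x‖⁻¹ • x ∈ B := fun x hx h => by
    refine ⟨hnorm x hx, ?_⟩
    have h1 : 0 < ‖x‖ ^ 2 := by positivity
    simp only [map_smul, inner_smul_left, inner_smul_right]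
    simp only [conj_trivial]
    rw [← mul_assoc, ← mul_inv, inv_mul_le_iff₀ (by positivity)]
    linarith
  have hP0 : ∀ x ∈ B, P x ≠ 0 := fun x hx => by
    simpa using (hpath x hx 1 ⟨zero_le_one, le_rfl⟩).1
  let r : C(B, Metric.sphere (0 : V) 1) :=
    ⟨fun x => ⟨‖P x‖⁻¹ • ⟨P x, hPV x⟩, by simpa using hnorm _ (hP0 x x.2)⟩, by
      have h1 : Continuous fun x : B => ‖P x‖⁻¹ :=
        (by fun_prop : Continuous fun x : B => ‖P x‖).inv₀ fun x => norm_ne_zero_iff.2 (hP0 x x.2)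
      have h2 : Continuous fun x : B => (⟨P x, hPV x⟩ : V) :=
        (hPc.comp continuous_subtype_val).subtype_mk _
      exact (h1.smul h2).subtype_mk _⟩
  let j : C(Metric.sphere (0 : V) 1, B) :=
    ⟨fun x => ⟨(x : V), ⟨mem_sphere_zero_iff_norm.1 x.2, (hV _ (x : V).2).trans (by
      have : ‖((x : V) : U)‖ = 1 := mem_sphere_zero_iff_norm.1 x.2
      rw [this]; linarith)⟩⟩, by fun_prop⟩
  have hjr : (ContinuousMap.id B).Homotopic (j.comp r) := by
    refine ⟨{ toFun := fun q => ⟨‖P q.2 + (1 - (q.1 : ℝ)) • ((q.2 : U) - P q.2)‖⁻¹ •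
                (P q.2 + (1 - (q.1 : ℝ)) • ((q.2 : U) - P q.2)), ?_⟩
              continuous_toFun := ?_
              map_zero_left := ?_
              map_one_left := ?_ }⟩
    · exact hlev _ (hpath _ q.2.2 _ q.1.2).1 (hpath _ q.2.2 _ q.1.2).2
    · have : Continuous fun q : unitInterval × B =>
          P q.2 + (1 - (q.1 : ℝ)) • ((q.2 : U) - P q.2) := by fun_prop
      exact ((this.norm.inv₀ fun q => norm_ne_zero_iff.2
        (hpath _ q.2.2 _ q.1.2).1).smul this).subtype_mk _
    · intro x
      refine Subtype.ext ?_
      simp [x.2.1]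
    · intro x
      refine Subtype.ext ?_
      simp [j, r]
  refine ⟨le_rfl, fun u R => ?_⟩
  have h1 : (R.comp j).Nullhomotopic := nullhomotopic_of_finrank_lt hdim _
  have h2 : R.Nullhomotopic := by
    obtain ⟨y, hy⟩ := h1.comp_left r
    refine ⟨y, ContinuousMap.Homotopic.trans ?_ hy⟩
    exact (ContinuousMap.Homotopic.refl R).comp hjr
  exact h2.comp_left _

/-- An inessential sublevel inclusion of a quadratic form `B` cannot arise from one of a quadratic
form `Q` that has a smaller negative part. -/
theorem not_sphereInessential_transfer {Q B : U →ₗ[ℝ] U} (hQ : Q.IsSymmetric)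
    (hB : B.IsSymmetric) {κ : ℝ} (hκ : 0 < κ)
    (hQgap : ∀ x, ‖x‖ = 1 → |⟪Q x, x⟫| ≤ κ → ∀ τ : ℝ, Q x ≠ τ • x)
    (hBgap : ∀ x, ‖x‖ = 1 → |⟪B x, x⟫| ≤ κ → ∀ τ : ℝ, B x ≠ τ • x) {u : U}
    (hu : ∀ (e : U) (t : ℝ), ⟪B (e + t • u), e + t • u⟫ ≤ ⟪Q e, e⟫) (hu0 : 0 < ⟪Q u, u⟫)
    (h : ∀ V : Submodule ℝ U, SphereInessential V (sphereSublevel (fun x => ⟪Q x, x⟫) κ)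
        (sphereSublevel (fun x => ⟪Q x, x⟫) κ) →
      SphereInessential V (sphereSublevel (fun x => ⟪B x, x⟫) (-κ))
        (sphereSublevel (fun x => ⟪B x, x⟫) κ)) : False := by
  obtain ⟨E, hE, hE', hEE⟩ := exists_spectral_splitting hQ hQgap
  obtain ⟨V, hV, hV', hVV⟩ := exists_spectral_splitting hB hBgap
  have huE : u ∉ E := fun hmem => by
    have := hE u hmem
    nlinarith [sq_nonneg ‖u‖]
  have hdim : Module.finrank ℝ E < Module.finrank ℝ V := by
    have hlt : E < E ⊔ Submodule.span ℝ {u} := by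
      refine lt_of_le_of_ne le_sup_left fun h => huE ?_
      rw [h]
      exact Submodule.mem_sup_right (Submodule.mem_span_singleton_self u)
    have hdisj : Disjoint (E ⊔ Submodule.span ℝ {u}) Vᗮ := by
      rw [Submodule.disjoint_def]
      intro x hx hxV
      by_contra hx0
      have h1 := hV' x hxV hx0
      obtain ⟨e, he, y, hy, rfl⟩ := Submodule.mem_sup.1 hx
      obtain ⟨t, rfl⟩ := Submodule.mem_span_singleton.1 hy
      have h2 := hu e t
      have h3 := hE e he
      have h4 : 0 ≤ κ * ‖e + t • u‖ ^ 2 := by positivity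
      nlinarith [mul_nonneg hκ.le (sq_nonneg ‖e‖)]
    have h1 := Submodule.finrank_add_finrank_le_of_disjoint hdisj
    have h2 := Submodule.finrank_lt_finrank_of_lt hlt
    have h3 := V.finrank_add_finrank_orthogonal
    omega
  obtain ⟨hsub, hnull⟩ := h V (sphereInessential_of_splitting hQ hκ.le hE hE' hEE hdim)
  let P := V.starProjection
  let i : C(Metric.sphere (0 : V) 1, sphereSublevel (fun x => ⟪B x, x⟫) (-κ)) :=
    ⟨fun x => ⟨(x : V), ⟨mem_sphere_zero_iff_norm.1 x.2, (hV _ (x : V).2).trans (by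
      have : ‖((x : V) : U)‖ = 1 := mem_sphere_zero_iff_norm.1 x.2
      rw [this]; linarith)⟩⟩, by fun_prop⟩
  let R : C(sphereSublevel (fun x => ⟪B x, x⟫) κ, {w : V // w ≠ 0}) :=
    ⟨fun x => ⟨⟨P x, V.starProjection_apply_mem x⟩, fun h0 => by
      have h1 : P x = 0 := by simpa using congrArg Subtype.val h0
      have h2 : (x : U) ∈ Vᗮ := by
        have := V.sub_starProjection_mem_orthogonal (x : U)
        rwa [show V.starProjection (x : U) = 0 from h1, sub_zero] at this
      have h3 := hV' x h2 (fun h => by have := x.2.1; rw [h, norm_zero] at this; norm_num at this)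
      have h4 := x.2.2
      rw [x.2.1] at h3
      linarith⟩, by
      have : Continuous P := P.continuous
      fun_prop⟩
  refine not_nullhomotopic_sphere _ (fun x => Subtype.ext ?_) (hnull i R)
  change P ((x : V) : U) = ((x : V) : U)
  exact V.starProjection_eq_self_iff.2 (x : V).2

end Splitting

section ApproxOrbit

variable {E : Type*} [NormedAddCommGroup E] [NormedSpace ℝ E]

/-- `z` satisfies the Euler scheme with step `1 / N` for the fields `X i`, up to an error `C / N²`
in each of its `N` steps. -/
def IsApproxOrbit (N : ℕ) (C : ℝ) (X : ℕ → E → E) (z : ℕ → E) : Prop :=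
  ∀ i < N, ‖z (i + 1) - z i - (N : ℝ)⁻¹ • X i (z i)‖ ≤ C / (N : ℝ) ^ 2

lemma one_add_div_pow_le_exp {L : ℝ} (hL : 0 ≤ L) {N m i : ℕ} (hN : 0 < N) (hi : i ≤ m * N) :
    (1 + L / N) ^ i ≤ Real.exp (m * L) := by
  have h1 : (1 + L / N) ^ i ≤ Real.exp (L / N) ^ i :=
    pow_le_pow_left₀ (by positivity) (by linarith [Real.add_one_le_exp (L / N)]) i
  refine h1.trans ?_
  rw [← Real.exp_nat_mul]
  refine Real.exp_le_exp.2 ?_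
  have hN' : (0 : ℝ) < N := by exact_mod_cast hN
  have : (i : ℝ) ≤ m * N := by exact_mod_cast hi
  calc (i : ℝ) * (L / N) ≤ m * N * (L / N) := by gcongr
    _ = m * L := by field_simp

lemma IsApproxOrbit.dist_le {N : ℕ} {C D L : ℝ} {X : ℕ → E → E} {z w : ℕ → E}
    (hz : IsApproxOrbit N C X z) (hw : IsApproxOrbit N D X w) (hL : 0 ≤ L) (hCD : 0 ≤ C + D)
    (hX : ∀ i < N, ∀ x y, ‖X i x - X i y‖ ≤ L * ‖x - y‖) {i : ℕ} (hi : i ≤ N) :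
    ‖z i - w i‖ ≤ Real.exp L * (‖z 0 - w 0‖ + (C + D) / N) := by
  have key : ∀ i ≤ N, ‖z i - w i‖ ≤ (1 + L / N) ^ i * (‖z 0 - w 0‖ + i * ((C + D) / N ^ 2)) := by
    intro i
    induction i with
    | zero => intro _; simp
    | succ i ih =>
      intro hi
      have hiN : i < N := hi
      have hN : (0 : ℝ) < N := by exact_mod_cast (Nat.zero_lt_of_lt hiN)
      have h1 : z (i + 1) - w (i + 1) = (z i - w i) + (N : ℝ)⁻¹ • (X i (z i) - X i (w i))
          + ((z (i + 1) - z i - (N : ℝ)⁻¹ • X i (z i))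
            - (w (i + 1) - w i - (N : ℝ)⁻¹ • X i (w i))) := by
        rw [smul_sub]; abel
      have h2 : ‖z (i + 1) - w (i + 1)‖ ≤ (1 + L / N) * ‖z i - w i‖ + (C + D) / N ^ 2 := by
        rw [h1]
        refine (norm_add_le _ _).trans ?_
        have h3 := (norm_sub_le _ _).trans (add_le_add (hz i hiN) (hw i hiN))
        have h4 : ‖(N : ℝ)⁻¹ • (X i (z i) - X i (w i))‖ ≤ L / N * ‖z i - w i‖ := by
          rw [norm_smul, norm_inv, Real.norm_natCast]
          calc (N : ℝ)⁻¹ * ‖X i (z i) - X i (w i)‖ ≤ (N : ℝ)⁻¹ * (L * ‖z i - w i‖) := by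
                gcongr; exact hX i hiN _ _
            _ = L / N * ‖z i - w i‖ := by ring
        have h5 := norm_add_le (z i - w i) ((N : ℝ)⁻¹ • (X i (z i) - X i (w i)))
        rw [add_div]
        linarith
      have ha : 1 ≤ (1 + L / N) ^ (i + 1) := one_le_pow₀ (by
        have : 0 ≤ L / N := by positivity
        linarith)
      have hb : 0 ≤ (C + D) / N ^ 2 := by positivity
      calc ‖z (i + 1) - w (i + 1)‖ ≤ (1 + L / N) * ‖z i - w i‖ + (C + D) / N ^ 2 := h2
        _ ≤ (1 + L / N) * ((1 + L / N) ^ i * (‖z 0 - w 0‖ + i * ((C + D) / N ^ 2)))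
            + (1 + L / N) ^ (i + 1) * ((C + D) / N ^ 2) := by
          gcongr
          · exact ih hiN.le
          · exact le_mul_of_one_le_left hb ha
        _ = _ := by push_cast; ring
  rcases Nat.eq_zero_or_pos N with hN | hN
  · obtain rfl : i = 0 := by omega
    rw [hN]
    simp only [Nat.cast_zero, div_zero, add_zero]
    exact le_mul_of_one_le_left (norm_nonneg _) (Real.one_le_exp hL)
  have hN' : (0 : ℝ) < N := by exact_mod_cast hN
  refine (key i hi).trans ?_
  have h1 := one_add_div_pow_le_exp hL (m := 1) hN (by simpa using hi)
  rw [Nat.cast_one, one_mul] at h1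
  gcongr
  calc (i : ℝ) * ((C + D) / N ^ 2) ≤ N * ((C + D) / N ^ 2) := by gcongr
    _ = (C + D) / N := by field_simp

/-- A curve with Lipschitz velocity is an approximate orbit. -/
lemma norm_curve_step_le {γ γ' : ℝ → E} {K : ℝ} {N : ℕ}
    (hγ : ∀ t ∈ Icc (0 : ℝ) 1, HasDerivAt γ (γ' t) t)
    (hK : ∀ s ∈ Icc (0 : ℝ) 1, ∀ t ∈ Icc (0 : ℝ) 1, ‖γ' s - γ' t‖ ≤ K * |s - t|) {i : ℕ}
    (hi : i < N) :
    ‖γ ((i + 1 : ℕ) / N) - γ (i / N) - (N : ℝ)⁻¹ • γ' (i / N)‖ ≤ K / (N : ℝ) ^ 2 := by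
  have hN : (0 : ℝ) < N := by exact_mod_cast (Nat.zero_lt_of_lt hi)
  set a : ℝ := i / N
  set b : ℝ := (i + 1 : ℕ) / N
  have hab : b - a = (N : ℝ)⁻¹ := by simp only [a, b]; push_cast; field_simp; ring
  have hab' : a ≤ b := by have := inv_pos.2 hN; linarith
  have ha : 0 ≤ a := by positivity
  have hb : b ≤ 1 := (div_le_one hN).2 (by exact_mod_cast hi)
  have hK0 : 0 ≤ K := by
    have := (norm_nonneg _).trans (hK 0 ⟨le_rfl, zero_le_one⟩ 1 ⟨zero_le_one, le_rfl⟩)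
    simpa using this
  have hsub : ∀ t ∈ Icc a b, t ∈ Icc (0 : ℝ) 1 := fun t ht =>
    ⟨ha.trans ht.1, ht.2.trans hb⟩
  have h1 := (convex_Icc a b).norm_image_sub_le_of_norm_hasDerivWithin_le
    (f := fun t => γ t - t • γ' a) (f' := fun t => γ' t - γ' a) (C := K * (b - a))
    (fun t ht => (((hγ t (hsub t ht)).sub
      (by simpa using (hasDerivAt_id t).smul_const (γ' a)))).hasDerivWithinAt)
    (fun t ht => (hK t (hsub t ht) a (hsub a ⟨le_rfl, hab'⟩)).trans (by
      rw [abs_of_nonneg (sub_nonneg.2 ht.1)]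
      gcongr
      exact ht.2))
    (left_mem_Icc.2 hab') (right_mem_Icc.2 hab')
  have h2 : γ b - b • γ' a - (γ a - a • γ' a) = γ b - γ a - (N : ℝ)⁻¹ • γ' a := by
    rw [← hab, sub_smul]; abel
  rw [h2, Real.norm_of_nonneg (by linarith), hab] at h1
  refine h1.trans (le_of_eq ?_)
  field_simp

/-- A sequence whose increments grow at most linearly stays bounded over `4 N` steps. -/
lemma norm_le_of_linear_growth {A : Type*} [SeminormedAddCommGroup A] {z : ℕ → A} {c : ℝ}
    (hc : 0 ≤ c) {N : ℕ} (hN : 0 < N)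
    (hcN : 2 * c ≤ N)
    (hz : ∀ j < 4 * N, ‖z (j + 1) - z j‖ ≤ c / N * (1 + ‖z j‖ + ‖z (j + 1)‖)) {i j : ℕ}
    (hi : i ≤ 4 * N) (hj : j ≤ 4 * N) :
    1 + ‖z i‖ ≤ Real.exp (16 * c) * (1 + ‖z j‖) := by
  have hN' : (0 : ℝ) < N := by exact_mod_cast hN
  set a := c / N
  have ha : 0 ≤ a := by positivity
  have ha2 : a ≤ 1 / 2 := by
    simp only [a]; rw [div_le_iff₀ hN']; linarith
  have hone : ∀ u v : ℝ, 0 ≤ u → 0 ≤ v → |u - v| ≤ a * (1 + u + v) →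
      1 + u ≤ (1 + 4 * c / N) * (1 + v) := by
    intro u v hu hv h
    have h1 := (le_abs_self _).trans h
    have h2 : 4 * c / N = 4 * a := by simp only [a]; ring
    rw [h2]
    nlinarith [mul_nonneg ha hv, mul_nonneg ha hu, mul_nonneg (mul_nonneg ha hu) hv]
  have hstep : ∀ j < 4 * N, 1 + ‖z (j + 1)‖ ≤ (1 + 4 * c / N) * (1 + ‖z j‖) ∧
      1 + ‖z j‖ ≤ (1 + 4 * c / N) * (1 + ‖z (j + 1)‖) := fun j hj => by
    have h1 := hz j hj
    refine ⟨hone _ _ (norm_nonneg _) (norm_nonneg _) ?_, hone _ _ (norm_nonneg _) (norm_nonneg _) ?_⟩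
    · refine (abs_norm_sub_norm_le _ _).trans (h1.trans (le_of_eq ?_)); ring
    · refine (abs_norm_sub_norm_le _ _).trans ?_
      rw [norm_sub_rev]; exact h1
  have hup : ∀ k, ∀ j, j + k ≤ 4 * N →
      1 + ‖z (j + k)‖ ≤ (1 + 4 * c / N) ^ k * (1 + ‖z j‖) ∧
      1 + ‖z j‖ ≤ (1 + 4 * c / N) ^ k * (1 + ‖z (j + k)‖) := fun k => by
    induction k with
    | zero => intro j _; simp
    | succ k ih =>
      intro j hjk
      obtain ⟨h1, h2⟩ := ih j (by omega)
      obtain ⟨h3, h4⟩ := hstep (j + k) (by omega)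
      rw [← add_assoc]
      constructor
      · calc _ ≤ _ := h3
          _ ≤ (1 + 4 * c / N) * ((1 + 4 * c / N) ^ k * (1 + ‖z j‖)) := by gcongr
          _ = _ := by ring
      · calc _ ≤ _ := h2
          _ ≤ (1 + 4 * c / N) ^ k * ((1 + 4 * c / N) * (1 + ‖z (j + k + 1)‖)) := by gcongr
          _ = _ := by ring
  have hexp : ∀ k ≤ 4 * N, (1 + 4 * c / N) ^ k ≤ Real.exp (16 * c) := fun k hk => by
    have := one_add_div_pow_le_exp (L := 4 * c) (by positivity) (m := 4) hN hk
    refine this.trans (le_of_eq ?_)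
    push_cast
    ring_nf
  rcases le_total i j with h | h
  · obtain ⟨k, rfl⟩ := Nat.exists_eq_add_of_le h
    exact (hup k i hj).2.trans (by gcongr; exact hexp k (by omega))
  · obtain ⟨k, rfl⟩ := Nat.exists_eq_add_of_le h
    exact (hup k j hi).1.trans (by gcongr; exact hexp k (by omega))

end ApproxOrbit

section HamiltonianField

variable {n : ℕ}

lemma fderiv_eq_inner_hamVF {h : Esp n → ℝ} {p : Esp n} (hh : DifferentiableAt ℝ h p) (v : Esp n) :
    fderiv ℝ h p v = ⟪(hamVF h p).1, v.2⟫ - ⟪(hamVF h p).2, v.1⟫ := by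
  have h1 : HasFDerivAt (fun η => h (p.1, η))
      ((fderiv ℝ h p).comp (ContinuousLinearMap.inr ℝ _ _)) p.2 :=
    HasFDerivAt.comp p.2 (hh.hasFDerivAt : HasFDerivAt h _ (p.1, p.2)) (hasFDerivAt_prodMk_right _ _)
  have h2 : HasFDerivAt (fun y => h (y, p.2))
      ((fderiv ℝ h p).comp (ContinuousLinearMap.inl ℝ _ _)) p.1 :=
    HasFDerivAt.comp p.1 (hh.hasFDerivAt : HasFDerivAt h _ (p.1, p.2)) (hasFDerivAt_prodMk_left _ _)
  simp only [hamVF, gradient, h1.fderiv, h2.fderiv, inner_neg_left,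
    InnerProductSpace.toDual_symm_apply, sub_neg_eq_add]
  simp only [ContinuousLinearMap.comp_apply, ContinuousLinearMap.inr_apply,
    ContinuousLinearMap.inl_apply, ← map_add, Prod.mk_add_mk, zero_add, add_zero]

/-- The complex structure `(x, ξ) ↦ (ξ, -x)`. -/
def rotField : Esp n →L[ℝ] Esp n :=
  (ContinuousLinearMap.snd ℝ _ _).prod (-(ContinuousLinearMap.fst ℝ _ _))

@[simp] lemma rotField_apply (y : Esp n) : rotField y = (y.2, -y.1) := rfl

end HamiltonianField

section DiscretePaths

/-- Discrete paths in `T*ℝⁿ` with `M` steps. -/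
def DiscPath (n M : ℕ) : Type :=
  PiLp 2 (fun _ : Fin M => WithLp 2 (EuclideanSpace ℝ (Fin n) × EuclideanSpace ℝ (Fin n)))

variable {n M : ℕ}

instance : NormedAddCommGroup (DiscPath n M) := inferInstanceAs (NormedAddCommGroup
  (PiLp 2 (fun _ : Fin M => WithLp 2 (EuclideanSpace ℝ (Fin n) × EuclideanSpace ℝ (Fin n)))))

instance : InnerProductSpace ℝ (DiscPath n M) := inferInstanceAs (InnerProductSpace ℝ
  (PiLp 2 (fun _ : Fin M => WithLp 2 (EuclideanSpace ℝ (Fin n) × EuclideanSpace ℝ (Fin n)))))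

instance : FiniteDimensional ℝ (DiscPath n M) := inferInstanceAs (FiniteDimensional ℝ
  (PiLp 2 (fun _ : Fin M => WithLp 2 (EuclideanSpace ℝ (Fin n) × EuclideanSpace ℝ (Fin n)))))

/-- The entries of a discrete path. -/
def entryFin (i : Fin M) : DiscPath n M →L[ℝ]
    WithLp 2 (EuclideanSpace ℝ (Fin n) × EuclideanSpace ℝ (Fin n)) :=
  (PiLp.proj (𝕜 := ℝ) 2 (fun _ : Fin M =>
    WithLp 2 (EuclideanSpace ℝ (Fin n) × EuclideanSpace ℝ (Fin n))) i :)

/-- The `j`-th entry of a discrete path, zero past the end. -/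
def entry (n M j : ℕ) : DiscPath n M →L[ℝ]
    WithLp 2 (EuclideanSpace ℝ (Fin n) × EuclideanSpace ℝ (Fin n)) :=
  if h : j < M then entryFin ⟨j, h⟩ else 0

/-- The discrete path with a given sequence of entries. -/
def ofEntries (M : ℕ) (w : ℕ → EuclideanSpace ℝ (Fin n) × EuclideanSpace ℝ (Fin n)) :
    DiscPath n M :=
  (WithLp.toLp 2 fun i : Fin M => WithLp.toLp 2 (w i) : PiLp 2 (fun _ : Fin M =>
    WithLp 2 (EuclideanSpace ℝ (Fin n) × EuclideanSpace ℝ (Fin n))))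

lemma entry_ofEntries {w : ℕ → EuclideanSpace ℝ (Fin n) × EuclideanSpace ℝ (Fin n)} {j : ℕ}
    (hj : j < M) : entry n M j (ofEntries M w) = WithLp.toLp 2 (w j) := by
  unfold entry
  rw [dif_pos hj]
  rfl

lemma entry_of_le {j : ℕ} (hj : M ≤ j) (x : DiscPath n M) : entry n M j x = 0 := by
  simp [entry, hj.not_gt]

/-- The position coordinates of a discrete path, which starts at position zero. -/
def posAt (c : ℕ → ℝ) : ℕ → (DiscPath n M →L[ℝ] EuclideanSpace ℝ (Fin n))
  | 0 => 0
  | k + 1 => c k • (WithLp.fstL 2 ℝ _ _).comp (entry n M k)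

/-- The momentum coordinates of a discrete path, which ends at momentum zero. -/
def momAt (c : ℕ → ℝ) (j : ℕ) : DiscPath n M →L[ℝ] EuclideanSpace ℝ (Fin n) :=
  c j • (WithLp.sndL 2 ℝ _ _).comp (entry n M j)

/-- The point of phase space visited between the steps `j` and `j + 1`. -/
def midAt (c : ℕ → ℝ) (j : ℕ) : DiscPath n M →L[ℝ] Esp n := (posAt c (j + 1)).prod (momAt c j)

/-- The discrete Hamiltonian action. -/
def discAction (c : ℕ → ℝ) (H : ℕ → Esp n → ℝ) (x : DiscPath n M) : ℝ :=
  ∑ j ∈ Finset.range M,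
    (⟪momAt c j x, posAt c (j + 1) x - posAt c j x⟫ - H j (midAt c j x))

@[simp] lemma posAt_zero (c : ℕ → ℝ) (x : DiscPath n M) : posAt c 0 x = 0 := rfl

lemma posAt_succ (c : ℕ → ℝ) (k : ℕ) (x : DiscPath n M) :
    posAt c (k + 1) x = c k • (entry n M k x).fst := rfl

lemma momAt_apply (c : ℕ → ℝ) (k : ℕ) (x : DiscPath n M) :
    momAt c k x = c k • (entry n M k x).snd := rfl

@[simp] lemma midAt_fst (c : ℕ → ℝ) (k : ℕ) (x : DiscPath n M) :
    (midAt c k x).1 = posAt c (k + 1) x := rfl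

@[simp] lemma midAt_snd (c : ℕ → ℝ) (k : ℕ) (x : DiscPath n M) :
    (midAt c k x).2 = momAt c k x := rfl

@[simp] lemma momAt_of_le (c : ℕ → ℝ) {k : ℕ} (hk : M ≤ k) (x : DiscPath n M) :
    momAt c k x = 0 := by
  simp [momAt, entry_of_le hk]

lemma inner_discPath (x u : DiscPath n M) : ⟪x, u⟫ = ∑ j ∈ Finset.range M,
    (⟪(entry n M j x).fst, (entry n M j u).fst⟫ + ⟪(entry n M j x).snd, (entry n M j u).snd⟫) := by
  rw [← Fin.sum_univ_eq_sum_range (fun j =>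
    ⟪(entry n M j x).fst, (entry n M j u).fst⟫ + ⟪(entry n M j x).snd, (entry n M j u).snd⟫)]
  refine (PiLp.inner_apply (𝕜 := ℝ) (f := fun _ : Fin M => WithLp 2 (EuclideanSpace ℝ (Fin n) ×
    EuclideanSpace ℝ (Fin n))) x u).trans (Finset.sum_congr rfl fun i _ => ?_)
  rw [WithLp.prod_inner_apply]
  unfold entry
  rw [dif_pos i.2]
  rfl

lemma sum_inner_momAt_posAt_sub (c : ℕ → ℝ) (x u : DiscPath n M) :
    ∑ j ∈ Finset.range M, ⟪momAt c j x, posAt c (j + 1) u - posAt c j u⟫ =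
      ∑ j ∈ Finset.range M, ⟪momAt c j x - momAt c (j + 1) x, posAt c (j + 1) u⟫ := by
  have h := Finset.sum_range_sub (fun j => ⟪momAt c j x, posAt c j u⟫) M
  simp only [momAt_of_le c le_rfl, inner_zero_left, posAt_zero, inner_zero_right, sub_zero] at h
  rw [← sub_eq_zero, ← Finset.sum_sub_distrib, ← h]
  refine Finset.sum_congr rfl fun j _ => ?_
  rw [inner_sub_right, inner_sub_left]
  ring

lemma contDiff_discAction (c : ℕ → ℝ) {H : ℕ → Esp n → ℝ} (hH : ∀ j < M, ContDiff ℝ 2 (H j)) :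
    ContDiff ℝ 2 (discAction c H : DiscPath n M → ℝ) := by
  refine ContDiff.sum fun j hj => ContDiff.sub ?_ ?_
  · exact (momAt c j).contDiff.inner ℝ ((posAt c (j + 1)).contDiff.sub (posAt c j).contDiff)
  · exact (hH j (Finset.mem_range.1 hj)).comp (midAt c j).contDiff

lemma fderiv_discAction (c : ℕ → ℝ) {H : ℕ → Esp n → ℝ} (hH : ∀ j < M, Differentiable ℝ (H j))
    (x u : DiscPath n M) : fderiv ℝ (discAction c H) x u =
      ∑ j ∈ Finset.range M, (⟪momAt c j u, posAt c (j + 1) x - posAt c j x⟫ +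
        ⟪momAt c j x, posAt c (j + 1) u - posAt c j u⟫ -
          fderiv ℝ (H j) (midAt c j x) (midAt c j u)) := by
  have h : HasFDerivAt (discAction c H) (∑ j ∈ Finset.range M,
      ((fderivInnerCLM ℝ (momAt c j x, posAt c (j + 1) x - posAt c j x)).comp
          ((momAt c j).prod (posAt c (j + 1) - posAt c j)) -
        (fderiv ℝ (H j) (midAt c j x)).comp (midAt c j))) x := by
    refine HasFDerivAt.fun_sum fun j hj => HasFDerivAt.sub ?_ ?_
    · exact (momAt c j).hasFDerivAt.inner ℝ ((posAt c (j + 1)).hasFDerivAt.sub (posAt c j).hasFDerivAt)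
    · exact (hH j (Finset.mem_range.1 hj) _).hasFDerivAt.comp x (midAt c j).hasFDerivAt
  rw [h.fderiv, sum_apply]
  refine Finset.sum_congr rfl fun j _ => ?_
  simp [fderivInnerCLM_apply]
  ring

/-- The discrete Hamilton equations, with the multiplier `τ` of the constraint to the sphere. -/
theorem step_of_fderiv_discAction_eq {c : ℕ → ℝ} (hc : ∀ j, c j ≠ 0) {H : ℕ → Esp n → ℝ}
    (hH : ∀ j < M, Differentiable ℝ (H j)) {x : DiscPath n M} {τ : ℝ}
    (hx : ∀ u, fderiv ℝ (discAction c H) x u = τ * ⟪x, u⟫) {j : ℕ} (hj : j < M) :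
    ((posAt c (j + 1) x, momAt c (j + 1) x) : Esp n) - (posAt c j x, momAt c j x) =
      hamVF (H j) (midAt c j x) + (τ * (c j ^ 2)⁻¹) • rotField (midAt c j x) := by
  have hmain : ∀ u, ∑ i ∈ Finset.range M, (⟪momAt c i u, posAt c (i + 1) x - posAt c i x
        - (hamVF (H i) (midAt c i x)).1⟫ + ⟪momAt c i x - momAt c (i + 1) x
        + (hamVF (H i) (midAt c i x)).2, posAt c (i + 1) u⟫) = τ * ⟪x, u⟫ := fun u => by
    rw [← hx u, fderiv_discAction c hH]
    simp only [Finset.sum_sub_distrib, Finset.sum_add_distrib, sum_inner_momAt_posAt_sub c x u]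
    simp only [← Finset.sum_add_distrib, ← Finset.sum_sub_distrib]
    refine Finset.sum_congr rfl fun i hi => ?_
    rw [fderiv_eq_inner_hamVF (hH i (Finset.mem_range.1 hi) _)]
    simp only [midAt_fst, midAt_snd, inner_sub_right, inner_add_left, inner_sub_left]
    rw [real_inner_comm (momAt c i u) (hamVF (H i) (midAt c i x)).1]
    ring
  have hentry : ∀ (w : EuclideanSpace ℝ (Fin n) × EuclideanSpace ℝ (Fin n)) (i : ℕ),
      entry n M i (ofEntries M fun k => if k = j then w else 0) =
        if i = j then WithLp.toLp 2 w else 0 := fun w i => by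
    by_cases hi : i < M
    · rw [entry_ofEntries hi]; split_ifs <;> rfl
    · rw [entry_of_le (not_lt.1 hi), if_neg (by omega)]
  have hw : ∀ w : EuclideanSpace ℝ (Fin n) × EuclideanSpace ℝ (Fin n),
      ⟪c j • w.2, posAt c (j + 1) x - posAt c j x - (hamVF (H j) (midAt c j x)).1⟫ +
      ⟪momAt c j x - momAt c (j + 1) x + (hamVF (H j) (midAt c j x)).2, c j • w.1⟫ =
      τ * (⟪(entry n M j x).fst, w.1⟫ + ⟪(entry n M j x).snd, w.2⟫) := fun w => by
    have h := hmain (ofEntries M fun k => if k = j then w else 0)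
    rw [inner_discPath, Finset.sum_eq_single_of_mem j (Finset.mem_range.2 hj),
      Finset.sum_eq_single_of_mem j (Finset.mem_range.2 hj)] at h
    · rw [momAt_apply, posAt_succ c j (ofEntries _ _), hentry, if_pos rfl] at h
      exact h
    · intro i _ hij
      rw [hentry, if_neg hij]; simp
    · intro i _ hij
      rw [momAt_apply, posAt_succ c i (ofEntries _ _), hentry, if_neg hij]; simp
  have hcj := hc j
  refine Prod.ext ?_ ?_
  · refine ext_inner_left ℝ fun b => ?_
    have h := hw (0, b)
    simp only [smul_zero, inner_zero_right, add_zero, zero_add,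
      inner_smul_left, inner_sub_right] at h
    simp only [Prod.fst_sub, Prod.fst_add, Prod.smul_fst, rotField_apply, midAt_snd,
      inner_sub_right, inner_add_right, inner_smul_right, momAt_apply c j x]
    rw [real_inner_comm (entry n M j x).snd b]
    simp only [conj_trivial] at h
    rw [← sub_eq_iff_eq_add']
    apply mul_left_cancel₀ hcj
    have : τ * ⟪(entry n M j x).snd, b⟫ =
        c j * (τ * (c j ^ 2)⁻¹ * (c j * ⟪(entry n M j x).snd, b⟫)) := by field_simp
    rw [this] at h
    linarith
  · refine ext_inner_left ℝ fun b => ?_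
    have h := hw (b, 0)
    simp only [smul_zero, inner_zero_right, add_zero, zero_add,
      inner_zero_left, inner_smul_right, inner_sub_left, inner_add_left] at h
    simp only [Prod.snd_sub, Prod.snd_add, Prod.smul_snd, rotField_apply, midAt_fst,
      inner_sub_right, inner_add_right, inner_smul_right, inner_neg_right, posAt_succ c j x]
    rw [real_inner_comm (entry n M j x).fst b, real_inner_comm _ b, real_inner_comm _ b,
      real_inner_comm _ b]
    apply mul_left_cancel₀ hcj
    have : τ * ⟪(entry n M j x).fst, b⟫ =
        c j * (τ * (c j ^ 2)⁻¹ * (c j * ⟪(entry n M j x).fst, b⟫)) := by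
      field_simp
    rw [this] at h
    linarith

lemma sum_weight_mul_sq_midAt {c : ℕ → ℝ} (hc : ∀ j, c j ≠ 0) (x : DiscPath n M) :
    ∑ j ∈ Finset.range M, (c j ^ 2)⁻¹ * (‖(midAt c j x).1‖ ^ 2 + ‖(midAt c j x).2‖ ^ 2) =
      ‖x‖ ^ 2 := by
  rw [← real_inner_self_eq_norm_sq, inner_discPath]
  refine Finset.sum_congr rfl fun j _ => ?_
  have hcj := hc j
  rw [midAt_fst, midAt_snd, posAt_succ, momAt_apply, norm_smul, norm_smul,
    real_inner_self_eq_norm_sq, real_inner_self_eq_norm_sq, mul_pow, mul_pow, Real.norm_eq_abs,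
    sq_abs]
  field_simp

lemma discAction_eq_of_fderiv_eq {c : ℕ → ℝ} {H : ℕ → Esp n → ℝ}
    (hH : ∀ j < M, Differentiable ℝ (H j)) {x : DiscPath n M} {τ : ℝ}
    (hx : ∀ u, fderiv ℝ (discAction c H) x u = τ * ⟪x, u⟫) :
    discAction c H x = τ / 2 * ‖x‖ ^ 2 + ∑ j ∈ Finset.range M,
      (fderiv ℝ (H j) (midAt c j x) (midAt c j x) / 2 - H j (midAt c j x)) := by
  have h := hx x
  rw [fderiv_discAction c hH, real_inner_self_eq_norm_sq] at h
  rw [div_mul_eq_mul_div, ← h, Finset.sum_div, ← Finset.sum_add_distrib, discAction]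
  exact Finset.sum_congr rfl fun j _ => by ring

end DiscretePaths

section ReturnOrbits

variable {n : ℕ}

/-- The point at which the step of a discrete orbit from time `j` to time `j + 1` is evaluated. -/
def midPt (z : ℕ → Esp n) (j : ℕ) : Esp n := ((z (j + 1)).1, (z j).2)

/-- A time-dependent field `X` and a field `Y`, Lipschitz and of linear growth. -/
structure FieldBounds (L : ℝ) (X : ℝ → Esp n → Esp n) (Y : Esp n → Esp n) : Prop where
  nonneg : 0 ≤ L
  out_lip : ∀ s t y w, ‖X s y - X t w‖ ≤ L * (|s - t| + ‖y - w‖)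
  out_growth : ∀ s y, ‖X s y‖ ≤ L * (1 + ‖y‖)
  turn_lip : ∀ y w, ‖Y y - Y w‖ ≤ L * ‖y - w‖
  turn_growth : ∀ y, ‖Y y‖ ≤ L * (1 + ‖y‖)

/-- A discrete orbit that starts in the fibre, rotates by the angle `τ`, follows `X`, then `Y`, then
`X` backwards, and ends in the base, up to rotations by `τ / N²` in each of the later steps. -/
structure ReturnOrbit (N : ℕ) (l τ : ℝ) (X : ℝ → Esp n → Esp n) (Y : Esp n → Esp n)
    (z : ℕ → Esp n) : Prop where
  rot : ∀ i < N, z (i + 1) - z i = (τ / N) • rotField (midPt z i)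
  out : ∀ i < N, z (N + i + 1) - z (N + i) = (l / N) • X (i / N) (midPt z (N + i)) +
    (τ / (N : ℝ) ^ 2) • rotField (midPt z (N + i))
  turn : ∀ i < N, z (2 * N + i + 1) - z (2 * N + i) = (N : ℝ)⁻¹ • Y (midPt z (2 * N + i)) +
    (τ / (N : ℝ) ^ 2) • rotField (midPt z (2 * N + i))
  back : ∀ i < N, z (3 * N + i + 1) - z (3 * N + i) =
    -((l / N) • X ((N - 1 - i : ℕ) / N) (midPt z (3 * N + i))) +
    (τ / (N : ℝ) ^ 2) • rotField (midPt z (3 * N + i))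
  start_fst : (z 0).1 = 0
  stop_snd : (z (4 * N)).2 = 0
  sum_eq_one : ∑ j ∈ Finset.range N, (‖(midPt z j).1‖ ^ 2 + ‖(midPt z j).2‖ ^ 2) / N +
    ∑ j ∈ Finset.Ico N (4 * N), (‖(midPt z j).1‖ ^ 2 + ‖(midPt z j).2‖ ^ 2) / (N : ℝ) ^ 2 = 1

lemma norm_rotField (y : Esp n) : ‖rotField y‖ = ‖y‖ := by
  simp [Prod.norm_def, max_comm]

lemma norm_midPt_le_add (z : ℕ → Esp n) (j : ℕ) : ‖midPt z j‖ ≤ ‖z j‖ + ‖z (j + 1)‖ := by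
  refine max_le ?_ ?_
  · exact (norm_fst_le (z (j + 1))).trans (le_add_of_nonneg_left (norm_nonneg _))
  · exact (norm_snd_le (z j)).trans (le_add_of_nonneg_right (norm_nonneg _))

lemma norm_midPt_le {z : ℕ → Esp n} {j : ℕ} {R : ℝ} (h1 : ‖z j‖ ≤ R) (h2 : ‖z (j + 1)‖ ≤ R) :
    ‖midPt z j‖ ≤ R :=
  max_le ((norm_fst_le (z (j + 1))).trans h2) ((norm_snd_le (z j)).trans h1)

lemma norm_midPt_sub_le (z : ℕ → Esp n) (j : ℕ) : ‖midPt z j - z j‖ ≤ ‖z (j + 1) - z j‖ := by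
  refine max_le (norm_fst_le (z (j + 1) - z j)) ?_
  simp [midPt]

lemma norm_midPt_sub_succ_le (z : ℕ → Esp n) (j : ℕ) :
    ‖midPt z j - z (j + 1)‖ ≤ ‖z (j + 1) - z j‖ := by
  rw [norm_sub_rev (z (j + 1)) (z j)]
  refine max_le ?_ (norm_snd_le (z j - z (j + 1)))
  simp [midPt]

namespace ReturnOrbit

variable {N : ℕ} {l τ : ℝ} {X : ℝ → Esp n → Esp n} {Y : Esp n → Esp n} {z : ℕ → Esp n}

lemma norm_step_le (h : ReturnOrbit N l τ X Y z) {L T : ℝ} (hF : FieldBounds L X Y) (hN : 0 < N)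
    (hl : |l| ≤ 1) (hτ : |τ| ≤ T) {j : ℕ} (hj : j < 4 * N) :
    ‖z (j + 1) - z j‖ ≤ (L + T) / N * (1 + ‖midPt z j‖) := by
  have hN' : (1 : ℝ) ≤ N := by exact_mod_cast hN
  have hT : 0 ≤ T := (abs_nonneg _).trans hτ
  have hL := hF.nonneg
  have hrot : ∀ y : Esp n, ‖(τ / (N : ℝ) ^ 2) • rotField y‖ ≤ T / N * (1 + ‖y‖) := fun y => by
    rw [norm_smul, norm_rotField, norm_div, Real.norm_eq_abs, norm_pow, Real.norm_natCast]
    gcongr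
    · nlinarith
    · linarith
  have hrot' : ∀ y : Esp n, ‖(τ / N) • rotField y‖ ≤ T / N * (1 + ‖y‖) := fun y => by
    rw [norm_smul, norm_rotField, norm_div, Real.norm_eq_abs, Real.norm_natCast]
    gcongr
    linarith
  have hX : ∀ s y, ‖(l / N) • X s y‖ ≤ L / N * (1 + ‖y‖) := fun s y => by
    rw [norm_smul, norm_div, Real.norm_eq_abs, Real.norm_natCast]
    calc |l| / N * ‖X s y‖ ≤ 1 / N * (L * (1 + ‖y‖)) := by
          gcongr
          exact hF.out_growth _ _
      _ = _ := by ring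
  have hY : ∀ y, ‖(N : ℝ)⁻¹ • Y y‖ ≤ L / N * (1 + ‖y‖) := fun y => by
    rw [norm_smul, norm_inv, Real.norm_natCast]
    calc (N : ℝ)⁻¹ * ‖Y y‖ ≤ (N : ℝ)⁻¹ * (L * (1 + ‖y‖)) := by
          gcongr
          exact hF.turn_growth _
      _ = _ := by ring
  have hsplit : (L + T) / N * (1 + ‖midPt z j‖) = L / N * (1 + ‖midPt z j‖) +
      T / N * (1 + ‖midPt z j‖) := by ring
  rw [hsplit]
  have hLn : 0 ≤ L / N * (1 + ‖midPt z j‖) := by positivity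
  rcases lt_or_ge j N with h1 | h1
  · rw [h.rot j h1]
    linarith [hrot' (midPt z j)]
  rcases lt_or_ge j (2 * N) with h2 | h2
  · obtain ⟨i, rfl⟩ := Nat.exists_eq_add_of_le h1
    rw [h.out i (by omega)]
    exact (norm_add_le _ _).trans (add_le_add (hX _ _) (hrot _))
  rcases lt_or_ge j (3 * N) with h3 | h3
  · obtain ⟨i, rfl⟩ := Nat.exists_eq_add_of_le h2
    rw [h.turn i (by omega)]
    exact (norm_add_le _ _).trans (add_le_add (hY _) (hrot _))
  · obtain ⟨i, rfl⟩ := Nat.exists_eq_add_of_le h3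
    rw [h.back i (by omega)]
    refine (norm_add_le _ _).trans (add_le_add ?_ (hrot _))
    rw [norm_neg]
    exact hX _ _

/-- A priori bounds for return orbits. -/
lemma exists_bound (L T : ℝ) : ∃ C : ℝ, 0 ≤ C ∧ ∀ {N : ℕ} {l τ : ℝ} {X : ℝ → Esp n → Esp n}
    {Y : Esp n → Esp n} {z : ℕ → Esp n}, ReturnOrbit N l τ X Y z → FieldBounds L X Y → 0 < N →
    2 * (L + T) ≤ N → |l| ≤ 1 → |τ| ≤ T →
    (∀ j ≤ 4 * N, ‖z j‖ ≤ C) ∧ ∀ j < 4 * N, ‖z (j + 1) - z j‖ ≤ C / N := by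
  set c := L + T
  set R := Real.exp (16 * c) * (2 + T)
  refine ⟨max 0 (max R (c * (1 + 2 * R))), le_max_left _ _, ?_⟩
  intro N l τ X Y z h hF hN hcN hl hτ
  have hN' : (0 : ℝ) < N := by exact_mod_cast hN
  have hN1 : (1 : ℝ) ≤ N := by exact_mod_cast hN
  have hT : 0 ≤ T := (abs_nonneg _).trans hτ
  have hc : 0 ≤ c := add_nonneg hF.nonneg hT
  have hstep : ∀ j < 4 * N, ‖z (j + 1) - z j‖ ≤ c / N * (1 + ‖z j‖ + ‖z (j + 1)‖) := fun j hj => by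
    refine (h.norm_step_le hF hN hl hτ hj).trans ?_
    rw [add_assoc]
    gcongr
    exact norm_midPt_le_add _ _
  obtain ⟨j, hj, hy⟩ : ∃ j < N, ‖(midPt z j).1‖ ^ 2 + ‖(midPt z j).2‖ ^ 2 ≤ 1 := by
    by_contra! hcon
    have h1 : (1 : ℝ) < ∑ j ∈ Finset.range N,
        (‖(midPt z j).1‖ ^ 2 + ‖(midPt z j).2‖ ^ 2) / N := by
      calc (1 : ℝ) = ∑ j ∈ Finset.range N, (1 : ℝ) / N := by simp; field_simp
        _ < _ := by
          refine Finset.sum_lt_sum_of_nonempty ⟨0, Finset.mem_range.2 hN⟩ fun j hj => ?_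
          have := hcon j (Finset.mem_range.1 hj)
          gcongr
    have h2 : 0 ≤ ∑ j ∈ Finset.Ico N (4 * N),
        (‖(midPt z j).1‖ ^ 2 + ‖(midPt z j).2‖ ^ 2) / (N : ℝ) ^ 2 :=
      Finset.sum_nonneg fun j _ => by positivity
    linarith [h.sum_eq_one]
  have hy1 : ‖midPt z j‖ ≤ 1 := by
    refine max_le ?_ ?_ <;> refine abs_le_of_sq_le_sq' ?_ zero_le_one |>.2 <;> rw [one_pow]
    · nlinarith [sq_nonneg ‖(midPt z j).2‖]
    · nlinarith [sq_nonneg ‖(midPt z j).1‖]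
  have hzj : ‖z j‖ ≤ 1 + T := by
    have h1 : ‖z (j + 1) - z j‖ ≤ T := by
      rw [h.rot j hj, norm_smul, norm_rotField, norm_div, Real.norm_eq_abs, Real.norm_natCast]
      calc |τ| / N * ‖midPt z j‖ ≤ T / N * 1 := by gcongr
        _ ≤ T := by rw [mul_one]; exact div_le_self hT hN1
    calc ‖z j‖ = ‖midPt z j - (midPt z j - z j)‖ := by rw [sub_sub_cancel]
      _ ≤ ‖midPt z j‖ + ‖midPt z j - z j‖ := norm_sub_le _ _
      _ ≤ 1 + T := add_le_add hy1 ((norm_midPt_sub_le z j).trans h1)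
  have hR : ∀ i ≤ 4 * N, ‖z i‖ ≤ R := fun i hi => by
    have h1 := norm_le_of_linear_growth hc hN hcN hstep hi (show j ≤ 4 * N by omega)
    have h2 : Real.exp (16 * c) * (1 + ‖z j‖) ≤ R := by
      exact mul_le_mul_of_nonneg_left (by linarith) (Real.exp_pos _).le
    linarith
  refine ⟨fun i hi => (hR i hi).trans ((le_max_left _ _).trans (le_max_right _ _)), fun i hi => ?_⟩
  refine (hstep i hi).trans ?_
  rw [div_mul_eq_mul_div]
  gcongr
  refine le_trans ?_ ((le_max_right _ _).trans (le_max_right _ _))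
  exact mul_le_mul_of_nonneg_left (by linarith [hR i hi.le, hR (i + 1) hi]) hc

end ReturnOrbit

end ReturnOrbits

section ReturnOrbits

variable {n : ℕ}

/-- Uniform estimates for a return orbit. -/
structure OrbitEstimates (C : ℝ) (N : ℕ) (l τ : ℝ) (X : ℝ → Esp n → Esp n) (Y : Esp n → Esp n)
    (z : ℕ → Esp n) : Prop where
  nonneg : 0 ≤ C
  bound : ∀ j ≤ 4 * N, ‖z j‖ ≤ C
  mid_bound : ∀ j < 4 * N, ‖midPt z j‖ ≤ C
  step : ∀ j < 4 * N, ‖z (j + 1) - z j‖ ≤ C / N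
  mid : ∀ j < 4 * N, ‖midPt z j - z j‖ ≤ C / N
  mid_succ : ∀ j < 4 * N, ‖midPt z j - z (j + 1)‖ ≤ C / N
  rot : IsApproxOrbit N C (fun _ y => τ • rotField y) z
  out : IsApproxOrbit N C (fun i y => l • X (i / N) y) (fun i => z (N + i))
  turn : IsApproxOrbit N C (fun _ => Y) (fun i => z (2 * N + i))
  out_rev : IsApproxOrbit N C (fun i y => -(l • X ((N - 1 - i : ℕ) / N) y)) (fun i => z (2 * N - i))
  back : IsApproxOrbit N C (fun i y => -(l • X ((N - 1 - i : ℕ) / N) y)) (fun i => z (3 * N + i))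

lemma norm_sub_sub_smul_le {a b m ρ : Esp n} {Z : Esp n → Esp n} {N : ℕ} {C L D : ℝ}
    (hab : a - b = (N : ℝ)⁻¹ • Z m + ρ) (hZ : ‖Z m - Z b‖ ≤ L * ‖m - b‖) (hL : 0 ≤ L)
    (hm : ‖m - b‖ ≤ C / N) (hρ : ‖ρ‖ ≤ D / (N : ℝ) ^ 2) :
    ‖a - b - (N : ℝ)⁻¹ • Z b‖ ≤ (L * C + D) / (N : ℝ) ^ 2 := by
  have h1 : a - b - (N : ℝ)⁻¹ • Z b = (N : ℝ)⁻¹ • (Z m - Z b) + ρ := by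
    rw [hab, smul_sub]; abel
  have h2 : ‖(N : ℝ)⁻¹ • (Z m - Z b)‖ ≤ L * C / (N : ℝ) ^ 2 := by
    rw [norm_smul, norm_inv, Real.norm_natCast]
    calc (N : ℝ)⁻¹ * ‖Z m - Z b‖ ≤ (N : ℝ)⁻¹ * (L * (C / N)) := by
          gcongr
          exact hZ.trans (mul_le_mul_of_nonneg_left hm hL)
      _ = _ := by
        field_simp
  rw [h1, add_div]
  exact (norm_add_le _ _).trans (add_le_add h2 hρ)

namespace ReturnOrbit

lemma exists_estimates (L T : ℝ) : ∃ C : ℝ, ∀ {N : ℕ} {l τ : ℝ} {X : ℝ → Esp n → Esp n}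
    {Y : Esp n → Esp n} {z : ℕ → Esp n}, ReturnOrbit N l τ X Y z → FieldBounds L X Y → 0 < N →
    2 * (L + T) ≤ N → |l| ≤ 1 → |τ| ≤ T → OrbitEstimates C N l τ X Y z := by
  obtain ⟨C, hC, hb⟩ := exists_bound (n := n) L T
  refine ⟨max C (max (T * C + 0) (L * C + T * C)), ?_⟩
  intro N l τ X Y z h hF hN hcN hl hτ
  have hN' : (0 : ℝ) < N := by exact_mod_cast hN
  have hT : 0 ≤ T := (abs_nonneg _).trans hτ
  have hL := hF.nonneg
  obtain ⟨hb1, hb2⟩ := hb h hF hN hcN hl hτ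
  set C' := max C (max (T * C + 0) (L * C + T * C))
  have hCC : C ≤ C' := le_max_left _ _
  have h2 : T * C + 0 ≤ C' := (le_max_left _ _).trans (le_max_right _ _)
  have h3 : L * C + T * C ≤ C' := (le_max_right _ _).trans (le_max_right _ _)
  have hm : ∀ j < 4 * N, ‖midPt z j‖ ≤ C := fun j hj =>
    norm_midPt_le (hb1 j hj.le) (hb1 (j + 1) hj)
  have hmz : ∀ j < 4 * N, ‖midPt z j - z j‖ ≤ C / N := fun j hj =>
    (norm_midPt_sub_le z j).trans (hb2 j hj)
  have hmz' : ∀ j < 4 * N, ‖midPt z j - z (j + 1)‖ ≤ C / N := fun j hj =>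
    (norm_midPt_sub_succ_le z j).trans (hb2 j hj)
  have hρ : ∀ j < 4 * N, ‖(τ / (N : ℝ) ^ 2) • rotField (midPt z j)‖ ≤ T * C / (N : ℝ) ^ 2 :=
    fun j hj => by
      rw [norm_smul, norm_rotField, norm_div, Real.norm_eq_abs, norm_pow, Real.norm_natCast,
        div_mul_eq_mul_div]
      gcongr
      exact hm j hj
  have hX : ∀ s y w, ‖l • X s y - l • X s w‖ ≤ L * ‖y - w‖ := fun s y w => by
    have := hF.out_lip s s y w
    rw [sub_self, abs_zero, zero_add] at this
    rw [← smul_sub, norm_smul, Real.norm_eq_abs]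
    nlinarith [norm_nonneg (X s y - X s w), abs_nonneg l]
  have hX' : ∀ s y w, ‖-(l • X s y) - -(l • X s w)‖ ≤ L * ‖y - w‖ := fun s y w => by
    rw [neg_sub_neg, norm_sub_rev y w]
    exact hX s w y
  refine ⟨hC.trans hCC, fun j hj => (hb1 j hj).trans hCC, fun j hj => (hm j hj).trans hCC,
    fun j hj => (hb2 j hj).trans (by gcongr), fun j hj => (hmz j hj).trans (by gcongr),
    fun j hj => (hmz' j hj).trans (by gcongr), ?_, ?_, ?_, ?_, ?_⟩
  · intro i hi
    refine (norm_sub_sub_smul_le (Z := fun y => τ • rotField y) (m := midPt z i) (ρ := 0) (L := T)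
      (D := 0) ?_ ?_ hT (hmz i (by omega)) (by simp)).trans (by gcongr)
    · rw [h.rot i hi, add_zero, smul_smul, div_eq_inv_mul]
    · rw [← smul_sub, ← map_sub, norm_smul, norm_rotField]
      exact mul_le_mul_of_nonneg_right hτ (norm_nonneg _)
  · intro i hi
    refine (norm_sub_sub_smul_le (Z := fun y => l • X (i / N) y) (m := midPt z (N + i)) ?_
      (hX _ _ _) hL (hmz (N + i) (by omega)) (hρ (N + i) (by omega))).trans (by gcongr)
    simp only [← add_assoc]
    rw [h.out i hi, smul_smul, div_eq_inv_mul]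
  · intro i hi
    refine (norm_sub_sub_smul_le (Z := Y) (m := midPt z (2 * N + i)) ?_
      (hF.turn_lip _ _) hL (hmz (2 * N + i) (by omega)) (hρ (2 * N + i) (by omega))).trans
      (by gcongr)
    simp only [← add_assoc]
    rw [h.turn i hi]
  · intro i hi
    obtain ⟨k, hk⟩ : ∃ k, k + 1 + i = N := ⟨N - 1 - i, by omega⟩
    have e1 : 2 * N - i = N + k + 1 := by omega
    have e2 : 2 * N - (i + 1) = N + k := by omega
    have e3 : N - 1 - i = k := by omega
    simp only [e1, e2, e3]
    refine (norm_sub_sub_smul_le (Z := fun y => -(l • X (k / N) y)) (m := midPt z (N + k))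
      (ρ := -((τ / (N : ℝ) ^ 2) • rotField (midPt z (N + k)))) ?_
      (hX' _ _ _) hL (hmz' (N + k) (by omega)) ?_).trans (by gcongr)
    · rw [← neg_sub, h.out k (by omega), smul_neg, smul_smul, div_eq_inv_mul, neg_add]
    · rw [norm_neg]
      exact hρ (N + k) (by omega)
  · intro i hi
    refine (norm_sub_sub_smul_le (Z := fun y => -(l • X ((N - 1 - i : ℕ) / N) y))
      (m := midPt z (3 * N + i)) ?_ (hX' _ _ _) hL (hmz (3 * N + i) (by omega))
      (hρ (3 * N + i) (by omega))).trans (by gcongr)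
    simp only [← add_assoc]
    rw [h.back i hi, smul_neg, smul_smul, div_eq_inv_mul]

end ReturnOrbit

end ReturnOrbits

section ReturnOrbits

variable {n : ℕ}

/-- The point at angle `t` of the circle through the covector `v`. -/
def circlePt (v : EuclideanSpace ℝ (Fin n)) (t : ℝ) : Esp n := (Real.sin t • v, Real.cos t • v)

lemma hasDerivAt_circlePt (v : EuclideanSpace ℝ (Fin n)) (τ t : ℝ) :
    HasDerivAt (fun s => circlePt v (τ * s)) (τ • rotField (circlePt v (τ * t))) t := by
  have h : HasDerivAt (fun s => τ * s) τ t := by simpa using (hasDerivAt_id t).const_mul τ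
  refine ((h.sin.smul_const v).prodMk (h.cos.smul_const v)).congr_deriv (Prod.ext ?_ ?_)
  · change (Real.cos (τ * t) * τ) • v = τ • Real.cos (τ * t) • v
    rw [smul_smul, mul_comm]
  · change (-Real.sin (τ * t) * τ) • v = τ • -(Real.sin (τ * t) • v)
    rw [← neg_smul, smul_smul, mul_comm]

lemma norm_circlePt_sub_circlePt_le (v w : EuclideanSpace ℝ (Fin n)) (t : ℝ) :
    ‖circlePt v t - circlePt w t‖ ≤ ‖v - w‖ := by
  refine max_le ?_ ?_
  · change ‖Real.sin t • v - Real.sin t • w‖ ≤ _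
    rw [← smul_sub, norm_smul]
    exact mul_le_of_le_one_left (norm_nonneg _) (Real.abs_sin_le_one t)
  · change ‖Real.cos t • v - Real.cos t • w‖ ≤ _
    rw [← smul_sub, norm_smul]
    exact mul_le_of_le_one_left (norm_nonneg _) (Real.abs_cos_le_one t)

lemma norm_circlePt_le (v : EuclideanSpace ℝ (Fin n)) (t : ℝ) : ‖circlePt v t‖ ≤ ‖v‖ := by
  have := norm_circlePt_sub_circlePt_le v 0 t
  simpa [circlePt] using this

lemma norm_circlePt_sub_le (v : EuclideanSpace ℝ (Fin n)) (s t : ℝ) :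
    ‖circlePt v s - circlePt v t‖ ≤ |s - t| * ‖v‖ := by
  refine max_le ?_ ?_
  · change ‖Real.sin s • v - Real.sin t • v‖ ≤ _
    rw [← sub_smul, norm_smul]
    gcongr
    exact Real.abs_sin_sub_sin_le s t
  · change ‖Real.cos s • v - Real.cos t • v‖ ≤ _
    rw [← sub_smul, norm_smul]
    gcongr
    exact Real.abs_cos_sub_cos_le s t

lemma sq_norm_circlePt (v : EuclideanSpace ℝ (Fin n)) (t : ℝ) :
    ‖(circlePt v t).1‖ ^ 2 + ‖(circlePt v t).2‖ ^ 2 = ‖v‖ ^ 2 := by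
  simp only [circlePt, norm_smul, mul_pow, Real.norm_eq_abs, sq_abs, ← add_mul,
    Real.sin_sq_add_cos_sq, one_mul]

lemma abs_sq_norm_sub_sq_norm_le {A : Type*} [SeminormedAddCommGroup A] {a b : A} {C D : ℝ}
    (ha : ‖a‖ ≤ C) (hb : ‖b‖ ≤ C) (hab : ‖a - b‖ ≤ D) : |‖a‖ ^ 2 - ‖b‖ ^ 2| ≤ D * (2 * C) := by
  have h1 : ‖a‖ ^ 2 - ‖b‖ ^ 2 = (‖a‖ - ‖b‖) * (‖a‖ + ‖b‖) := by ring
  rw [h1, abs_mul, abs_of_nonneg (a := ‖a‖ + ‖b‖) (by positivity)]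
  have h2 := (abs_norm_sub_norm_le a b).trans hab
  exact mul_le_mul h2 (by linarith) (by positivity) ((abs_nonneg _).trans h2)

namespace OrbitEstimates

/-- After the rotation, a return orbit is close to the circle of a unit covector. -/
lemma exists_circlePt (C T : ℝ) : ∃ C' : ℝ, ∀ {N : ℕ} {l τ : ℝ} {X : ℝ → Esp n → Esp n}
    {Y : Esp n → Esp n} {z : ℕ → Esp n}, OrbitEstimates C N l τ X Y z →
    ReturnOrbit N l τ X Y z → |τ| ≤ T → C' < N →
    ∃ v : EuclideanSpace ℝ (Fin n), ‖v‖ = 1 ∧ ‖z N - circlePt v τ‖ ≤ C' / N := by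
  set E := Real.exp T * (C + T * (T * C))
  set S := (C + E) * (2 * C) + (C + E) * (2 * C) + 6 * C ^ 2
  refine ⟨max 0 (E + S), ?_⟩
  intro N l τ X Y z hz h hτ hN
  have hT : 0 ≤ T := (abs_nonneg _).trans hτ
  have hC := hz.nonneg
  have hN' : (0 : ℝ) < N := (le_max_left _ _).trans_lt hN
  have hE : 0 ≤ E := by positivity
  have hS : 0 ≤ S := by positivity
  have hSN : S < N := by linarith [(le_max_right 0 (E + S)).trans_lt hN]
  have hNn : 0 < N := by exact_mod_cast hN'
  set p := (z 0).2
  have hp : ‖p‖ ≤ C := (norm_snd_le (z 0)).trans (hz.bound 0 (by omega))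
  set γ : ℝ → Esp n := fun t => circlePt p (τ * t)
  have hz0 : z 0 = γ 0 := Prod.ext (by simp [γ, circlePt, h.start_fst]) (by simp [γ, circlePt, p])
  have hγ : IsApproxOrbit N (T * (T * C)) (fun _ y => τ • rotField y) (fun i => γ (i / N)) := by
    intro i hi
    refine norm_curve_step_le (γ := γ) (γ' := fun t => τ • rotField (γ t))
      (fun t _ => hasDerivAt_circlePt p τ t) (fun s _ t _ => ?_) hi
    rw [← smul_sub, ← map_sub, norm_smul, norm_rotField, mul_assoc]
    refine mul_le_mul hτ ?_ (norm_nonneg _) hT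
    refine (norm_circlePt_sub_le _ _ _).trans ?_
    rw [← mul_sub, abs_mul]
    calc |τ| * |s - t| * ‖p‖ ≤ T * |s - t| * C := by gcongr
      _ = _ := by ring
  have hclose : ∀ i ≤ N, ‖z i - γ (i / N)‖ ≤ E / N := fun i hi => by
    have := hz.rot.dist_le hγ hT (by positivity) (fun i _ x y => by
      rw [← smul_sub, ← map_sub, norm_smul, norm_rotField]
      exact mul_le_mul_of_nonneg_right hτ (norm_nonneg _)) hi
    simp only [Nat.cast_zero, zero_div, ← hz0, sub_self, norm_zero, zero_add] at this
    rwa [← mul_div_assoc] at this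
  have hmid : ∀ i < N, |‖(midPt z i).1‖ ^ 2 + ‖(midPt z i).2‖ ^ 2 - ‖p‖ ^ 2| ≤
      ((C + E) * (2 * C) + (C + E) * (2 * C)) / N := fun i hi => by
    have h1 : ‖midPt z i - γ (i / N)‖ ≤ (C + E) / N := by
      rw [← sub_add_sub_cancel _ (z i), add_div]
      exact (norm_add_le _ _).trans (add_le_add (hz.mid i (by omega)) (hclose i hi.le))
    have h2 := hz.mid_bound i (by omega)
    have h3 : ‖γ (i / N)‖ ≤ C := (norm_circlePt_le _ _).trans hp
    have h4 := abs_sq_norm_sub_sq_norm_le ((norm_fst_le _).trans h2) ((norm_fst_le _).trans h3)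
      ((norm_fst_le (midPt z i - γ (i / N))).trans h1)
    have h5 := abs_sq_norm_sub_sq_norm_le ((norm_snd_le _).trans h2) ((norm_snd_le _).trans h3)
      ((norm_snd_le (midPt z i - γ (i / N))).trans h1)
    rw [← sq_norm_circlePt p (τ * (i / N)), add_sub_add_comm, add_div, mul_div_right_comm]
    exact (abs_add_le _ _).trans (add_le_add h4 h5)
  have hsq : |1 - ‖p‖ ^ 2| ≤ S / N := by
    have h1 : ‖p‖ ^ 2 = ∑ j ∈ Finset.range N, ‖p‖ ^ 2 / N := by simp; field_simp
    have h2 : |∑ j ∈ Finset.range N, (‖(midPt z j).1‖ ^ 2 + ‖(midPt z j).2‖ ^ 2) / N - ‖p‖ ^ 2| ≤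
        ((C + E) * (2 * C) + (C + E) * (2 * C)) / N := by
      have e : ∑ j ∈ Finset.range N, (‖(midPt z j).1‖ ^ 2 + ‖(midPt z j).2‖ ^ 2) / N - ‖p‖ ^ 2 =
          ∑ j ∈ Finset.range N,
            ((‖(midPt z j).1‖ ^ 2 + ‖(midPt z j).2‖ ^ 2) / N - ‖p‖ ^ 2 / N) := by
        rw [Finset.sum_sub_distrib, ← h1]
      rw [e]
      refine (Finset.abs_sum_le_sum_abs _ _).trans ((Finset.sum_le_sum
        (g := fun _ => ((C + E) * (2 * C) + (C + E) * (2 * C)) / N / N) fun j hj => ?_).trans ?_)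
      · rw [← sub_div, abs_div, Nat.abs_cast]
        gcongr
        exact hmid j (Finset.mem_range.1 hj)
      · simp only [Finset.sum_const, Finset.card_range, nsmul_eq_mul]
        exact (mul_div_cancel₀ _ hN'.ne').le
    have h3 : |∑ j ∈ Finset.Ico N (4 * N),
        (‖(midPt z j).1‖ ^ 2 + ‖(midPt z j).2‖ ^ 2) / (N : ℝ) ^ 2| ≤ 6 * C ^ 2 / N := by
      rw [abs_of_nonneg (Finset.sum_nonneg fun j _ => by positivity)]
      refine (Finset.sum_le_sum (g := fun _ => 2 * C ^ 2 / (N : ℝ) ^ 2) fun j hj => ?_).trans ?_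
      · have h2 := hz.mid_bound j (Finset.mem_Ico.1 hj).2
        have := (norm_fst_le _).trans h2
        have := (norm_snd_le _).trans h2
        rw [two_mul]
        gcongr
      · simp only [Finset.sum_const, Nat.card_Ico, nsmul_eq_mul]
        rw [show 4 * N - N = 3 * N by omega]
        push_cast
        apply le_of_eq
        field_simp
        ring
    have h4 := h.sum_eq_one
    have h5 : 1 - ‖p‖ ^ 2 = (∑ j ∈ Finset.range N,
        (‖(midPt z j).1‖ ^ 2 + ‖(midPt z j).2‖ ^ 2) / N - ‖p‖ ^ 2) +
        ∑ j ∈ Finset.Ico N (4 * N),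
          (‖(midPt z j).1‖ ^ 2 + ‖(midPt z j).2‖ ^ 2) / (N : ℝ) ^ 2 := by rw [← h4]; ring
    rw [h5]
    refine (abs_add_le _ _).trans ((add_le_add h2 h3).trans (le_of_eq ?_))
    simp only [S]; ring
  have hp1 : |1 - ‖p‖| ≤ S / N := by
    refine le_trans ?_ hsq
    rw [show 1 - ‖p‖ ^ 2 = (1 - ‖p‖) * (1 + ‖p‖) by ring, abs_mul,
      abs_of_pos (a := 1 + ‖p‖) (by positivity)]
    exact le_mul_of_one_le_right (abs_nonneg _) (by linarith [norm_nonneg p])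
  have hp0 : ‖p‖ ≠ 0 := fun h0 => by
    rw [h0, sub_zero, abs_one, le_div_iff₀ hN'] at hp1
    linarith
  refine ⟨‖p‖⁻¹ • p, ?_, ?_⟩
  · rw [norm_smul, norm_inv, norm_norm, inv_mul_cancel₀ hp0]
  · have h1 : ‖p - ‖p‖⁻¹ • p‖ ≤ S / N := by
      refine le_trans (le_of_eq ?_) hp1
      have h2 : p - ‖p‖⁻¹ • p = (1 - ‖p‖⁻¹) • p := by rw [sub_smul, one_smul]
      rw [h2, norm_smul, Real.norm_eq_abs, ← abs_norm p, ← abs_mul, abs_norm, sub_mul,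
        inv_mul_cancel₀ hp0, one_mul, abs_sub_comm]
    have h2 := hclose N le_rfl
    rw [div_self hN'.ne'] at h2
    have h3 : γ 1 = circlePt p τ := by simp [γ]
    rw [h3] at h2
    rw [← sub_add_sub_cancel _ (circlePt p τ)]
    calc _ ≤ E / N + S / N := (norm_add_le _ _).trans
          (add_le_add h2 ((norm_circlePt_sub_circlePt_le _ _ _).trans h1))
      _ = (E + S) / N := by ring
      _ ≤ _ := by gcongr; exact le_max_right _ _

end OrbitEstimates

end ReturnOrbits

section ReturnOrbits

variable {n : ℕ}

/-- An integral curve over `[0, 1]` of a time-dependent field, with `K`-Lipschitz velocity. -/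
structure IsFlowCurve (K : ℝ) (X : ℝ → Esp n → Esp n) (γ : ℝ → Esp n) : Prop where
  deriv : ∀ t ∈ Icc (0 : ℝ) 1, HasDerivAt γ (X t (γ t)) t
  lip : ∀ s ∈ Icc (0 : ℝ) 1, ∀ t ∈ Icc (0 : ℝ) 1, ‖X s (γ s) - X t (γ t)‖ ≤ K * |s - t|

/-- The integral curve of `Y` from `w` returns to `w` at time `1`, and `g` vanishes along it. -/
def HasLoop (K : ℝ) (Y : Esp n → Esp n) (g : Esp n → ℝ) (w : Esp n) : Prop :=
  ∃ γ : ℝ → Esp n, IsFlowCurve K (fun _ => Y) γ ∧ γ 0 = w ∧ γ 1 = w ∧ ∀ t ∈ Icc (0 : ℝ) 1, g (γ t) = 0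

lemma natCast_div_mem_Icc {i N : ℕ} (hi : i ≤ N) : ((i : ℝ) / N) ∈ Icc (0 : ℝ) 1 :=
  ⟨by positivity, div_le_one_of_le₀ (by exact_mod_cast hi) (by positivity)⟩

lemma IsFlowCurve.dist_le {K C L : ℝ} {N : ℕ} {X : ℝ → Esp n → Esp n} {γ : ℝ → Esp n}
    {z : ℕ → Esp n} (hγ : IsFlowCurve K X γ) (hz : IsApproxOrbit N C (fun i y => X (i / N) y) z)
    (hL : 0 ≤ L) (hC : 0 ≤ C) (hK : 0 ≤ K) (hX : ∀ s y w, ‖X s y - X s w‖ ≤ L * ‖y - w‖)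
    {i : ℕ} (hi : i ≤ N) :
    ‖z i - γ (i / N)‖ ≤ Real.exp L * (‖z 0 - γ 0‖ + (C + K) / N) := by
  have h : IsApproxOrbit N K (fun i y => X (i / N) y) (fun i => γ (i / N)) := fun i hi =>
    norm_curve_step_le hγ.deriv hγ.lip hi
  simpa using hz.dist_le h hL (add_nonneg hC hK) (fun i _ x y => hX (i / N) x y) hi

namespace OrbitEstimates

variable {C : ℝ} {N : ℕ} {l τ : ℝ} {X : ℝ → Esp n → Esp n} {Y : Esp n → Esp n} {z : ℕ → Esp n}

lemma turn_le (h : OrbitEstimates C N l τ X Y z) {L K D : ℝ} {g : Esp n → ℝ} {w : Esp n}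
    (hF : FieldBounds L X Y) (hK : 0 ≤ K) (hg : ∀ y w, |g y - g w| ≤ L * ‖y - w‖)
    (hw : ‖z (2 * N) - w‖ ≤ D / N) (hl : HasLoop K Y g w) :
    ‖z (3 * N) - z (2 * N)‖ ≤ (Real.exp L * (D + (C + K)) + D) / N ∧
      ∀ i < N, |g (midPt z (2 * N + i))| ≤ L * (C + Real.exp L * (D + (C + K))) / N := by
  obtain ⟨γ, hγ, h0, h1, hg0⟩ := hl
  have hL := hF.nonneg
  have key : ∀ i ≤ N, ‖z (2 * N + i) - γ (i / N)‖ ≤ Real.exp L * (D + (C + K)) / N := fun i hi => by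
    have := hγ.dist_le h.turn hL h.nonneg hK (fun _ => hF.turn_lip) hi
    refine this.trans ?_
    simp only [add_zero, h0]
    rw [mul_div_assoc, add_div D]
    gcongr
  constructor
  · rcases Nat.eq_zero_or_pos N with rfl | hN
    · simp
    have := key N le_rfl
    rw [div_self (by positivity), h1, ← Nat.succ_mul] at this
    rw [add_div]
    refine (norm_sub_le_norm_sub_add_norm_sub _ w _).trans (add_le_add this ?_)
    rwa [norm_sub_rev]
  · intro i hi
    have e := hg (midPt z (2 * N + i)) (γ (i / N))
    rw [hg0 _ (natCast_div_mem_Icc hi.le), sub_zero] at e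
    refine e.trans ?_
    rw [mul_div_assoc, add_div]
    gcongr
    exact (norm_sub_le_norm_sub_add_norm_sub _ (z (2 * N + i)) _).trans
      (add_le_add (h.mid _ (by omega)) (key i hi.le))

lemma back_le (h : OrbitEstimates C N l τ X Y z) {L D : ℝ} (hF : FieldBounds L X Y) (hl : |l| ≤ 1)
    (hD : ‖z (3 * N) - z (2 * N)‖ ≤ D / N) {i : ℕ} (hi : i ≤ N) :
    ‖z (3 * N + i) - z (2 * N - i)‖ ≤ Real.exp L * (D + (C + C)) / N := by
  have hL := hF.nonneg
  have := h.back.dist_le h.out_rev hL (add_nonneg h.nonneg h.nonneg) (fun i _ x y => by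
    rw [neg_sub_neg, ← smul_sub, norm_smul, norm_sub_rev]
    have h1 := hF.out_lip ((N - 1 - i : ℕ) / N) ((N - 1 - i : ℕ) / N) x y
    rw [sub_self, abs_zero, zero_add] at h1
    calc ‖l‖ * _ ≤ 1 * (L * ‖x - y‖) := by
          gcongr
          exact hl
      _ = _ := one_mul _) hi
  refine this.trans ?_
  simp only [add_zero, Nat.sub_zero]
  rw [mul_div_assoc, add_div D]
  gcongr

lemma abs_sum_sub_sum_le (h : OrbitEstimates C N l τ X Y z) {L D : ℝ} {G : ℝ → Esp n → ℝ}
    (hL : 0 ≤ L) (hG : ∀ s y w, |G s y - G s w| ≤ L * ‖y - w‖)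
    (hD : ∀ i ≤ N, ‖z (3 * N + i) - z (2 * N - i)‖ ≤ D / N) (hN : 0 < N) :
    |∑ i ∈ Finset.range N, G (i / N) (midPt z (N + i)) -
      ∑ i ∈ Finset.range N, G ((N - 1 - i : ℕ) / N) (midPt z (3 * N + i))| ≤
      L * (C + D + C) := by
  rw [← Finset.sum_range_reflect (fun i => G (i / N) (midPt z (N + i))), ← Finset.sum_sub_distrib]
  refine (Finset.abs_sum_le_sum_abs _ _).trans ?_
  have hN' : (0 : ℝ) < N := by exact_mod_cast hN
  calc _ ≤ ∑ i ∈ Finset.range N, L * (C + D + C) / N := by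
        refine Finset.sum_le_sum fun i hi => ?_
        have hi' := Finset.mem_range.1 hi
        refine (hG _ _ _).trans ?_
        rw [mul_div_assoc]
        gcongr
        have e : N + (N - 1 - i) + 1 = 2 * N - i := by omega
        have h1 := h.mid_succ (N + (N - 1 - i)) (by omega)
        rw [e] at h1
        have h2 := h.mid (3 * N + i) (by omega)
        have h3 := hD i hi'.le
        rw [norm_sub_rev] at h2 h3
        calc _ = ‖(midPt z (N + (N - 1 - i)) - z (2 * N - i)) + (z (2 * N - i) - z (3 * N + i)) +
              (z (3 * N + i) - midPt z (3 * N + i))‖ := by congr 1; abel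
          _ ≤ C / N + D / N + C / N := norm_add₃_le.trans (by gcongr)
          _ = _ := by ring
    _ = _ := by
      rw [Finset.sum_const, Finset.card_range, nsmul_eq_mul]
      field_simp

end OrbitEstimates

/-- For large `N`, a return orbit has action far from `[-κ, κ]` when `κ < π / 4`, provided the orbits
it follows in the middle close up. -/
theorem ReturnOrbit.eventually_false {L K κ : ℝ} (hL : 0 ≤ L) (hK : 0 ≤ K) (hκ0 : 0 ≤ κ)
    (hκ : κ < Real.pi / 4) :
    ∃ N₀ : ℕ, ∀ N ≥ N₀, ∀ (l τ : ℝ) (X : ℝ → Esp n → Esp n) (Y : Esp n → Esp n)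
      (G : ℝ → Esp n → ℝ) (g : Esp n → ℝ) (z : ℕ → Esp n), ReturnOrbit N l τ X Y z →
      FieldBounds L X Y → (∀ s y, |G s y| ≤ L) → (∀ s y w, |G s y - G s w| ≤ L * ‖y - w‖) →
      (∀ y, |g y| ≤ L) → (∀ y w, |g y - g w| ≤ L * ‖y - w‖) → |l| ≤ 1 →
      |τ / 2 + (l / N * ∑ i ∈ Finset.range N, G (i / N) (midPt z (N + i)) +
        1 / N * ∑ i ∈ Finset.range N, g (midPt z (2 * N + i)) -
        l / N * ∑ i ∈ Finset.range N, G ((N - 1 - i : ℕ) / N) (midPt z (3 * N + i)))| ≤ κ →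
      ((∀ w, HasLoop (K * (1 + ‖w‖)) Y g w) ∨ (l = 1 ∧ ∀ v t, ‖v‖ = 1 → ∃ σ,
        IsFlowCurve K X σ ∧ σ 0 = circlePt v t ∧ HasLoop K Y g (σ 1))) → False := by
  set T : ℝ := 2 * κ + 6 * L with hT
  obtain ⟨C, hC⟩ := ReturnOrbit.exists_estimates (n := n) L T
  obtain ⟨C₁, hC₁⟩ := OrbitEstimates.exists_circlePt (n := n) C T
  set D : ℝ := Real.exp L * (max C₁ 0 + (C + K)) with hD
  set K' : ℝ := K * (1 + C)
  set E₁ : ℝ := max 0 D with hE₁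
  set E₂ : ℝ := max (Real.exp L * (E₁ + (C + K')) + E₁) (Real.exp L * (E₁ + (C + K)) + E₁)
  set E₃ : ℝ := max (L * (C + Real.exp L * (E₁ + (C + K')))) (L * (C + Real.exp L * (E₁ + (C + K))))
  set E₄ : ℝ := Real.exp L * (E₂ + (C + C))
  set E₅ : ℝ := L * (C + E₄ + C) + E₃
  have hδ : 0 < Real.pi / 4 - κ := by linarith
  have hcos : 0 < Real.cos (Real.pi / 4 + κ) :=
    Real.cos_pos_of_mem_Ioo ⟨by linarith [Real.pi_pos], by linarith⟩
  have hev : ∀ᶠ N : ℕ in atTop, 0 < N ∧ 2 * (L + T) ≤ N ∧ C₁ < N ∧ E₅ / N ≤ (Real.pi / 4 - κ) / 2 ∧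
      (E₄ + C₁) / N < Real.cos (Real.pi / 4 + κ) := by
    have ht : ∀ a : ℝ, Tendsto (fun N : ℕ => a / N) atTop (𝓝 0) :=
      fun a => tendsto_const_div_atTop_nhds_zero_nat a
    exact (eventually_gt_atTop 0).and ((tendsto_natCast_atTop_atTop.eventually_ge_atTop _).and
      ((tendsto_natCast_atTop_atTop.eventually_gt_atTop _).and
      (((ht _).eventually_le_const (by linarith)).and ((ht _).eventually_lt_const hcos))))
  obtain ⟨N₀, hN₀⟩ := eventually_atTop.1 hev
  refine ⟨N₀, ?_⟩
  intro N hN l τ X Y G g z h hF hG hGL hg hgL hl hact hloop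
  obtain ⟨hNpos, hNT, hNC, hN5, hN4⟩ := hN₀ N hN
  have hN' : (0 : ℝ) < N := by exact_mod_cast hNpos
  have hsum : ∀ f : ℕ → ℝ, (∀ i, |f i| ≤ L) → |1 / N * ∑ i ∈ Finset.range N, f i| ≤ L := fun f hf => by
    rw [abs_mul, abs_of_nonneg (by positivity : (0 : ℝ) ≤ 1 / N)]
    have : |∑ i ∈ Finset.range N, f i| ≤ N * L := by
      refine (Finset.abs_sum_le_sum_abs _ _).trans ((Finset.sum_le_sum fun i _ => hf i).trans ?_)
      simp
    rw [one_div, inv_mul_le_iff₀ hN']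
    exact this
  have hsum' : ∀ f : ℕ → ℝ, (∀ i, |f i| ≤ L) → |l / N * ∑ i ∈ Finset.range N, f i| ≤ L := fun f hf => by
    have : l / N * ∑ i ∈ Finset.range N, f i = l * (1 / N * ∑ i ∈ Finset.range N, f i) := by ring
    rw [this, abs_mul]
    calc |l| * _ ≤ 1 * L := by
          gcongr
          exact hsum f hf
      _ = L := one_mul L
  have hτ : |τ| ≤ T := by
    have h1 := hsum' (fun i => G (i / N) (midPt z (N + i))) fun i => hG _ _
    have h2 := hsum (fun i => g (midPt z (2 * N + i))) fun i => hg _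
    have h3 := hsum' (fun i => G ((N - 1 - i : ℕ) / N) (midPt z (3 * N + i))) fun i => hG _ _
    rw [abs_le] at h1 h2 h3 hact ⊢
    constructor <;> linarith [h1.1, h1.2, h2.1, h2.2, h3.1, h3.2, hact.1, hact.2]
  have he := hC h hF hNpos hNT hl hτ
  obtain ⟨v, hv, hvz⟩ := hC₁ he h hτ hNC
  have hCnn := he.nonneg
  have hE₁0 : 0 ≤ E₁ := le_max_left _ _
  have hmid : ‖z (3 * N) - z (2 * N)‖ ≤ E₂ / N ∧ ∀ i < N, |g (midPt z (2 * N + i))| ≤ E₃ / N := by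
    rcases hloop with hloop | ⟨rfl, hloop⟩
    · have hK' : K * (1 + ‖z (2 * N)‖) ≤ K' := by
        change _ ≤ K * (1 + C)
        gcongr
        exact he.bound _ (by omega)
      have := he.turn_le (D := E₁) hF (by positivity : 0 ≤ K * (1 + ‖z (2 * N)‖)) hgL
        (by rw [sub_self, norm_zero]; positivity) (hloop (z (2 * N)))
      refine ⟨this.1.trans ?_, fun i hi => (this.2 i hi).trans ?_⟩
      · gcongr
        refine le_trans ?_ (le_max_left _ _)
        gcongr
      · gcongr
        refine le_trans ?_ (le_max_left _ _)
        gcongr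
    · obtain ⟨σ, hσ, hσ0, hσ1⟩ := hloop v τ hv
      have h1 : ‖z (2 * N) - σ 1‖ ≤ E₁ / N := by
        have hout := he.out
        simp only [one_smul] at hout
        have h2 := hσ.dist_le hout hL hCnn hK (fun s y w => by simpa using hF.out_lip s s y w) le_rfl
        rw [div_self hN'.ne', ← two_mul, add_zero, hσ0] at h2
        refine h2.trans ?_
        calc _ ≤ Real.exp L * (max C₁ 0 / N + (C + K) / N) := by
              gcongr
              exact hvz.trans (by gcongr; exact le_max_left _ _)
          _ = D / N := by rw [hD]; ring
          _ ≤ E₁ / N := by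
            gcongr
            exact le_max_right _ _
      have := he.turn_le hF hK hgL h1 hσ1
      refine ⟨this.1.trans ?_, fun i hi => (this.2 i hi).trans ?_⟩
      · gcongr
        exact le_max_right _ _
      · gcongr
        exact le_max_right _ _
  have hback : ∀ i ≤ N, ‖z (3 * N + i) - z (2 * N - i)‖ ≤ E₄ / N := fun i hi =>
    he.back_le hF hl hmid.1 hi
  have hdiff := he.abs_sum_sub_sum_le hL hGL hback hNpos
  have hgs : |∑ i ∈ Finset.range N, g (midPt z (2 * N + i))| ≤ E₃ := by
    refine (Finset.abs_sum_le_sum_abs _ _).trans ((Finset.sum_le_sum fun i hi =>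
      hmid.2 i (Finset.mem_range.1 hi)).trans ?_)
    rw [Finset.sum_const, Finset.card_range, nsmul_eq_mul, mul_div_cancel₀ _ hN'.ne']
  have hτ' : |τ| ≤ Real.pi / 4 + κ := by
    set S₁ := ∑ i ∈ Finset.range N, G (i / N) (midPt z (N + i))
    set S₂ := ∑ i ∈ Finset.range N, g (midPt z (2 * N + i))
    set S₃ := ∑ i ∈ Finset.range N, G ((N - 1 - i : ℕ) / N) (midPt z (3 * N + i))
    have e : τ / 2 = (τ / 2 + (l / N * S₁ + 1 / N * S₂ - l / N * S₃)) - (l * (S₁ - S₃) + S₂) / N := by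
      field_simp; ring
    have e1 : |l * (S₁ - S₃) + S₂| ≤ E₅ := by
      refine (abs_add_le _ _).trans (add_le_add ?_ hgs)
      rw [abs_mul]
      calc |l| * |S₁ - S₃| ≤ 1 * (L * (C + E₄ + C)) := by gcongr
        _ = _ := one_mul _
    have e2 : |(l * (S₁ - S₃) + S₂) / N| ≤ (Real.pi / 4 - κ) / 2 := by
      rw [abs_div, abs_of_pos hN']
      exact (by gcongr : _ ≤ E₅ / N).trans hN5
    have e3 : |τ / 2| ≤ κ + (Real.pi / 4 - κ) / 2 := by
      rw [e]
      exact (abs_sub _ _).trans (add_le_add hact e2)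
    rw [abs_div, abs_two] at e3
    linarith
  have hc1 : Real.cos (Real.pi / 4 + κ) ≤ Real.cos τ := by
    rw [← Real.cos_abs τ]
    exact Real.cos_le_cos_of_nonneg_of_le_pi (abs_nonneg _) (by linarith [Real.pi_pos]) hτ'
  have hc2 : Real.cos τ ≤ (E₄ + C₁) / N := by
    have h1 := hback N le_rfl
    rw [show 3 * N + N = 4 * N by ring, show 2 * N - N = N by omega] at h1
    have h2 : ‖z (4 * N) - circlePt v τ‖ ≤ (E₄ + C₁) / N := by
      rw [add_div]
      exact (norm_sub_le_norm_sub_add_norm_sub _ (z N) _).trans (add_le_add h1 hvz)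
    have h3 := (norm_snd_le (z (4 * N) - circlePt v τ)).trans h2
    rw [Prod.snd_sub, h.stop_snd, zero_sub, norm_neg] at h3
    simp only [circlePt, norm_smul, hv, mul_one, Real.norm_eq_abs] at h3
    exact (le_abs_self _).trans h3
  linarith

end ReturnOrbits

section LoopAction

variable {n : ℕ}

lemma hamVF_const_mul (a : ℝ) (h : Esp n → ℝ) (p : Esp n) :
    hamVF (fun q => a * h q) p = a • hamVF h p := by
  have hf : ∀ (f : EuclideanSpace ℝ (Fin n) → ℝ) y,
      gradient (fun η => a * f η) y = a • gradient f y := fun f y => by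
    have h1 : fderiv ℝ (fun η => a * f η) = a • fderiv ℝ f := fderiv_const_smul_field a
    rw [gradient, gradient, h1, Pi.smul_apply, map_smul]
  simp only [hamVF, hf]
  ext1 <;> simp

lemma hamVF_zero (p : Esp n) : hamVF (fun _ => (0 : ℝ)) p = 0 := by
  simpa using hamVF_const_mul 0 (fun _ => 0) p

/-- The weights of the loop action: the first `N` steps are given longer duration. -/
def loopWeight (N j : ℕ) : ℝ := if j < N then √N else N

/-- The Hamiltonians of the `4 N` steps of the loop action: pause, run `l h` forward in time, run
`g`, run `l h` backward in time. -/
def loopHam (N : ℕ) (l : ℝ) (h : ℝ → Esp n → ℝ) (g : Esp n → ℝ) (j : ℕ) (q : Esp n) : ℝ :=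
  if j < N then 0 else if j < 2 * N then l / N * h ((j - N : ℕ) / N) q else
    if j < 3 * N then 1 / N * g q else -(l / N) * h ((4 * N - 1 - j : ℕ) / N) q

/-- The discrete action of running `l h` forward, then `g`, then `l h` backward. -/
def loopAction (N : ℕ) (l : ℝ) (h : ℝ → Esp n → ℝ) (g : Esp n → ℝ) : DiscPath n (4 * N) → ℝ :=
  discAction (loopWeight N) (loopHam N l h g)

lemma loopWeight_ne_zero {N : ℕ} (hN : 0 < N) (j : ℕ) : loopWeight N j ≠ 0 := by
  unfold loopWeight
  split_ifs <;> positivity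

lemma sq_loopWeight_of_lt {N j : ℕ} (hj : j < N) : loopWeight N j ^ 2 = N := by
  rw [loopWeight, if_pos hj, Real.sq_sqrt (by positivity)]

lemma loopWeight_of_le {N j : ℕ} (hj : N ≤ j) : loopWeight N j = N := by
  rw [loopWeight, if_neg hj.not_gt]

variable {N : ℕ} {l : ℝ} {h : ℝ → Esp n → ℝ} {g : Esp n → ℝ}

lemma loopHam_pause {i : ℕ} (hi : i < N) : loopHam N l h g i = fun _ => 0 := by
  funext q; rw [loopHam, if_pos hi]

lemma loopHam_out {i : ℕ} (hi : i < N) :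
    loopHam N l h g (N + i) = fun q => l / N * h (i / N) q := by
  funext q
  rw [loopHam, if_neg (by omega), if_pos (by omega), Nat.add_sub_cancel_left]

lemma loopHam_turn {i : ℕ} (hi : i < N) :
    loopHam N l h g (2 * N + i) = fun q => 1 / N * g q := by
  funext q
  rw [loopHam, if_neg (by omega), if_neg (by omega), if_pos (by omega)]

lemma loopHam_back {i : ℕ} (hi : i < N) :
    loopHam N l h g (3 * N + i) = fun q => -(l / N) * h ((N - 1 - i : ℕ) / N) q := by
  funext q
  rw [loopHam, if_neg (by omega), if_neg (by omega), if_neg (by omega),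
    show 4 * N - 1 - (3 * N + i) = N - 1 - i by omega]

lemma contDiff_loopHam (hh : ∀ s, ContDiff ℝ 2 (h s)) (hg : ContDiff ℝ 2 g) (j : ℕ) :
    ContDiff ℝ 2 (loopHam N l h g j) := by
  unfold loopHam
  split_ifs
  · exact contDiff_const
  · exact contDiff_const.mul (hh _)
  · exact contDiff_const.mul hg
  · exact contDiff_const.mul (hh _)

lemma contDiff_loopAction (hh : ∀ s, ContDiff ℝ 2 (h s)) (hg : ContDiff ℝ 2 g) :
    ContDiff ℝ 2 (loopAction N l h g) :=
  contDiff_discAction _ fun j _ => contDiff_loopHam hh hg j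

lemma sum_range_four_mul (N : ℕ) (f : ℕ → ℝ) : ∑ j ∈ Finset.range (4 * N), f j =
    ∑ i ∈ Finset.range N, f i + ∑ i ∈ Finset.range N, f (N + i) +
      ∑ i ∈ Finset.range N, f (2 * N + i) + ∑ i ∈ Finset.range N, f (3 * N + i) := by
  rw [show 4 * N = N + N + N + N by ring, Finset.sum_range_add, Finset.sum_range_add,
    Finset.sum_range_add, show N + N + N = 3 * N by ring, show N + N = 2 * N by ring]

/-- Bounds on the Hamiltonians of a loop action, uniform in the scaling of `h`. -/
structure LoopBounds (L : ℝ) (h : ℝ → Esp n → ℝ) (g : Esp n → ℝ) : Prop where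
  contDiff_out : ∀ s, ContDiff ℝ 2 (h s)
  contDiff_turn : ContDiff ℝ 2 g
  field : FieldBounds L (fun s => hamVF (h s)) (hamVF g)
  out_le : ∀ s y, |fderiv ℝ (h s) y y / 2 - h s y| ≤ L
  out_lip : ∀ s y w, |(fderiv ℝ (h s) y y / 2 - h s y) - (fderiv ℝ (h s) w w / 2 - h s w)| ≤
    L * ‖y - w‖
  turn_le : ∀ y, |fderiv ℝ g y y / 2 - g y| ≤ L
  turn_lip : ∀ y w, |(fderiv ℝ g y y / 2 - g y) - (fderiv ℝ g w w / 2 - g w)| ≤ L * ‖y - w‖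

lemma returnOrbit_of_fderiv_loopAction_eq (hN : 0 < N) (hh : ∀ s, ContDiff ℝ 2 (h s))
    (hg : ContDiff ℝ 2 g) {x : DiscPath n (4 * N)} (hx1 : ‖x‖ = 1) {τ : ℝ}
    (hx : ∀ u, fderiv ℝ (loopAction N l h g) x u = τ * ⟪x, u⟫) :
    ReturnOrbit N l τ (fun s => hamVF (h s)) (hamVF g)
      (fun j => (posAt (loopWeight N) j x, momAt (loopWeight N) j x)) := by
  have hstep := fun j hj => step_of_fderiv_discAction_eq (loopWeight_ne_zero hN)
    (fun j _ => (contDiff_loopHam (N := N) (l := l) hh hg j).differentiable (by norm_num)) hx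
    (j := j) hj
  have hw : ∀ j, N ≤ j → τ * (loopWeight N j ^ 2)⁻¹ = τ / (N : ℝ) ^ 2 := fun j hj => by
    rw [loopWeight_of_le hj, div_eq_mul_inv]
  constructor
  · intro i hi
    have e := hstep i (by omega)
    rw [loopHam_pause hi, hamVF_zero, zero_add, sq_loopWeight_of_lt hi, ← div_eq_mul_inv] at e
    exact e
  · intro i hi
    have e := hstep (N + i) (by omega)
    rw [loopHam_out hi, hamVF_const_mul, hw _ (by omega)] at e
    exact e
  · intro i hi
    have e := hstep (2 * N + i) (by omega)
    rw [loopHam_turn hi, hamVF_const_mul, hw _ (by omega), one_div] at e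
    exact e
  · intro i hi
    have e := hstep (3 * N + i) (by omega)
    rw [loopHam_back hi, hamVF_const_mul, hw _ (by omega), neg_smul] at e
    exact e
  · rfl
  · exact momAt_of_le _ le_rfl x
  · have e := sum_weight_mul_sq_midAt (loopWeight_ne_zero hN) x
    rw [hx1, one_pow] at e
    rw [← e, ← Finset.sum_range_add_sum_Ico _ (show N ≤ 4 * N by omega)]
    congr 1
    · refine Finset.sum_congr rfl fun j hj => ?_
      rw [sq_loopWeight_of_lt (Finset.mem_range.1 hj), div_eq_inv_mul]
      rfl
    · refine Finset.sum_congr rfl fun j hj => ?_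
      rw [loopWeight_of_le (Finset.mem_Ico.1 hj).1, div_eq_inv_mul]
      rfl

/-- For large `N` the loop action has no critical points on the unit sphere with level in `[-κ, κ]`,
for `κ < π / 4`, if the orbits it follows close up in the middle. -/
theorem LoopBounds.eventually_no_critical {L K κ : ℝ} (hL : 0 ≤ L) (hK : 0 ≤ K) (hκ0 : 0 ≤ κ)
    (hκ : κ < Real.pi / 4) :
    ∃ N₀ : ℕ, ∀ N ≥ N₀, ∀ (l : ℝ) (h : ℝ → Esp n → ℝ) (g : Esp n → ℝ), LoopBounds L h g → |l| ≤ 1 →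
      ((∀ w, HasLoop (K * (1 + ‖w‖)) (hamVF g) (fun y => fderiv ℝ g y y / 2 - g y) w) ∨
        (l = 1 ∧ ∀ v t, ‖v‖ = 1 → ∃ σ, IsFlowCurve K (fun s => hamVF (h s)) σ ∧ σ 0 = circlePt v t ∧
          HasLoop K (hamVF g) (fun y => fderiv ℝ g y y / 2 - g y) (σ 1))) →
      ∀ x, ‖x‖ = 1 → |loopAction N l h g x| ≤ κ →
        ∀ τ : ℝ, ∃ u, fderiv ℝ (loopAction N l h g) x u ≠ τ * ⟪x, u⟫ := by
  obtain ⟨N₀, hN₀⟩ := ReturnOrbit.eventually_false (n := n) hL hK hκ0 hκ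
  refine ⟨max N₀ 1, fun N hN l h g hb hl hloop x hx hxκ τ => ?_⟩
  have hNpos : 0 < N := (le_max_right N₀ 1).trans hN
  by_contra! hcrit
  refine hN₀ N ((le_max_left _ _).trans hN) l τ (fun s => hamVF (h s)) (hamVF g)
    (fun s y => fderiv ℝ (h s) y y / 2 - h s y) (fun y => fderiv ℝ g y y / 2 - g y) _
    (returnOrbit_of_fderiv_loopAction_eq hNpos hb.contDiff_out hb.contDiff_turn hx hcrit)
    hb.field hb.out_le hb.out_lip hb.turn_le hb.turn_lip hl ?_ hloop
  have e := discAction_eq_of_fderiv_eq (fun j _ =>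
    (contDiff_loopHam (N := N) (l := l) hb.contDiff_out hb.contDiff_turn j).differentiable
      (by norm_num)) hcrit
  rw [hx, one_pow, mul_one] at e
  rw [loopAction, e] at hxκ
  convert hxκ using 3
  have hfd : ∀ (a : ℝ) (f : Esp n → ℝ), ContDiff ℝ 2 f → ∀ y,
      fderiv ℝ (fun q => a * f q) y y / 2 - a * f y = a * (fderiv ℝ f y y / 2 - f y) :=
    fun a f hf y => by
      rw [fderiv_const_mul (hf.differentiable (by norm_num) y)]
      simp only [smul_apply, smul_eq_mul]
      ring
  rw [sum_range_four_mul, Finset.mul_sum, Finset.mul_sum, Finset.mul_sum]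
  have e0 : ∀ i ∈ Finset.range N, fderiv ℝ (loopHam N l h g i) (midAt (loopWeight N) i x)
      (midAt (loopWeight N) i x) / 2 - loopHam N l h g i (midAt (loopWeight N) i x) = 0 :=
    fun i hi => by
      rw [loopHam_pause (Finset.mem_range.1 hi)]; simp
  rw [Finset.sum_eq_zero e0, zero_add, sub_eq_add_neg, ← Finset.sum_neg_distrib]
  refine congrArg₂ _ (congrArg₂ _ ?_ ?_) ?_ <;> refine Finset.sum_congr rfl fun i hi => ?_
  · rw [loopHam_out (Finset.mem_range.1 hi), hfd _ _ (hb.contDiff_out _)]; rfl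
  · rw [loopHam_turn (Finset.mem_range.1 hi), hfd _ _ hb.contDiff_turn]; rfl
  · rw [loopHam_back (Finset.mem_range.1 hi), hfd _ _ (hb.contDiff_out _), neg_mul]; rfl

end LoopAction

section IndexVector

variable {n N : ℕ}

/-- The symplectic part of the loop action. -/
def areaForm (N : ℕ) (x : DiscPath n (4 * N)) : ℝ := ∑ j ∈ Finset.range (4 * N),
  ⟪momAt (loopWeight N) j x, posAt (loopWeight N) (j + 1) x - posAt (loopWeight N) j x⟫

/-- The squared distance from the symplectic coordinate subspace `z_i = 0`. -/
def planeSq (i : Fin n) (y : Esp n) : ℝ := y.1 i ^ 2 + y.2 i ^ 2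

lemma planeSq_nonneg (i : Fin n) (y : Esp n) : 0 ≤ planeSq i y := by unfold planeSq; positivity

lemma inner_smul_single (i : Fin n) (a : ℝ) (y : EuclideanSpace ℝ (Fin n)) :
    ⟪y, a • EuclideanSpace.single i (1 : ℝ)⟫ = a * y i := by
  rw [inner_smul_right, EuclideanSpace.inner_single_right]; simp

/-- Adding a solution of the discrete Hamilton equations of a quadratic Hamiltonian does not change
the action. -/
lemma areaForm_sub_sum_add_smul {i₀ : Fin n} {a P Q : ℕ → ℝ} {u : DiscPath n (4 * N)}
    (hP : ∀ j ≤ 4 * N, momAt (loopWeight N) j u = P j • EuclideanSpace.single i₀ 1)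
    (hQ : ∀ j ≤ 4 * N, posAt (loopWeight N) j u = Q j • EuclideanSpace.single i₀ 1)
    (hPs : ∀ j < 4 * N, P j - P (j + 1) = a j * Q (j + 1))
    (hQs : ∀ j < 4 * N, Q (j + 1) - Q j = a j * P j) (e : DiscPath n (4 * N)) (t : ℝ) :
    areaForm N (e + t • u) - ∑ j ∈ Finset.range (4 * N),
        a j / 2 * planeSq i₀ (midAt (loopWeight N) j (e + t • u)) =
      areaForm N e - ∑ j ∈ Finset.range (4 * N), a j / 2 * planeSq i₀ (midAt (loopWeight N) j e) := by
  set c := loopWeight N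
  have hlin : ∀ x : DiscPath n (4 * N), ∑ j ∈ Finset.range (4 * N),
      ⟪momAt c j u, posAt c (j + 1) x - posAt c j x⟫ =
      ∑ j ∈ Finset.range (4 * N), a j * Q (j + 1) * posAt c (j + 1) x i₀ := fun x => by
    rw [sum_inner_momAt_posAt_sub]
    refine Finset.sum_congr rfl fun j hj => ?_
    have hj' := Finset.mem_range.1 hj
    rw [hP j hj'.le, hP (j + 1) hj', ← sub_smul, hPs j hj', real_inner_comm, inner_smul_single]
  have hlin' : ∀ x : DiscPath n (4 * N), ∑ j ∈ Finset.range (4 * N),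
      ⟪momAt c j x, posAt c (j + 1) u - posAt c j u⟫ =
      ∑ j ∈ Finset.range (4 * N), a j * P j * momAt c j x i₀ := fun x => by
    refine Finset.sum_congr rfl fun j hj => ?_
    have hj' := Finset.mem_range.1 hj
    rw [hQ j hj'.le, hQ (j + 1) hj', ← sub_smul, hQs j hj', inner_smul_single]
  have hu1 : areaForm N u = ∑ j ∈ Finset.range (4 * N), a j * Q (j + 1) ^ 2 := by
    rw [areaForm, hlin]
    refine Finset.sum_congr rfl fun j hj => ?_
    rw [hQ (j + 1) (Finset.mem_range.1 hj)]
    simp; ring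
  have hu2 : areaForm N u = ∑ j ∈ Finset.range (4 * N), a j * P j ^ 2 := by
    rw [areaForm, hlin']
    refine Finset.sum_congr rfl fun j hj => ?_
    rw [hP j (Finset.mem_range.1 hj).le]
    simp; ring
  have hexp : areaForm N (e + t • u) = areaForm N e +
      t * (∑ j ∈ Finset.range (4 * N), a j * P j * momAt c j e i₀ +
        ∑ j ∈ Finset.range (4 * N), a j * Q (j + 1) * posAt c (j + 1) e i₀) +
      t ^ 2 * ((∑ j ∈ Finset.range (4 * N), a j * Q (j + 1) ^ 2 +
        ∑ j ∈ Finset.range (4 * N), a j * P j ^ 2) / 2) := by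
    rw [← hlin, ← hlin', ← hu1, ← hu2, add_self_div_two]
    simp only [areaForm, Finset.mul_sum, ← Finset.sum_add_distrib]
    refine Finset.sum_congr rfl fun j _ => ?_
    simp only [map_add, map_smul, inner_add_left, inner_add_right, inner_sub_right, inner_smul_left,
      inner_smul_right, conj_trivial]
    ring
  rw [hexp]
  simp only [Finset.mul_sum, ← Finset.sum_add_distrib, Finset.sum_div, add_sub_assoc,
    ← Finset.sum_sub_distrib]
  rw [sub_eq_add_neg, ← Finset.sum_neg_distrib, add_assoc, ← Finset.sum_add_distrib]
  congr 1
  refine Finset.sum_congr rfl fun j hj => ?_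
  have hj' := Finset.mem_range.1 hj
  simp only [planeSq, midAt_fst, midAt_snd]
  simp only [map_add, map_smul, PiLp.add_apply, PiLp.smul_apply,
    hP j hj'.le, hQ (j + 1) hj', smul_eq_mul, PiLp.single_apply, if_true]
  ring

/-- A discrete path on which the symplectic area is positive, and which can be added to any path
without raising its action beyond its area. -/
lemma exists_index_vector (i₀ : Fin n) (hN : 0 < N) : ∃ u : DiscPath n (4 * N),
    0 < areaForm N u ∧ ∀ (e : DiscPath n (4 * N)) (t : ℝ),
      areaForm N (e + t • u) - 1 / N * ∑ i ∈ Finset.range N,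
      Real.pi * planeSq i₀ (midAt (loopWeight N) (2 * N + i) (e + t • u)) ≤ areaForm N e := by
  have hN' : (0 : ℝ) < N := by exact_mod_cast hN
  set φ : ℝ := Real.pi / (2 * N + 1) with hφ
  have hφ0 : 0 < φ := by positivity
  set s : ℕ → ℕ := fun j => min (j - 2 * N) N with hs
  set P : ℕ → ℝ := fun j => Real.cos ((s j + 1 / 2) * φ) with hP
  set Q : ℕ → ℝ := fun j => Real.sin (s j * φ) with hQ
  set a₀ : ℝ := 2 * Real.sin (φ / 2) with ha₀
  set a : ℕ → ℝ := fun j => if 2 * N ≤ j ∧ j < 3 * N then a₀ else 0 with ha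
  set e₁ : EuclideanSpace ℝ (Fin n) := EuclideanSpace.single i₀ 1 with he₁
  set c := loopWeight N with hc
  have hc0 := loopWeight_ne_zero hN
  have hφpi : φ ≤ Real.pi / 3 := by
    rw [hφ]
    have : (1 : ℝ) ≤ N := by exact_mod_cast hN
    gcongr
    linarith
  have ha₀pos : 0 < a₀ := mul_pos two_pos (Real.sin_pos_of_pos_of_lt_pi (by positivity)
    (by linarith [Real.pi_pos]))
  have ha₀le : a₀ / 2 ≤ Real.pi / N := by
    have h1 : Real.sin (φ / 2) ≤ φ / 2 := Real.sin_le (by positivity)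
    have h2 : φ / 2 ≤ Real.pi / N := by
      rw [hφ, div_div]
      gcongr
      linarith
    rw [ha₀]
    linarith
  set u : DiscPath n (4 * N) := ofEntries (4 * N) fun j =>
    ((c j)⁻¹ • Q (j + 1) • e₁, (c j)⁻¹ • P j • e₁) with hu
  have hs_in : ∀ j, 2 * N ≤ j → j < 3 * N → s (j + 1) = s j + 1 := fun j h1 h2 => by
    simp only [hs]; omega
  have hs_out : ∀ j, ¬(2 * N ≤ j ∧ j < 3 * N) → s (j + 1) = s j := fun j h => by
    simp only [hs]; omega
  have hPu : ∀ j ≤ 4 * N, momAt c j u = P j • e₁ := fun j hj => by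
    rcases hj.lt_or_eq with hj | rfl
    · rw [momAt_apply, hu, entry_ofEntries hj]
      exact smul_inv_smul₀ (hc0 j) _
    · rw [momAt_of_le c le_rfl, hP]
      have : ((s (4 * N) : ℝ) + 1 / 2) * φ = Real.pi / 2 := by
        have : s (4 * N) = N := by simp only [hs]; omega
        rw [this, hφ]; field_simp
      simp only [this, Real.cos_pi_div_two, zero_smul]
  have hQu : ∀ j ≤ 4 * N, posAt c j u = Q j • e₁ := fun j hj => by
    rcases j with _ | j
    · simp [hQ, hs]
    · rw [posAt_succ, hu, entry_ofEntries hj]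
      exact smul_inv_smul₀ (hc0 j) _
  have hPs : ∀ j < 4 * N, P j - P (j + 1) = a j * Q (j + 1) := fun j _ => by
    by_cases h : 2 * N ≤ j ∧ j < 3 * N
    · simp only [hP, hQ, ha, if_pos h, hs_in j h.1 h.2, ha₀]
      push_cast
      rw [Real.cos_sub_cos]
      rw [show (((s j : ℝ) + 1 / 2) * φ + (s j + 1 + 1 / 2) * φ) / 2 = (s j + 1) * φ by ring,
        show (((s j : ℝ) + 1 / 2) * φ - (s j + 1 + 1 / 2) * φ) / 2 = -(φ / 2) by ring, Real.sin_neg]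
      ring
    · simp only [hP, ha, if_neg h, hs_out j h]
      ring
  have hQs : ∀ j < 4 * N, Q (j + 1) - Q j = a j * P j := fun j _ => by
    by_cases h : 2 * N ≤ j ∧ j < 3 * N
    · simp only [hP, hQ, ha, if_pos h, hs_in j h.1 h.2, ha₀]
      push_cast
      rw [Real.sin_sub_sin]
      rw [show (((s j : ℝ) + 1) * φ - s j * φ) / 2 = φ / 2 by ring,
        show (((s j : ℝ) + 1) * φ + s j * φ) / 2 = (s j + 1 / 2) * φ by ring]
    · simp only [hQ, ha, if_neg h, hs_out j h]
      ring
  have hsum : ∀ f : ℕ → ℝ, ∑ j ∈ Finset.range (4 * N), a j * f j =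
      a₀ * ∑ i ∈ Finset.range N, f (2 * N + i) := fun f => by
    rw [sum_range_four_mul, Finset.sum_eq_zero, Finset.sum_eq_zero,
      Finset.sum_eq_zero (f := fun i => a (3 * N + i) * f (3 * N + i)), zero_add, zero_add, add_zero,
      Finset.mul_sum]
    · refine Finset.sum_congr rfl fun i hi => ?_
      have := Finset.mem_range.1 hi
      simp only [ha, if_pos (show 2 * N ≤ 2 * N + i ∧ 2 * N + i < 3 * N by omega)]
    all_goals
      intro i hi
      have := Finset.mem_range.1 hi
      simp only [ha]
      rw [if_neg (by omega), zero_mul]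
  refine ⟨u, ?_, fun e t => ?_⟩
  · have h1 : areaForm N u = a₀ * ∑ i ∈ Finset.range N, P (2 * N + i) ^ 2 := by
      rw [← hsum fun j => P j ^ 2, areaForm]
      refine Finset.sum_congr rfl fun j hj => ?_
      have hj' := Finset.mem_range.1 hj
      rw [hPu j hj'.le, hQu j hj'.le, hQu (j + 1) hj', ← sub_smul, hQs j hj', inner_smul_single]
      simp [he₁]; ring
    rw [h1]
    refine mul_pos ha₀pos (lt_of_lt_of_le ?_ (Finset.single_le_sum (fun i _ => sq_nonneg _)
      (Finset.mem_range.2 hN)))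
    have : s (2 * N + 0) = 0 := by simp [hs]
    simp only [hP, this]
    refine pow_pos (Real.cos_pos_of_mem_Ioo ⟨?_, ?_⟩) 2
    · push_cast; nlinarith [Real.pi_pos]
    · push_cast; nlinarith [Real.pi_pos]
  · have h := areaForm_sub_sum_add_smul hPu hQu hPs hQs e t
    have h2 : ∀ x : DiscPath n (4 * N), ∑ j ∈ Finset.range (4 * N),
        a j / 2 * planeSq i₀ (midAt c j x) = a₀ / 2 * ∑ i ∈ Finset.range N,
          planeSq i₀ (midAt c (2 * N + i) x) := fun x => by
      have := hsum fun j => planeSq i₀ (midAt c j x) / 2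
      rw [← Finset.sum_div] at this
      calc _ = _ := Finset.sum_congr rfl fun j _ => by ring
        _ = _ := this
        _ = _ := by ring
    rw [h2, h2] at h
    have h3 : ∀ x : DiscPath n (4 * N), 0 ≤ ∑ i ∈ Finset.range N,
          planeSq i₀ (midAt c (2 * N + i) x) := fun x =>
      Finset.sum_nonneg fun i _ => planeSq_nonneg _ _
    rw [← Finset.mul_sum, ← mul_assoc, one_div_mul_eq_div]
    nlinarith [mul_le_mul_of_nonneg_right ha₀le (h3 (e + t • u)), mul_nonneg ha₀pos.le (h3 e)]

end IndexVector

section QuadraticForms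

variable {U : Type*} [NormedAddCommGroup U] [InnerProductSpace ℝ U]

/-- `F` is the quadratic form of a symmetric operator. -/
def IsQuadForm (F : U → ℝ) : Prop := ∃ Q : U →ₗ[ℝ] U, Q.IsSymmetric ∧ ∀ x, F x = ⟪Q x, x⟫

lemma IsQuadForm.sum {ι : Type*} {s : Finset ι} {F : ι → U → ℝ} (hF : ∀ i ∈ s, IsQuadForm (F i)) :
    IsQuadForm (fun x => ∑ i ∈ s, F i x) := by
  choose! Q hQ hFQ using hF
  refine ⟨∑ i ∈ s, Q i, LinearMap.isSymmetric_sum s hQ, fun x => ?_⟩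
  rw [LinearMap.sum_apply, sum_inner]
  exact Finset.sum_congr rfl fun i hi => hFQ i hi x

lemma IsQuadForm.sub {F G : U → ℝ} (hF : IsQuadForm F) (hG : IsQuadForm G) :
    IsQuadForm (fun x => F x - G x) := by
  obtain ⟨Q, hQ, hFQ⟩ := hF
  obtain ⟨R, hR, hGR⟩ := hG
  exact ⟨Q - R, hQ.sub hR, fun x => by simp only [LinearMap.sub_apply, inner_sub_left, hFQ, hGR]⟩

lemma IsQuadForm.const_mul {F : U → ℝ} (hF : IsQuadForm F) (a : ℝ) :
    IsQuadForm (fun x => a * F x) := by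
  obtain ⟨Q, hQ, hFQ⟩ := hF
  exact ⟨a • Q, hQ.smul rfl, fun x => by
    simp only [LinearMap.smul_apply, inner_smul_left, hFQ, conj_trivial]⟩

lemma isQuadForm_inner [FiniteDimensional ℝ U] {V : Type*} [NormedAddCommGroup V] [InnerProductSpace ℝ V]
    [FiniteDimensional ℝ V] (A B : U →ₗ[ℝ] V) : IsQuadForm (fun x => ⟪A x, B x⟫) := by
  refine ⟨(1 / 2 : ℝ) • (A.adjoint ∘ₗ B + B.adjoint ∘ₗ A), fun x y => ?_, fun x => ?_⟩
  · simp only [LinearMap.smul_apply, LinearMap.add_apply, LinearMap.comp_apply, inner_smul_left,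
      inner_smul_right, inner_add_left, inner_add_right, LinearMap.adjoint_inner_left,
      LinearMap.adjoint_inner_right, conj_trivial]
    ring
  · simp only [LinearMap.smul_apply, LinearMap.add_apply, LinearMap.comp_apply, inner_smul_left,
      inner_add_left, LinearMap.adjoint_inner_left, conj_trivial]
    rw [real_inner_comm (A x) (B x)]
    ring

/-- `F` has no critical point on the unit sphere with level in `[-κ, κ]`. -/
def NoCriticalLevel (κ : ℝ) (F : U → ℝ) : Prop :=
  ∀ x, ‖x‖ = 1 → |F x| ≤ κ → ∀ τ : ℝ, ∃ u, fderiv ℝ F x u ≠ τ * ⟪x, u⟫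

lemma NoCriticalLevel.apply_ne_smul [FiniteDimensional ℝ U] {κ κ' : ℝ}
    {Q : U →ₗ[ℝ] U} (hQ : Q.IsSymmetric) (hκ : κ ≤ κ')
    (h : NoCriticalLevel κ' (fun x => ⟪Q x, x⟫)) (x : U) (hx : ‖x‖ = 1) (hxκ : |⟪Q x, x⟫| ≤ κ)
    (τ : ℝ) : Q x ≠ τ • x := fun hτ => by
  obtain ⟨u, hu⟩ := h x hx (hxκ.trans hκ) (2 * τ)
  apply hu
  have h1 : HasFDerivAt (fun x => ⟪Q x, x⟫) ((fderivInnerCLM ℝ (Q x, x)).comp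
      ((LinearMap.toContinuousLinearMap Q).prod (ContinuousLinearMap.id ℝ U))) x :=
    (LinearMap.toContinuousLinearMap Q).hasFDerivAt.inner ℝ (hasFDerivAt_id x)
  rw [h1.fderiv]
  simp only [ContinuousLinearMap.comp_apply, ContinuousLinearMap.prod_apply, fderivInnerCLM_apply,
    LinearMap.coe_toContinuousLinearMap', ContinuousLinearMap.id_apply]
  rw [hQ u x, hτ, inner_smul_left, inner_smul_right, real_inner_comm x u, conj_trivial]
  ring

end QuadraticForms

section LoopFamilies

variable {n N : ℕ} {l : ℝ} {h : ℝ → Esp n → ℝ} {g : Esp n → ℝ}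

/-- The contribution of `h` to the loop action. -/
def outSum (N : ℕ) (h : ℝ → Esp n → ℝ) (x : DiscPath n (4 * N)) : ℝ :=
  1 / N * ∑ i ∈ Finset.range N, (h (i / N) (midAt (loopWeight N) (N + i) x) -
    h ((N - 1 - i : ℕ) / N) (midAt (loopWeight N) (3 * N + i) x))

/-- The contribution of `g` to the loop action. -/
def turnSum (N : ℕ) (g : Esp n → ℝ) (x : DiscPath n (4 * N)) : ℝ :=
  1 / N * ∑ i ∈ Finset.range N, g (midAt (loopWeight N) (2 * N + i) x)

lemma loopAction_eq (x : DiscPath n (4 * N)) :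
    loopAction N l h g x = areaForm N x - l * outSum N h x - turnSum N g x := by
  rw [loopAction, discAction, Finset.sum_sub_distrib, ← areaForm, sub_sub]
  congr 1
  rw [sum_range_four_mul, outSum, turnSum, Finset.sum_eq_zero, zero_add, ← mul_assoc,
    mul_one_div, Finset.mul_sum, Finset.mul_sum, add_right_comm, ← Finset.sum_add_distrib]
  · congr 1 <;> refine Finset.sum_congr rfl fun i hi => ?_
    · rw [loopHam_out (Finset.mem_range.1 hi), loopHam_back (Finset.mem_range.1 hi)]
      ring
    · rw [loopHam_turn (Finset.mem_range.1 hi)]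
  · intro i hi
    rw [loopHam_pause (Finset.mem_range.1 hi)]

lemma isQuadForm_areaForm : IsQuadForm (areaForm N : DiscPath n (4 * N) → ℝ) :=
  IsQuadForm.sum fun j _ => isQuadForm_inner (momAt (loopWeight N) j).toLinearMap
    (posAt (loopWeight N) (j + 1) - posAt (loopWeight N) j).toLinearMap

lemma isQuadForm_turnSum_planeSq (i : Fin n) (a : ℝ) :
    IsQuadForm (turnSum N (fun y => a * planeSq i y)) := by
  refine (IsQuadForm.sum fun j _ => IsQuadForm.const_mul ?_ _).const_mul _
  have h := isQuadForm_inner (U := DiscPath n (4 * N))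
    ((EuclideanSpace.proj i : EuclideanSpace ℝ (Fin n) →L[ℝ] ℝ).comp
      (posAt (loopWeight N) (2 * N + j + 1))).toLinearMap
    ((EuclideanSpace.proj i : EuclideanSpace ℝ (Fin n) →L[ℝ] ℝ).comp
      (posAt (loopWeight N) (2 * N + j + 1))).toLinearMap
  have h' := isQuadForm_inner (U := DiscPath n (4 * N))
    ((EuclideanSpace.proj i : EuclideanSpace ℝ (Fin n) →L[ℝ] ℝ).comp
      (momAt (loopWeight N) (2 * N + j))).toLinearMap
    ((EuclideanSpace.proj i : EuclideanSpace ℝ (Fin n) →L[ℝ] ℝ).comp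
      (momAt (loopWeight N) (2 * N + j))).toLinearMap
  have e := h.sub (h'.const_mul (-1))
  convert e using 2 with x
  simp [planeSq]

lemma turnSum_const_mul (a : ℝ) (x : DiscPath n (4 * N)) :
    turnSum N (fun y => a * g y) x = a * turnSum N g x := by
  simp only [turnSum, Finset.mul_sum]
  exact Finset.sum_congr rfl fun _ _ => by ring

lemma turnSum_le {g' : Esp n → ℝ} (hN : 0 < N) {a : ℝ} (hg : ∀ y, g y ≤ g' y + a)
    (x : DiscPath n (4 * N)) : turnSum N g x ≤ turnSum N g' x + a := by
  have hN' : (0 : ℝ) < N := by exact_mod_cast hN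
  have e : a = 1 / N * ∑ i ∈ Finset.range N, a := by
    rw [Finset.sum_const, Finset.card_range, nsmul_eq_mul]
    field_simp
  rw [turnSum, turnSum, e, ← mul_add, ← Finset.sum_add_distrib]
  gcongr
  exact hg _

lemma contDiff_outSum (hh : ∀ s, ContDiff ℝ 2 (h s)) : ContDiff ℝ 2 (outSum N h) :=
  contDiff_const.mul (ContDiff.sum fun _ _ => ((hh _).comp (midAt _ _).contDiff).sub
    ((hh _).comp (midAt _ _).contDiff))

lemma contDiff_turnSum (hg : ContDiff ℝ 2 g) : ContDiff ℝ 2 (turnSum N g) :=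
  contDiff_const.mul (ContDiff.sum fun _ _ => hg.comp (midAt _ _).contDiff)

lemma exists_abs_le_of_norm_eq_one {U : Type*} [NormedAddCommGroup U] [NormedSpace ℝ U]
    [FiniteDimensional ℝ U] {f : U → ℝ} (hf : Continuous f) : ∃ C, ∀ x, ‖x‖ = 1 → |f x| ≤ C := by
  have : ProperSpace U := FiniteDimensional.proper ℝ U
  obtain ⟨C, hC⟩ := (isCompact_sphere (0 : U) 1).exists_bound_of_continuousOn hf.continuousOn
  exact ⟨C, fun x hx => hC x (by simpa using hx)⟩

/-- Three families of loop actions without critical points at low levels cannot coexist: two of them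
join a quadratic form to an action that is sandwiched between levels of the third. -/
theorem false_of_noCriticalLevel_loopAction {f : Esp n → ℝ} {κ κ' : ℝ} (i₀ : Fin n) (hN : 0 < N)
    (hκ : 0 < κ) (hκκ : κ < κ') (hh : ∀ s, ContDiff ℝ 2 (h s)) (hf : ContDiff ℝ 2 f)
    (hf_le : ∀ y, f y ≤ Real.pi * planeSq i₀ y) (hf_ge : ∀ y, Real.pi * planeSq i₀ y ≤ f y + 2 * κ)
    (h_out : ∀ l ∈ Icc (0 : ℝ) 1, NoCriticalLevel κ' (loopAction N l h fun _ => 0))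
    (h_turn : ∀ l ∈ Icc (0 : ℝ) 1, NoCriticalLevel κ' (loopAction N 1 h fun y => l * f y))
    (h_plane : ∀ l ∈ Icc (0 : ℝ) 1,
      NoCriticalLevel κ' (loopAction N l h fun y => Real.pi * planeSq i₀ y)) : False := by
  set g : Esp n → ℝ := fun y => Real.pi * planeSq i₀ y with hg_def
  have hg : ContDiff ℝ 2 g := by
    have e : ∀ i : Fin n, ContDiff ℝ 2 fun y : EuclideanSpace ℝ (Fin n) => y i := fun i =>
      (EuclideanSpace.proj i : EuclideanSpace ℝ (Fin n) →L[ℝ] ℝ).contDiff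
    exact contDiff_const.mul ((((e i₀).comp contDiff_fst).pow 2).add
      (((e i₀).comp contDiff_snd).pow 2))
  have hzero : ∀ x : DiscPath n (4 * N), turnSum N (fun _ => 0) x = 0 := fun x => by simp [turnSum]
  obtain ⟨Q, hQ, hQe⟩ := isQuadForm_areaForm (n := n) (N := N)
  obtain ⟨B, hB, hBe⟩ := isQuadForm_areaForm.sub (isQuadForm_turnSum_planeSq (N := N) i₀ Real.pi)
  have hQf : (loopAction N 0 h fun _ => 0) = fun x => ⟪Q x, x⟫ := by
    funext x; rw [loopAction_eq, ← hQe, hzero]; ring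
  have hBf : loopAction N 0 h g = fun x => ⟪B x, x⟫ := by
    funext x; rw [loopAction_eq, ← hBe]; ring
  obtain ⟨u, hu0, hu⟩ := exists_index_vector i₀ hN
  have hQcrit := h_out 0 ⟨le_rfl, zero_le_one⟩
  have hBcrit := h_plane 0 ⟨le_rfl, zero_le_one⟩
  rw [hQf] at hQcrit
  rw [hBf] at hBcrit
  obtain ⟨C₁, hC₁⟩ := exists_abs_le_of_norm_eq_one (contDiff_outSum (N := N) hh).continuous
  obtain ⟨C₂, hC₂⟩ := exists_abs_le_of_norm_eq_one (contDiff_turnSum (N := N) hf).continuous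
  have hκabs : |κ| ≤ κ := (abs_of_pos hκ).le
  refine not_sphereInessential_transfer hQ hB hκ (hQcrit.apply_ne_smul hQ hκκ.le)
    (hBcrit.apply_ne_smul hB hκκ.le) (u := u) (fun e t => ?_) (by rwa [← hQe]) fun V hV => ?_
  · rw [← hQe, ← hBe]
    exact hu e t
  rw [← hQf] at hV
  have h1 : SphereInessential V (sphereSublevel (loopAction N 1 h fun _ => 0) κ)
      (sphereSublevel (loopAction N 1 h fun _ => 0) κ) :=
    SphereInessential.of_path (F := fun l => loopAction N l h fun _ => 0) (C := C₁)
      (fun l _ => contDiff_loopAction hh contDiff_const) (fun l _ m _ x hx => by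
        rw [loopAction_eq, loopAction_eq, show areaForm N x - l * outSum N h x -
          turnSum N (fun _ => 0) x - (areaForm N x - m * outSum N h x - turnSum N (fun _ => 0) x) =
          -(outSum N h x * (l - m)) by ring, abs_neg, abs_mul]
        gcongr
        exact hC₁ x hx) h_out hκκ hκabs hκabs le_rfl hV
  have h2 : SphereInessential V (sphereSublevel (loopAction N 1 h f) κ)
      (sphereSublevel (loopAction N 1 h f) κ) := by
    have := SphereInessential.of_path (F := fun l => loopAction N 1 h fun y => l * f y) (C := C₂)
      (fun l _ => contDiff_loopAction hh (contDiff_const.mul hf)) (fun l _ m _ x hx => by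
        rw [loopAction_eq, loopAction_eq, turnSum_const_mul, turnSum_const_mul,
          show areaForm N x - 1 * outSum N h x - l * turnSum N f x -
          (areaForm N x - 1 * outSum N h x - m * turnSum N f x) =
          -(turnSum N f x * (l - m)) by ring, abs_neg, abs_mul]
        gcongr
        exact hC₂ x hx) h_turn hκκ hκabs hκabs le_rfl (W := V) (by simpa only [zero_mul] using h1)
    simpa only [one_mul] using this
  have h3 : SphereInessential V (sphereSublevel (loopAction N 1 h g) (-κ))
      (sphereSublevel (loopAction N 1 h g) κ) := by
    refine h2.mono (fun x hx => ⟨hx.1, ?_⟩) (fun x hx => ⟨hx.1, le_trans ?_ hx.2⟩)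
    · have := hx.2
      rw [loopAction_eq] at this ⊢
      linarith [turnSum_le hN hf_ge x]
    · rw [loopAction_eq, loopAction_eq]
      have := turnSum_le hN (g' := g) (a := 0) (fun y => (hf_le y).trans_eq (add_zero _).symm) x
      linarith
  have h4 := SphereInessential.of_path (F := fun l => loopAction N (1 - l) h g) (C := C₁) (W := V)
    (κ := κ) (κ' := κ') (c := -κ) (c' := κ)
    (fun l _ => contDiff_loopAction hh hg) (fun l _ m _ x hx => by
      rw [loopAction_eq, loopAction_eq, show areaForm N x - (1 - l) * outSum N h x -
        turnSum N g x - (areaForm N x - (1 - m) * outSum N h x - turnSum N g x) =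
        outSum N h x * (l - m) by ring, abs_mul]
      gcongr
      exact hC₁ x hx) (fun l hl => h_plane (1 - l) ⟨by linarith [hl.2], by linarith [hl.1]⟩) hκκ
      (by rw [abs_neg]; exact hκabs) hκabs (by linarith) (by simpa only [sub_zero] using h3)
  simpa only [sub_self, hBf] using h4

end LoopFamilies

section HamiltonianBounds

variable {n : ℕ}

/-- The symplectic gradient of a covector: `hamVF h p` is the symplectic gradient of the derivative
of `h` at `p`. -/
def symplGrad : (Esp n →L[ℝ] ℝ) →L[ℝ] Esp n :=
  LinearMap.toContinuousLinearMap
    { toFun := fun φ => ((InnerProductSpace.toDual ℝ _).symm (φ.comp (.inr ℝ _ _)),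
        -(InnerProductSpace.toDual ℝ _).symm (φ.comp (.inl ℝ _ _)))
      map_add' := fun φ ψ => by ext1 <;> simp [ContinuousLinearMap.add_comp, add_comm]
      map_smul' := fun a φ => by ext1 <;> simp [ContinuousLinearMap.smul_comp] }

lemma hamVF_eq_symplGrad {h : Esp n → ℝ} {p : Esp n} (hh : DifferentiableAt ℝ h p) :
    hamVF h p = symplGrad (fderiv ℝ h p) := by
  have h1 : HasFDerivAt (fun η => h (p.1, η)) ((fderiv ℝ h p).comp (.inr ℝ _ _)) p.2 :=
    HasFDerivAt.comp (g := h) p.2 hh.hasFDerivAt (hasFDerivAt_prodMk_right p.1 p.2)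
  have h2 : HasFDerivAt (fun y => h (y, p.2)) ((fderiv ℝ h p).comp (.inl ℝ _ _)) p.1 :=
    HasFDerivAt.comp (g := h) p.1 hh.hasFDerivAt (hasFDerivAt_prodMk_left p.1 p.2)
  rw [hamVF, gradient, gradient, h1.fderiv, h2.fderiv]
  rfl

lemma hamVF_add {g g' : Esp n → ℝ} {p : Esp n} (hg : DifferentiableAt ℝ g p)
    (hg' : DifferentiableAt ℝ g' p) :
    hamVF (fun y => g y + g' y) p = hamVF g p + hamVF g' p := by
  rw [hamVF_eq_symplGrad (hg.fun_add hg'), hamVF_eq_symplGrad hg, hamVF_eq_symplGrad hg',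
    fderiv_fun_add hg hg', map_add]

/-- Bounds on a time-dependent Hamiltonian. -/
structure OutBounds (L : ℝ) (h : ℝ → Esp n → ℝ) : Prop where
  contDiff : ∀ s, ContDiff ℝ 2 (h s)
  field_lip : ∀ s t y w, ‖hamVF (h s) y - hamVF (h t) w‖ ≤ L * (|s - t| + ‖y - w‖)
  field_le : ∀ s y, ‖hamVF (h s) y‖ ≤ L
  action_le : ∀ s y, |fderiv ℝ (h s) y y / 2 - h s y| ≤ L
  action_lip : ∀ s y w, |(fderiv ℝ (h s) y y / 2 - h s y) - (fderiv ℝ (h s) w w / 2 - h s w)| ≤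
    L * ‖y - w‖

/-- Bounds on an autonomous Hamiltonian. -/
structure TurnBounds (L : ℝ) (g : Esp n → ℝ) : Prop where
  nonneg : 0 ≤ L
  contDiff : ContDiff ℝ 2 g
  field_lip : ∀ y w, ‖hamVF g y - hamVF g w‖ ≤ L * ‖y - w‖
  field_le : ∀ y, ‖hamVF g y‖ ≤ L * (1 + ‖y‖)
  action_le : ∀ y, |fderiv ℝ g y y / 2 - g y| ≤ L
  action_lip : ∀ y w, |(fderiv ℝ g y y / 2 - g y) - (fderiv ℝ g w w / 2 - g w)| ≤ L * ‖y - w‖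

lemma OutBounds.loopBounds {L L' : ℝ} {h : ℝ → Esp n → ℝ} {g : Esp n → ℝ} (hL : 0 ≤ L)
    (hh : OutBounds L h) (hg : TurnBounds L' g) : LoopBounds (L + L') h g := by
  have hL' := hg.nonneg
  refine ⟨hh.contDiff, hg.contDiff, ⟨by positivity, fun s t y w => (hh.field_lip s t y w).trans ?_,
    fun s y => (hh.field_le s y).trans ?_, fun y w => (hg.field_lip y w).trans ?_,
    fun y => (hg.field_le y).trans ?_⟩, fun s y => (hh.action_le s y).trans ?_,
    fun s y w => (hh.action_lip s y w).trans ?_, fun y => (hg.action_le y).trans ?_,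
    fun y w => (hg.action_lip y w).trans ?_⟩
  · gcongr; linarith
  · nlinarith [mul_nonneg (add_nonneg hL hL') (norm_nonneg y)]
  · gcongr; linarith
  · gcongr; linarith
  · linarith
  · gcongr; linarith
  · linarith
  · gcongr; linarith

lemma TurnBounds.add {L L' : ℝ} {g g' : Esp n → ℝ} (hg : TurnBounds L g) (hg' : TurnBounds L' g') :
    TurnBounds (L + L') fun y => g y + g' y := by
  have hd := fun y => hg.contDiff.differentiable (by norm_num) y
  have hd' := fun y => hg'.contDiff.differentiable (by norm_num) y
  have e : ∀ y, fderiv ℝ (fun y => g y + g' y) y y / 2 - (g y + g' y) =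
      (fderiv ℝ g y y / 2 - g y) + (fderiv ℝ g' y y / 2 - g' y) := fun y => by
    rw [fderiv_fun_add (hd y) (hd' y), add_apply]
    ring
  refine ⟨add_nonneg hg.nonneg hg'.nonneg, hg.contDiff.add hg'.contDiff, fun y w => ?_,
    fun y => ?_, fun y => ?_, fun y w => ?_⟩
  · rw [hamVF_add (hd y) (hd' y), hamVF_add (hd w) (hd' w), add_sub_add_comm, add_mul]
    exact norm_add_le_of_le (hg.field_lip y w) (hg'.field_lip y w)
  · rw [hamVF_add (hd y) (hd' y), add_mul]
    exact norm_add_le_of_le (hg.field_le y) (hg'.field_le y)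
  · rw [e]
    exact (abs_add_le _ _).trans (add_le_add (hg.action_le y) (hg'.action_le y))
  · rw [e, e, add_sub_add_comm, add_mul]
    exact (abs_add_le _ _).trans (add_le_add (hg.action_lip y w) (hg'.action_lip y w))

lemma TurnBounds.const_mul {L l : ℝ} {g : Esp n → ℝ} (hg : TurnBounds L g) (hl : |l| ≤ 1) :
    TurnBounds L fun y => l * g y := by
  have hd := fun y => hg.contDiff.differentiable (by norm_num) y
  have e : ∀ y, fderiv ℝ (fun y => l * g y) y y / 2 - l * g y =
      l * (fderiv ℝ g y y / 2 - g y) := fun y => by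
    rw [fderiv_const_mul (hd y), smul_apply, smul_eq_mul]
    ring
  have hmul : ∀ {a B : ℝ}, 0 ≤ a → a ≤ B → |l| * a ≤ B := fun ha hab =>
    (mul_le_of_le_one_left ha hl).trans hab
  refine ⟨hg.nonneg, contDiff_const.mul hg.contDiff, fun y w => ?_,
    fun y => ?_, fun y => ?_, fun y w => ?_⟩
  · rw [hamVF_const_mul, hamVF_const_mul, ← smul_sub, norm_smul]
    exact hmul (norm_nonneg _) (hg.field_lip y w)
  · rw [hamVF_const_mul, norm_smul]
    exact hmul (norm_nonneg _) (hg.field_le y)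
  · rw [e, abs_mul]
    exact hmul (abs_nonneg _) (hg.action_le y)
  · rw [e, e, ← mul_sub, abs_mul]
    exact hmul (abs_nonneg _) (hg.action_lip y w)

lemma TurnBounds.const (a : ℝ) : TurnBounds |a| fun _ : Esp n => a := by
  have e : ∀ y, hamVF (fun _ : Esp n => a) y = 0 := fun y => by
    simpa using hamVF_const_mul a (fun _ => 1) y |>.trans (by
      rw [hamVF_eq_symplGrad (differentiableAt_const _), fderiv_fun_const]; simp)
  refine ⟨abs_nonneg a, contDiff_const, fun y w => ?_, fun y => ?_, fun y => ?_, fun y w => ?_⟩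
  · rw [e, e, sub_self, norm_zero]; positivity
  · rw [e, norm_zero]; positivity
  · simp
  · simp; positivity

lemma HasCompactSupport.exists_bound_lipschitz {V W : Type*} [NormedAddCommGroup V]
    [NormedSpace ℝ V] [NormedAddCommGroup W] [NormedSpace ℝ W] {f : V → W}
    (hc : HasCompactSupport f) (hf : ContDiff ℝ 1 f) :
    ∃ L, 0 ≤ L ∧ (∀ x, ‖f x‖ ≤ L) ∧ ∀ x y, ‖f x - f y‖ ≤ L * ‖x - y‖ := by
  obtain ⟨B, hB⟩ := hc.exists_bound_of_continuous hf.continuous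
  obtain ⟨C, hC⟩ := ContDiff.lipschitzWith_of_hasCompactSupport hc hf one_ne_zero
  have hB0 : 0 ≤ B := (norm_nonneg _).trans (hB 0)
  refine ⟨B + C, by positivity, fun x => (hB x).trans (by simp), fun x y =>
    (hC.norm_sub_le x y).trans ?_⟩
  gcongr
  linarith

lemma hasCompactSupport_action {V : Type*} [NormedAddCommGroup V] [NormedSpace ℝ V] {H : V → ℝ}
    (hc : HasCompactSupport H) (A : V → V) :
    HasCompactSupport fun z => fderiv ℝ H z (A z) / 2 - H z := by
  refine HasCompactSupport.intro hc fun z hz => ?_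
  rw [fderiv_of_notMem_tsupport ℝ hz, image_eq_zero_of_notMem_tsupport hz]
  simp

lemma exists_outBounds {H : Esp n × ℝ → ℝ} (hc : HasCompactSupport H) (hH : ContDiff ℝ ∞ H) :
    ∃ L, 0 ≤ L ∧ OutBounds L fun s y => H (y, s) := by
  set T : (Esp n × ℝ →L[ℝ] ℝ) →L[ℝ] Esp n :=
    symplGrad.comp ((ContinuousLinearMap.compL ℝ _ _ ℝ).flip (.inl ℝ (Esp n) ℝ))
  have hsm : ∀ s, ContDiff ℝ ∞ fun y => H (y, s) := fun s =>
    hH.comp (contDiff_id.prodMk contDiff_const)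
  have hfd : ∀ s y, fderiv ℝ (fun y => H (y, s)) y = (fderiv ℝ H (y, s)).comp (.inl ℝ _ _) :=
    fun s y => (HasFDerivAt.comp (g := H) y ((hH.differentiable (by simp)) (y, s)).hasFDerivAt
      (hasFDerivAt_prodMk_left y s)).fderiv
  have hX : ∀ s y, hamVF (fun y => H (y, s)) y = T (fderiv ℝ H (y, s)) := fun s y => by
    rw [hamVF_eq_symplGrad ((hsm s).differentiable (by simp) y), hfd]
    rfl
  have hG : ∀ s y, fderiv ℝ (fun y => H (y, s)) y y = fderiv ℝ H (y, s) ((y, s).1, 0) :=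
    fun s y => by rw [hfd]; rfl
  have hdH : ContDiff ℝ 1 (fderiv ℝ H) := hH.fderiv_right (by norm_cast)
  obtain ⟨L₁, hL₁, h₁, h₁'⟩ := ((hc.fderiv (𝕜 := ℝ)).comp_left (map_zero T)).exists_bound_lipschitz
    (T.contDiff.comp hdH)
  obtain ⟨L₂, hL₂, h₂, h₂'⟩ := (hasCompactSupport_action hc fun z => (z.1, 0)).exists_bound_lipschitz
    (((hdH.clm_apply (contDiff_fst.prodMk contDiff_const)).div_const 2).sub
      (hH.of_le (by norm_cast)))
  have hn : ∀ s t (y w : Esp n), ‖(y, s) - (w, t)‖ ≤ |s - t| + ‖y - w‖ := fun s t y w =>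
    max_le (le_add_of_nonneg_left (abs_nonneg _)) (le_add_of_nonneg_right (norm_nonneg _))
  refine ⟨L₁ + L₂, by positivity, fun s => (hsm s).of_le (by norm_cast),
    fun s t y w => ?_, fun s y => ?_, fun s y => ?_, fun s y w => ?_⟩
  · rw [hX, hX]
    refine (h₁' (y, s) (w, t)).trans ?_
    gcongr
    · linarith
    · exact hn s t y w
  · rw [hX]
    exact (h₁ (y, s)).trans (by linarith)
  · rw [hG]
    exact (h₂ (y, s)).trans (by linarith)
  · rw [hG, hG]
    refine (h₂' (y, s) (w, s)).trans ?_
    gcongr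
    · linarith
    · simp

lemma exists_turnBounds_comp {V : Type*} [NormedAddCommGroup V] [NormedSpace ℝ V] {ψ : V → ℝ}
    (hc : HasCompactSupport ψ) (hψ : ContDiff ℝ ∞ ψ) (A : Esp n →L[ℝ] V) :
    ∃ L, TurnBounds L fun y => ψ (A y) := by
  set T : (V →L[ℝ] ℝ) →L[ℝ] Esp n := symplGrad.comp ((ContinuousLinearMap.compL ℝ _ _ ℝ).flip A)
  have hsm : ContDiff ℝ ∞ fun y => ψ (A y) := hψ.comp A.contDiff
  have hfd : ∀ y, fderiv ℝ (fun y => ψ (A y)) y = (fderiv ℝ ψ (A y)).comp A := fun y =>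
    (HasFDerivAt.comp (g := ψ) y ((hψ.differentiable (by simp)) (A y)).hasFDerivAt
      A.hasFDerivAt).fderiv
  have hX : ∀ y, hamVF (fun y => ψ (A y)) y = T (fderiv ℝ ψ (A y)) := fun y => by
    rw [hamVF_eq_symplGrad (hsm.differentiable (by simp) y), hfd]
    rfl
  have hG : ∀ y, fderiv ℝ (fun y => ψ (A y)) y y = fderiv ℝ ψ (A y) (A y) :=
    fun y => by rw [hfd]; rfl
  have hdψ : ContDiff ℝ 1 (fderiv ℝ ψ) := hψ.fderiv_right (by norm_cast)
  obtain ⟨L₁, hL₁, h₁, h₁'⟩ := ((hc.fderiv (𝕜 := ℝ)).comp_left (map_zero T)).exists_bound_lipschitz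
    (T.contDiff.comp hdψ)
  obtain ⟨L₂, hL₂, h₂, h₂'⟩ := (hasCompactSupport_action hc fun z => z).exists_bound_lipschitz
    (((hdψ.clm_apply contDiff_id).div_const 2).sub (hψ.of_le (by norm_cast)))
  have hA : ∀ {a : ℝ}, 0 ≤ a → a ≤ L₁ + L₂ → ∀ y w, a * ‖A y - A w‖ ≤
      (L₁ + L₂) * (1 + ‖A‖) * ‖y - w‖ := fun ha hab y w => by
    rw [← map_sub, mul_assoc]
    gcongr
    refine (A.le_opNorm _).trans ?_
    gcongr
    linarith
  have hL : L₁ + L₂ ≤ (L₁ + L₂) * (1 + ‖A‖) := le_mul_of_one_le_right (by positivity) (by simp)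
  refine ⟨(L₁ + L₂) * (1 + ‖A‖), by positivity, hsm.of_le (by norm_cast),
    fun y w => ?_, fun y => ?_, fun y => ?_, fun y w => ?_⟩
  · rw [hX, hX]
    exact (h₁' (A y) (A w)).trans (hA hL₁ (by linarith) y w)
  · rw [hX]
    refine ((h₁ (A y)).trans (by linarith)).trans (hL.trans ?_)
    exact le_mul_of_one_le_right (by positivity) (by simp)
  · rw [hG]
    exact ((h₂ (A y)).trans (by linarith)).trans hL
  · rw [hG, hG]
    exact (h₂' (A y) (A w)).trans (hA hL₂ (by linarith) y w)

end HamiltonianBounds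

section PlaneRotation

variable {n : ℕ}

/-- The coordinate `xᵢ`. -/
def posCoord (i : Fin n) : Esp n →L[ℝ] ℝ :=
  (EuclideanSpace.proj i : EuclideanSpace ℝ (Fin n) →L[ℝ] ℝ).comp (.fst ℝ _ _)

/-- The coordinate `ξᵢ`. -/
def momCoord (i : Fin n) : Esp n →L[ℝ] ℝ :=
  (EuclideanSpace.proj i : EuclideanSpace ℝ (Fin n) →L[ℝ] ℝ).comp (.snd ℝ _ _)

@[simp] lemma posCoord_apply (i : Fin n) (y : Esp n) : posCoord i y = y.1 i := rfl

@[simp] lemma momCoord_apply (i : Fin n) (y : Esp n) : momCoord i y = y.2 i := rfl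

/-- The projection to the `i`-th symplectic coordinate plane. -/
def planeProj (i : Fin n) : Esp n →L[ℝ] Esp n :=
  (posCoord i).smulRight (EuclideanSpace.single i (1 : ℝ), 0) +
    (momCoord i).smulRight (0, EuclideanSpace.single i (1 : ℝ))

/-- The field `rotField` in the `i`-th symplectic coordinate plane. -/
def planeRot (i : Fin n) : Esp n →L[ℝ] Esp n :=
  (momCoord i).smulRight (EuclideanSpace.single i (1 : ℝ), 0) -
    (posCoord i).smulRight (0, EuclideanSpace.single i (1 : ℝ))

lemma planeProj_apply (i : Fin n) (y : Esp n) : planeProj i y =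
    (y.1 i • EuclideanSpace.single i (1 : ℝ), y.2 i • EuclideanSpace.single i (1 : ℝ)) := by
  ext1 <;> simp [planeProj]

lemma planeRot_apply (i : Fin n) (y : Esp n) : planeRot i y =
    (y.2 i • EuclideanSpace.single i (1 : ℝ), -(y.1 i • EuclideanSpace.single i (1 : ℝ))) := by
  ext1 <;> simp [planeRot]

lemma planeRot_planeProj (i : Fin n) (y : Esp n) : planeRot i (planeProj i y) = planeRot i y := by
  simp [planeRot_apply, planeProj_apply]

lemma planeRot_planeRot (i : Fin n) (y : Esp n) : planeRot i (planeRot i y) = -planeProj i y := by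
  simp [planeRot_apply, planeProj_apply]

lemma norm_planeProj_le (i : Fin n) (y : Esp n) : ‖planeProj i y‖ ≤ ‖y‖ := by
  rw [planeProj_apply]
  refine max_le ?_ ?_
  · simpa [norm_smul] using (PiLp.norm_apply_le y.1 i).trans (norm_fst_le y)
  · simpa [norm_smul] using (PiLp.norm_apply_le y.2 i).trans (norm_snd_le y)

lemma norm_planeRot_le (i : Fin n) (y : Esp n) : ‖planeRot i y‖ ≤ ‖y‖ := by
  rw [planeRot_apply]
  refine max_le ?_ ?_
  · simpa [norm_smul] using (PiLp.norm_apply_le y.2 i).trans (norm_snd_le y)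
  · simpa [norm_smul] using (PiLp.norm_apply_le y.1 i).trans (norm_fst_le y)

lemma symplGrad_posCoord (i : Fin n) :
    symplGrad (posCoord i) = (0, -EuclideanSpace.single i (1 : ℝ)) := by
  refine Prod.ext ((LinearIsometryEquiv.symm_apply_eq _).2 ?_)
    (congrArg Neg.neg ((LinearIsometryEquiv.symm_apply_eq _).2 ?_))
  · ext v; simp
  · ext v; simp [EuclideanSpace.inner_single_left]

lemma symplGrad_momCoord (i : Fin n) :
    symplGrad (momCoord i) = (EuclideanSpace.single i (1 : ℝ), 0) := by
  refine Prod.ext ((LinearIsometryEquiv.symm_apply_eq _).2 ?_)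
    ((congrArg Neg.neg ((LinearIsometryEquiv.symm_apply_eq _).2 ?_)).trans neg_zero)
  · ext v; simp [EuclideanSpace.inner_single_left]
  · ext v; simp

lemma contDiff_planeSq {m : WithTop ℕ∞} (i : Fin n) : ContDiff ℝ m (planeSq i) :=
  ((posCoord i).contDiff.pow 2).add ((momCoord i).contDiff.pow 2)

lemma hasFDerivAt_planeSq (i : Fin n) (y : Esp n) : HasFDerivAt (planeSq i)
    ((2 * y.1 i) • posCoord i + (2 * y.2 i) • momCoord i) y := by
  have h := ((posCoord i).hasFDerivAt (x := y)).pow 2 |>.add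
    (((momCoord i).hasFDerivAt (x := y)).pow 2)
  refine h.congr_fderiv ?_
  ext v <;> simp

lemma hamVF_planeSq (i : Fin n) (y : Esp n) : hamVF (planeSq i) y = (2 : ℝ) • planeRot i y := by
  rw [hamVF_eq_symplGrad (hasFDerivAt_planeSq i y).differentiableAt, (hasFDerivAt_planeSq i y).fderiv,
    map_add, map_smul, map_smul, symplGrad_posCoord, symplGrad_momCoord, planeRot_apply]
  ext1 <;> simp [smul_smul]

lemma action_planeSq (i : Fin n) (y : Esp n) :
    fderiv ℝ (fun y => Real.pi * planeSq i y) y y / 2 - Real.pi * planeSq i y = 0 := by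
  rw [fderiv_const_mul (hasFDerivAt_planeSq i y).differentiableAt, (hasFDerivAt_planeSq i y).fderiv]
  simp [planeSq]
  ring

lemma hamVF_pi_mul_planeSq (i : Fin n) (y : Esp n) :
    hamVF (fun y => Real.pi * planeSq i y) y = (2 * Real.pi) • planeRot i y := by
  rw [hamVF_const_mul, hamVF_planeSq, smul_smul, mul_comm]

lemma turnBounds_planeSq (i : Fin n) :
    TurnBounds (2 * Real.pi) fun y : Esp n => Real.pi * planeSq i y := by
  have hpi : |2 * Real.pi| = 2 * Real.pi := abs_of_pos (by positivity)
  refine ⟨by positivity, contDiff_const.mul (contDiff_planeSq i), fun y w => ?_, fun y => ?_,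
    fun y => ?_, fun y w => ?_⟩
  · rw [hamVF_pi_mul_planeSq, hamVF_pi_mul_planeSq, ← smul_sub, ← map_sub, norm_smul,
      Real.norm_eq_abs, hpi]
    gcongr
    exact norm_planeRot_le i _
  · rw [hamVF_pi_mul_planeSq, norm_smul, Real.norm_eq_abs, hpi]
    gcongr
    linarith [norm_planeRot_le i y]
  · rw [action_planeSq, abs_zero]; positivity
  · rw [action_planeSq, action_planeSq, sub_zero, abs_zero]; positivity

lemma hasLoop_planeSq (i : Fin n) (w : Esp n) :
    HasLoop (8 * Real.pi ^ 2 * (1 + ‖w‖)) (hamVF fun y => Real.pi * planeSq i y)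
      (fun y => fderiv ℝ (fun y => Real.pi * planeSq i y) y y / 2 - Real.pi * planeSq i y) w := by
  have hpi := Real.pi_pos
  set γ : ℝ → Esp n := fun t => w + (Real.cos (2 * Real.pi * t) - 1) • planeProj i w +
    Real.sin (2 * Real.pi * t) • planeRot i w with hγ
  have hY : ∀ t, hamVF (fun y => Real.pi * planeSq i y) (γ t) = (2 * Real.pi) •
      (Real.cos (2 * Real.pi * t) • planeRot i w - Real.sin (2 * Real.pi * t) • planeProj i w) :=
    fun t => by
      rw [hamVF_pi_mul_planeSq, hγ]
      simp only [map_add, map_smul, planeRot_planeProj, planeRot_planeRot]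
      module
  refine ⟨γ, ⟨fun t _ => ?_, fun s _ t _ => ?_⟩, by simp [hγ], by simp [hγ],
    fun t _ => action_planeSq i (γ t)⟩
  · have ht : HasDerivAt (fun t => 2 * Real.pi * t) (2 * Real.pi) t := by
      simpa using (hasDerivAt_id t).const_mul (2 * Real.pi)
    rw [hY]
    refine ((((ht.cos.sub_const 1).smul_const (planeProj i w)).const_add w).add
      (ht.sin.smul_const (planeRot i w))).congr_deriv ?_
    module
  · have hcos : ∀ s t : ℝ, |Real.cos s - Real.cos t| ≤ |s - t| := fun s t => by
      simpa [Real.dist_eq] using Real.lipschitzWith_cos.dist_le_mul s t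
    have hsin : ∀ s t : ℝ, |Real.sin s - Real.sin t| ≤ |s - t| := fun s t => by
      simpa [Real.dist_eq] using Real.lipschitzWith_sin.dist_le_mul s t
    have hst : |2 * Real.pi * s - 2 * Real.pi * t| = 2 * Real.pi * |s - t| := by
      rw [← mul_sub, abs_mul, abs_of_pos (by positivity)]
    have hc := hcos (2 * Real.pi * s) (2 * Real.pi * t)
    have hs := hsin (2 * Real.pi * s) (2 * Real.pi * t)
    rw [hst] at hc hs
    simp only [hY]
    have e : (2 * Real.pi) • (Real.cos (2 * Real.pi * s) • planeRot i w -
        Real.sin (2 * Real.pi * s) • planeProj i w) - (2 * Real.pi) •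
        (Real.cos (2 * Real.pi * t) • planeRot i w - Real.sin (2 * Real.pi * t) • planeProj i w) =
        (2 * Real.pi) • ((Real.cos (2 * Real.pi * s) - Real.cos (2 * Real.pi * t)) • planeRot i w -
        (Real.sin (2 * Real.pi * s) - Real.sin (2 * Real.pi * t)) • planeProj i w) := by module
    rw [e, norm_smul, Real.norm_eq_abs, abs_of_pos (by positivity : 0 < 2 * Real.pi)]
    calc _ ≤ 2 * Real.pi * (2 * Real.pi * |s - t| * ‖w‖ + 2 * Real.pi * |s - t| * ‖w‖) := by
          gcongr
          refine norm_sub_le_of_le ?_ ?_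
          · rw [norm_smul, Real.norm_eq_abs]
            gcongr
            exact norm_planeRot_le i w
          · rw [norm_smul, Real.norm_eq_abs]
            gcongr
            exact norm_planeProj_le i w
      _ = 8 * Real.pi ^ 2 * ‖w‖ * |s - t| := by ring
      _ ≤ _ := by gcongr; linarith

/-- At a zero of a nonnegative Hamiltonian the constant orbit is a loop of action zero. -/
lemma hasLoop_of_isMinimum {K : ℝ} (hK : 0 ≤ K) {g : Esp n → ℝ} (hg : ContDiff ℝ 2 g)
    (hg0 : ∀ y, 0 ≤ g y) {w : Esp n} (hw : g w = 0) :
    HasLoop K (hamVF g) (fun y => fderiv ℝ g y y / 2 - g y) w := by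
  have hmin : IsLocalMin g w := Eventually.of_forall fun y => hw.trans_le (hg0 y)
  have h0 : hamVF g w = 0 := by
    rw [hamVF_eq_symplGrad (hg.differentiable (by norm_num) w), hmin.fderiv_eq_zero, map_zero]
  refine ⟨fun _ => w, ⟨fun t _ => ?_, fun s _ t _ => ?_⟩, rfl, rfl, fun t _ => ?_⟩
  · exact (hasDerivAt_const t w).congr_deriv h0.symm
  · simpa using mul_nonneg hK (abs_nonneg (s - t))
  · simp [hmin.fderiv_eq_zero, hw]

/-- A Hamiltonian that vanishes in the cylinder of radius `r` and is close to `π (xᵢ² + ξᵢ²)`. -/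
lemma exists_cutoff_planeSq {r r₁ : ℝ} (hr : 0 < r) (hrr : r < r₁) (i : Fin n) :
    ∃ (f : Esp n → ℝ) (L : ℝ), TurnBounds L f ∧ (∀ y, 0 ≤ f y) ∧
      (∀ y, planeSq i y ≤ r ^ 2 → f y = 0) ∧ (∀ y, f y ≤ Real.pi * planeSq i y) ∧
      ∀ y, Real.pi * planeSq i y ≤ f y + Real.pi * r₁ ^ 2 := by
  have hpi := Real.pi_pos
  have hr₁ : r ^ 2 < r₁ ^ 2 := by gcongr
  have hd : 0 < r₁ ^ 2 - r ^ 2 := sub_pos.2 hr₁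
  set θ : ℝ → ℝ := fun t => Real.smoothTransition ((t - r ^ 2) / (r₁ ^ 2 - r ^ 2)) with hθ
  have hθ0 : ∀ t ≤ r ^ 2, θ t = 0 := fun t ht =>
    Real.smoothTransition.zero_of_nonpos (div_nonpos_of_nonpos_of_nonneg (by linarith) hd.le)
  have hθ1 : ∀ t ≥ r₁ ^ 2, θ t = 1 := fun t ht =>
    Real.smoothTransition.one_of_one_le ((one_le_div hd).2 (by linarith))
  have hθnn : ∀ t, 0 ≤ θ t := fun t => Real.smoothTransition.nonneg _
  have hθle : ∀ t, θ t ≤ 1 := fun t => Real.smoothTransition.le_one _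
  have hθs : ContDiff ℝ ∞ θ := Real.smoothTransition.contDiff.comp
    ((contDiff_id.sub contDiff_const).div_const _)
  set ψ : ℝ × ℝ → ℝ := fun z => Real.pi * (z.1 ^ 2 + z.2 ^ 2 - r ^ 2) *
    (θ (z.1 ^ 2 + z.2 ^ 2) - 1) with hψ
  have hsq : ContDiff ℝ ∞ fun z : ℝ × ℝ => z.1 ^ 2 + z.2 ^ 2 :=
    (contDiff_fst.pow 2).add (contDiff_snd.pow 2)
  have hψs : ContDiff ℝ ∞ ψ := (contDiff_const.mul (hsq.sub contDiff_const)).mul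
    ((hθs.comp hsq).sub contDiff_const)
  have hψc : HasCompactSupport ψ := by
    refine HasCompactSupport.intro (isCompact_closedBall 0 r₁) fun z hz => ?_
    rw [mem_closedBall_zero_iff, not_le, Prod.norm_def, lt_max_iff] at hz
    have hz' : r₁ ^ 2 ≤ z.1 ^ 2 + z.2 ^ 2 := by
      rcases hz with hz | hz
      · nlinarith [sq_lt_sq' (by linarith [norm_nonneg z.1]) hz, sq_nonneg z.2, sq_abs z.1,
          Real.norm_eq_abs z.1]
      · nlinarith [sq_lt_sq' (by linarith [norm_nonneg z.2]) hz, sq_nonneg z.1, sq_abs z.2,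
          Real.norm_eq_abs z.2]
    simp [hψ, hθ1 _ hz']
  obtain ⟨L, hL⟩ := exists_turnBounds_comp hψc hψs ((posCoord i).prod (momCoord i))
  have hf : ∀ y : Esp n, Real.pi * planeSq i y + -(Real.pi * r ^ 2) +
      ψ ((posCoord i).prod (momCoord i) y) = Real.pi * (planeSq i y - r ^ 2) * θ (planeSq i y) :=
    fun y => by simp only [hψ, planeSq, ContinuousLinearMap.prod_apply, posCoord_apply,
      momCoord_apply]; ring
  have hb := ((turnBounds_planeSq i).add (TurnBounds.const (-(Real.pi * r ^ 2)))).add hL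
  simp only [hf] at hb
  refine ⟨_, _, hb, fun y => ?_, fun y hy => ?_, fun y => ?_, fun y => ?_⟩
  · rcases le_total (planeSq i y) (r ^ 2) with hy | hy
    · simp [hθ0 _ hy]
    · have := hθnn (planeSq i y)
      have := sub_nonneg.2 hy
      positivity
  · simp [hθ0 _ hy]
  · rcases le_total (planeSq i y) (r ^ 2) with hy | hy
    · simpa [hθ0 _ hy] using mul_nonneg hpi.le (planeSq_nonneg i y)
    · rw [mul_assoc]
      gcongr
      refine (mul_le_of_le_one_right (sub_nonneg.2 hy) (hθle _)).trans ?_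
      linarith [sq_nonneg r]
  · rw [mul_assoc, ← mul_add]
    gcongr
    rcases le_total (planeSq i y) (r₁ ^ 2) with hy | hy
    · rcases le_total (planeSq i y) (r ^ 2) with hy' | hy'
      · simpa [hθ0 _ hy'] using hy
      · have := mul_nonneg (sub_nonneg.2 hy') (hθnn (planeSq i y))
        linarith
    · rw [hθ1 _ hy]
      linarith

end PlaneRotation

section FlowCutoff

variable {n : ℕ}

open scoped Manifold in
lemma exists_hasCompactSupport_eventuallyEq {V : Type*} [NormedAddCommGroup V] [NormedSpace ℝ V]
    [FiniteDimensional ℝ V] {U S : Set V} (hU : IsOpen U) (hS : IsCompact S) (hSU : S ⊆ U)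
    {h : V → ℝ} (hh : ContDiffOn ℝ ∞ h U) :
    ∃ H : V → ℝ, ContDiff ℝ ∞ H ∧ HasCompactSupport H ∧ ∀ x ∈ S, H =ᶠ[𝓝 x] h := by
  obtain ⟨T, hT, hST, hTU⟩ := exists_compact_between hS hU hSU
  obtain ⟨ζ, h1, h0, -⟩ := exists_contMDiffMap_one_nhds_of_subset_interior (n := ⊤) 𝓘(ℝ, V)
    hS.isClosed hST
  refine ⟨fun x => ζ x * h x, contDiff_iff_contDiffAt.2 fun x => ?_,
    HasCompactSupport.intro hT fun x hx => by simp [h0 x hx], fun x hx => ?_⟩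
  · by_cases hx : x ∈ U
    · exact ζ.contMDiff.contDiff.contDiffAt.mul (hh.contDiffAt (hU.mem_nhds hx))
    · have hTx : Tᶜ ∈ 𝓝 x := hT.isClosed.isOpen_compl.mem_nhds fun hxT => hx (hTU hxT)
      refine (contDiffAt_const (c := (0 : ℝ))).congr_of_eventuallyEq ?_
      filter_upwards [hTx] with y hy
      simp [h0 y hy]
  · filter_upwards [h1.filter_mono (nhds_le_nhdsSet hx)] with y hy
    simp [hy]

lemma hamVF_congr {h h' : Esp n → ℝ} {p : Esp n} (hh : h =ᶠ[𝓝 p] h') : hamVF h p = hamVF h' p := by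
  have h1 : (fun η => h (p.1, η)) =ᶠ[𝓝 p.2] fun η => h' (p.1, η) :=
    (Continuous.prodMk_right p.1).continuousAt.eventually hh
  have h2 : (fun y => h (y, p.2)) =ᶠ[𝓝 p.1] fun y => h' (y, p.2) :=
    (Continuous.prodMk_left p.2).continuousAt.eventually hh
  rw [hamVF, hamVF, gradient, gradient, gradient, gradient, h1.fderiv_eq, h2.fderiv_eq]

lemma OutBounds.isFlowCurve {L : ℝ} {h : ℝ → Esp n → ℝ} (hL : 0 ≤ L) (hh : OutBounds L h)
    {σ : ℝ → Esp n} (hσ : ∀ t ∈ Icc (0 : ℝ) 1, HasDerivAt σ (hamVF (h t) (σ t)) t) :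
    IsFlowCurve (L * (1 + L)) (fun s => hamVF (h s)) σ := by
  refine ⟨hσ, fun s hs t ht => (hh.field_lip s t _ _).trans ?_⟩
  have h1 := (convex_Icc (0 : ℝ) 1).norm_image_sub_le_of_norm_hasDerivWithin_le
    (fun t ht => (hσ t ht).hasDerivWithinAt) (fun t _ => hh.field_le t (σ t)) ht hs
  rw [Real.norm_eq_abs] at h1
  rw [mul_assoc, add_mul, one_mul]
  gcongr

lemma circlePt_mem_elZero {v : EuclideanSpace ℝ (Fin n)} (hv : ‖v‖ = 1) (t : ℝ) :
    circlePt v t ∈ elZero n := by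
  refine ⟨by rw [sq_norm_circlePt, hv, one_pow], fun hli => ?_⟩
  have h0 := LinearIndependent.pair_iff.1 hli (Real.cos t) (-Real.sin t) (by
    simp only [circlePt]; module)
  have := Real.sin_sq_add_cos_sq t
  rw [h0.1, neg_eq_zero.1 h0.2] at this
  norm_num at this

/-- The Hamiltonian of a flow may be cut off away from the orbits of the closed unit ball. -/
lemma exists_outBounds_flow {a b : ℝ} {Φ : Esp n × ℝ → Esp n} {h : Esp n × ℝ → ℝ} (ha : a < 0)
    (hb : 1 < b) (hΦ : ContDiffOn ℝ ∞ Φ (univ ×ˢ Ioo a b)) (hh : ContDiffOn ℝ ∞ h (univ ×ˢ Ioo a b))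
    (hflow : ∀ p, ∀ s ∈ Ioo a b,
      HasDerivAt (fun t => Φ (p, t)) (hamVF (fun q => h (q, s)) (Φ (p, s))) s) :
    ∃ (H : ℝ → Esp n → ℝ) (L : ℝ), 0 ≤ L ∧ OutBounds L H ∧ ∀ p, ‖p‖ ≤ 1 →
      IsFlowCurve (L * (1 + L)) (fun s => hamVF (H s)) fun t => Φ (p, t) := by
  have hI : Icc (0 : ℝ) 1 ⊆ Ioo a b := fun s hs => ⟨ha.trans_le hs.1, hs.2.trans_lt hb⟩
  set B : Set (Esp n × ℝ) := Metric.closedBall 0 1 ×ˢ Icc 0 1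
  have hB : B ⊆ univ ×ˢ Ioo a b := prod_mono (subset_univ _) hI
  have hBc : IsCompact B := (isCompact_closedBall 0 1).prod isCompact_Icc
  have hBI : (fun z => (Φ z, z.2)) '' B ⊆ univ ×ˢ Ioo a b := by
    rintro _ ⟨z, hz, rfl⟩
    exact ⟨mem_univ _, (hB hz).2⟩
  obtain ⟨H, hH, hHc, hHh⟩ := exists_hasCompactSupport_eventuallyEq (isOpen_univ.prod isOpen_Ioo)
    (hBc.image_of_continuousOn ((hΦ.continuousOn.mono hB).prodMk continuousOn_snd)) hBI hh
  obtain ⟨L, hL, hHL⟩ := exists_outBounds hHc hH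
  refine ⟨fun s y => H (y, s), L, hL, hHL, fun p hp => hHL.isFlowCurve hL fun t ht => ?_⟩
  refine (hflow p t (hI ht)).congr_deriv (hamVF_congr (EventuallyEq.symm ?_))
  exact (Continuous.prodMk_left t).continuousAt.eventually
    (hHh (Φ (p, t), t) ⟨(p, t), ⟨mem_closedBall_zero_iff.2 hp, ht⟩, rfl⟩)

end FlowCutoff

end

/-- nonsqueezing for `L₀`.  For `0 < r < 1/√2` there is no
Hamiltonian isotopy (defined on an open interval containing `0` and `1`) whose time-one map
sends `L₀` into the cylinder `{(x,ξ) : x₁² + ξ₁² ≤ r²}`. -/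
theorem stmt_3 (n : ℕ) (hn : 1 ≤ n) (r : ℝ) (hr0 : 0 < r) (hr1 : r < 1 / Real.sqrt 2) :
    ¬ ∃ (a b : ℝ) (Φ : Esp n × ℝ → Esp n) (h : Esp n × ℝ → ℝ),
        a < 0 ∧ 1 < b ∧
        ContDiffOn ℝ ∞ Φ (Set.univ ×ˢ Set.Ioo a b) ∧
        ContDiffOn ℝ ∞ h (Set.univ ×ˢ Set.Ioo a b) ∧
        (∀ p : Esp n, Φ (p, 0) = p) ∧
        (∀ (p : Esp n), ∀ s ∈ Set.Ioo a b,
          HasDerivAt (fun t => Φ (p, t)) (hamVF (fun q => h (q, s)) (Φ (p, s))) s) ∧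
        (∀ p ∈ elZero n,
          (Φ (p, 1)).1 ⟨0, hn⟩ ^ 2 + (Φ (p, 1)).2 ⟨0, hn⟩ ^ 2 ≤ r ^ 2) := by
  rintro ⟨a, b, Φ, h, ha, hb, hΦ, hh, hΦ0, hflow, hcyl⟩
  have hpi := Real.pi_pos
  obtain ⟨r₁, hrr₁, hr₁⟩ := exists_between hr1
  have hr₁0 : 0 < r₁ := hr0.trans hrr₁
  have hr₁sq : r₁ ^ 2 < 1 / 2 := by
    calc r₁ ^ 2 < (1 / √2) ^ 2 := by gcongr
      _ = 1 / 2 := by rw [div_pow, one_pow, Real.sq_sqrt zero_le_two]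
  have hκ : 0 < Real.pi * r₁ ^ 2 / 2 := by positivity
  obtain ⟨κ, hκκ, hκ4⟩ := exists_between (show Real.pi * r₁ ^ 2 / 2 < Real.pi / 4 by nlinarith)
  have hκ0 : 0 ≤ κ := (hκ.trans hκκ).le
  obtain ⟨H, L, hL, hHL, hHσ⟩ := exists_outBounds_flow ha hb hΦ hh hflow
  obtain ⟨f, M, hfM, hf0, hfr, hf_le, hf_ge⟩ :=
    exists_cutoff_planeSq (n := n) hr0 hrr₁ ⟨0, hn⟩
  have hM := hfM.nonneg
  have hK : 0 ≤ L * (1 + L) := by positivity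
  obtain ⟨N₁, hN₁⟩ := LoopBounds.eventually_no_critical (n := n) (L := L + |0|) (K := 0)
    (by positivity) le_rfl hκ0 hκ4
  obtain ⟨N₂, hN₂⟩ := LoopBounds.eventually_no_critical (n := n) (L := L + M) (by positivity) hK
    hκ0 hκ4
  obtain ⟨N₃, hN₃⟩ := LoopBounds.eventually_no_critical (n := n) (L := L + 2 * Real.pi)
    (K := 8 * Real.pi ^ 2) (by positivity) (by positivity) hκ0 hκ4
  set N := max (max N₁ N₂) (max N₃ 1) with hN
  have habs : ∀ l ∈ Set.Icc (0 : ℝ) 1, |l| ≤ 1 := fun l hl => (abs_of_nonneg hl.1).trans_le hl.2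
  refine false_of_noCriticalLevel_loopAction (N := N) (κ := Real.pi * r₁ ^ 2 / 2) ⟨0, hn⟩
    (by omega) hκ hκκ hHL.contDiff hfM.contDiff hf_le
    (fun y => (hf_ge y).trans_eq (by ring)) (fun l hl => ?_) (fun l hl => ?_) (fun l hl => ?_)
  · refine hN₁ N (by omega) l H _ (hHL.loopBounds hL (TurnBounds.const 0)) (habs l hl)
      (Or.inl fun w => ?_)
    exact hasLoop_of_isMinimum (by simp) contDiff_const (fun _ => le_rfl) rfl
  · have hb := hfM.const_mul (habs l hl)
    refine hN₂ N (by omega) 1 H _ (hHL.loopBounds hL hb) (by simp)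
      (Or.inr ⟨rfl, fun v t hv => ⟨_, hHσ (circlePt v t) (hv ▸ norm_circlePt_le v t), hΦ0 _,
        hasLoop_of_isMinimum hK hb.contDiff (fun y => mul_nonneg hl.1 (hf0 y)) ?_⟩⟩)
    rw [hfr _ (hcyl _ (circlePt_mem_elZero hv t)), mul_zero]
  · exact hN₃ N (by omega) l H _ (hHL.loopBounds hL (turnBounds_planeSq _)) (habs l hl)
      (Or.inl (hasLoop_planeSq _))
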